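/- For every natural number k ≥ 2 there exist an infinite-dimensional separable real Banach space X and a bounded linear operator S : X → X with S^k = 0, S^(k-1) ≠ 0, S strictly singular and not compact, such that every bounded linear operator T : X → X can be written T = ∑_{i=0}^{k-1} λ_i S^i + K with λ_i ∈ ℝ and K compact, and moreover every bounded linear operator T : X → X admits a closed linear subspace W of X with W ≠ {0}, W ≠ X and T(W) ⊆ W (a non-trivial proper closed invariant subspace). -/

import Mathlib

/-- A bounded linear operator is strictly singular if for every infinite-dimensional
subspace `Y` and every `c > 0` there is `y ∈ Y` with `‖S y‖ < c * ‖y‖`. -/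
def StrictlySingular {X : Type*} [NormedAddCommGroup X] [NormedSpace ℝ X]
    (S : X →L[ℝ] X) : Prop :=
  ∀ Y : Submodule ℝ X, ¬FiniteDimensional ℝ Y → ∀ c : ℝ, 0 < c → ∃ y ∈ Y, ‖S y‖ < c * ‖y‖

namespace BD

open Finset

/-- The parameters `(m_j, n_j)`. -/
def mn : ℕ → ℕ × ℕ
  | 0 => (4, 1)
  | j + 1 =>
    (4 * (mn j).2 ^ 2 * (mn j).1 ^ 2,
      (4 * (mn j).2 ^ 2 * (mn j).1 ^ 2) ^ 3 *
        (6 * (mn j).2) ^ (4 * (mn j).2 ^ 2 * (mn j).1 ^ 2 + 2))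

def mm (j : ℕ) : ℕ := (mn j).1
def nn (j : ℕ) : ℕ := (mn j).2

theorem mm_succ (j : ℕ) : mm (j + 1) = 4 * nn j ^ 2 * mm j ^ 2 := by simp [mm, nn, mn]
theorem nn_succ (j : ℕ) :
    nn (j + 1) = mm (j + 1) ^ 3 * (6 * nn j) ^ (mm (j + 1) + 2) := by simp [mm, nn, mn]
theorem mm_zero : mm 0 = 4 := by simp [mm, mn]
theorem nn_zero : nn 0 = 1 := by simp [nn, mn]

theorem four_le_mm_one_le_nn (j : ℕ) : 4 ≤ mm j ∧ 1 ≤ nn j := by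
  induction j with
  | zero => simp [mm_zero, nn_zero]
  | succ j ih =>
    obtain ⟨h1, h2⟩ := ih
    have h3 : 4 ≤ mm (j + 1) := by
      rw [mm_succ]
      have : 1 ≤ nn j ^ 2 := Nat.one_le_pow _ _ h2
      have : 1 ≤ mm j ^ 2 := Nat.one_le_pow _ _ (by omega)
      calc 4 = 4 * 1 * 1 := by norm_num
        _ ≤ _ := by gcongr
    refine ⟨h3, ?_⟩
    rw [nn_succ]
    apply Nat.one_le_iff_ne_zero.2
    positivity

theorem four_le_mm (j : ℕ) : 4 ≤ mm j := (four_le_mm_one_le_nn j).1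
theorem one_le_nn (j : ℕ) : 1 ≤ nn j := (four_le_mm_one_le_nn j).2

theorem four_mul_nn_mul_le (j : ℕ) : 4 * nn j * mm j ^ 2 ≤ mm (j + 1) := by
  rw [mm_succ]
  have := one_le_nn j
  gcongr
  nlinarith

theorem sq_mm_le (j : ℕ) : mm j ^ 2 ≤ mm (j + 1) := by
  have := one_le_nn j
  have := four_mul_nn_mul_le j
  nlinarith [Nat.zero_le (mm j ^ 2)]

theorem le_nn_succ (j : ℕ) :
    2 * mm (j + 1) ^ 2 * (6 * nn j) ^ (mm (j + 1) + 1) ≤ nn (j + 1) := by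
  rw [nn_succ]
  have := four_le_mm (j + 1)
  have := one_le_nn j
  gcongr
  · nlinarith [Nat.zero_le (mm (j+1) ^ 2)]
  all_goals omega

theorem mm_lt_succ (j : ℕ) : mm j < mm (j + 1) := by
  have := sq_mm_le j
  have := four_le_mm j
  nlinarith

theorem nn_le_succ (j : ℕ) : nn j ≤ nn (j + 1) := by
  have := le_nn_succ j
  have h1 := four_le_mm (j + 1)
  have h2 := one_le_nn j
  calc nn j ≤ 1 * (6 * nn j) ^ 1 := by rw [pow_one]; omega
    _ ≤ 2 * mm (j + 1) ^ 2 * (6 * nn j) ^ (mm (j + 1) + 1) := by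
      gcongr
      · nlinarith
      · omega
      · omega
    _ ≤ _ := this

theorem mm_mono : Monotone mm := monotone_nat_of_le_succ fun j => (mm_lt_succ j).le
theorem mm_strictMono : StrictMono mm := strictMono_nat_of_lt_succ mm_lt_succ
theorem nn_mono : Monotone nn := monotone_nat_of_le_succ nn_le_succ

/-- `θ_j = 1 / m_j`. -/
noncomputable def th (j : ℕ) : ℝ := 1 / mm j

theorem th_pos (j : ℕ) : 0 < th j := by
  have := four_le_mm j
  unfold th; positivity

theorem th_le (j : ℕ) : th j ≤ 1 / 4 := by
  have : (4 : ℝ) ≤ mm j := by exact_mod_cast four_le_mm j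
  unfold th; gcongr

theorem th_anti {i j : ℕ} (h : i ≤ j) : th j ≤ th i := by
  have h1 : (4 : ℝ) ≤ mm i := by exact_mod_cast four_le_mm i
  have h2 : (mm i : ℝ) ≤ mm j := by exact_mod_cast mm_mono h
  unfold th; gcongr

theorem mm_mul_th (j : ℕ) : (mm j : ℝ) * th j = 1 := by
  have : (4 : ℝ) ≤ mm j := by exact_mod_cast four_le_mm j
  unfold th; field_simp

theorem th_lt_le {i j : ℕ} (h : i < j) : 4 * nn i * th j ≤ th i ^ 2 := by
  have h1 : (4 : ℝ) ≤ mm i := by exact_mod_cast four_le_mm i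
  have h2 : (4 : ℝ) * nn i * mm i ^ 2 ≤ mm j := by
    exact_mod_cast (four_mul_nn_mul_le i).trans (mm_mono h)
  have h3 : (4 : ℝ) ≤ mm j := by exact_mod_cast four_le_mm j
  unfold th
  rw [div_pow, one_pow, mul_one_div, div_le_div_iff₀ (by positivity) (by positivity)]
  linarith

theorem th_lt_sq {i j : ℕ} (h : i < j) : th j ≤ th i ^ 2 := by
  have h0 := th_lt_le h
  have : (1 : ℝ) ≤ nn i := by exact_mod_cast one_le_nn i
  nlinarith [th_pos j]

/-- The coding function. -/
def sg (j ξ : ℕ) : ℕ := 2 * (j + ξ + 1)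

theorem even_sg (j ξ : ℕ) : Even (sg j ξ) := ⟨j + ξ + 1, by simp [sg]; ring⟩
theorem lt_sg (j ξ : ℕ) : j < sg j ξ := by simp [sg]; omega
theorem lt_sg' (j ξ : ℕ) : ξ < sg j ξ := by simp [sg]; omega
theorem sg_inj {j ξ ξ' : ℕ} (h : sg j ξ = sg j ξ') : ξ = ξ' := by simp [sg] at h; omega

/-- The algebra of coefficients. -/
def A : Type := DualNumber ℝ

noncomputable instance : NormedCommRing A := inferInstanceAs (NormedCommRing (TrivSqZeroExt ℝ ℝ))
noncomputable instance : NormedAlgebra ℝ A := inferInstanceAs (NormedAlgebra ℝ (TrivSqZeroExt ℝ ℝ))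
instance : NormOneClass A := inferInstanceAs (NormOneClass (TrivSqZeroExt ℝ ℝ))

/-- The element `s + t ε`. -/
noncomputable def A.mk (s t : ℝ) : A := ((s, t) : ℝ × ℝ)

/-- Real part. -/
noncomputable def re : A →ₗ[ℝ] ℝ where
  toFun := TrivSqZeroExt.fst
  map_add' _ _ := rfl
  map_smul' _ _ := rfl

/-- Infinitesimal part. -/
noncomputable def tau : A →ₗ[ℝ] ℝ where
  toFun := TrivSqZeroExt.snd
  map_add' _ _ := rfl
  map_smul' _ _ := rfl

@[simp] theorem re_mk (s t : ℝ) : re (A.mk s t) = s := rfl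
@[simp] theorem tau_mk (s t : ℝ) : tau (A.mk s t) = t := rfl

@[ext] theorem A.ext {a b : A} (h1 : re a = re b) (h2 : tau a = tau b) : a = b :=
  TrivSqZeroExt.ext h1 h2

theorem mk_re_tau (a : A) : A.mk (re a) (tau a) = a := by ext <;> simp

theorem norm_eq (a : A) : ‖a‖ = |re a| + |tau a| := TrivSqZeroExt.norm_def a

theorem re_mul (a b : A) : re (a * b) = re a * re b := by
  exact TrivSqZeroExt.fst_mul (a : TrivSqZeroExt ℝ ℝ) b

theorem tau_mul (a b : A) : tau (a * b) = re a * tau b + tau a * re b := by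
  have := TrivSqZeroExt.snd_mul (a : TrivSqZeroExt ℝ ℝ) b
  simp at this
  exact this.trans (by simp [re, tau]; rfl)

theorem re_one : re 1 = 1 := rfl
theorem tau_one : tau 1 = 0 := rfl

theorem abs_tau_le (a : A) : |tau a| ≤ ‖a‖ := by rw [norm_eq]; linarith [abs_nonneg (re a)]

/-- The nilpotent element `ε`. -/
noncomputable def eps : A := A.mk 0 1

theorem eps_mul_eps : eps * eps = 0 := by
  ext <;> simp [re_mul, tau_mul, eps]

/-- `A` as a product of lines. -/
noncomputable def equivProd : A ≃ₗ[ℝ] ℝ × ℝ where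
  toFun a := (re a, tau a)
  map_add' _ _ := by simp
  map_smul' _ _ := by simp
  invFun p := A.mk p.1 p.2
  left_inv a := mk_re_tau a
  right_inv p := by simp

instance : FiniteDimensional ℝ A := equivProd.symm.finiteDimensional
instance : ProperSpace A := FiniteDimensional.proper ℝ A
instance : TopologicalSpace.SeparableSpace A := inferInstance

end BD

namespace BD

open Finset

/-- A system of nodes coding a Bourgain–Delbaen type space. -/
structure Nodes where
  pred : ℕ → ℕ
  wt : ℕ → ℕ
  age : ℕ → ℕ
  b : ℕ → ℕ → A
  pred_lt : ∀ γ, 0 < γ → pred γ < γ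
  wt_le : ∀ γ, wt γ ≤ γ
  b_sum : ∀ γ, ∑ η ∈ range γ, ‖b γ η‖ ≤ 1
  age_zero : age 0 = 0
  age_pos : ∀ γ, 0 < γ → age γ = age (pred γ) + 1
  age_le : ∀ γ, 0 < γ → age γ ≤ nn (wt γ)
  wt_pred : ∀ γ, pred γ ≠ 0 → wt (pred γ) = wt γ
  odd_cases : ∀ γ, Odd (wt γ) → ∃ η < γ, b γ = Pi.single η 1 ∧ wt η = sg (wt γ) (pred γ)
  rich_even : ∀ ξ j, Even j → (ξ = 0 ∨ wt ξ = j) → age ξ < nn j → ∀ (b0 : ℕ → A) (L : ℕ),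
    ∑ η ∈ range L, ‖b0 η‖ ≤ 1 → ∀ ε : ℝ, 0 < ε → ∀ L', ∃ γ ≥ L', L ≤ γ ∧ ξ < γ ∧ pred γ = ξ ∧
      wt γ = j ∧ ∑ η ∈ range γ, ‖b γ η - if η < L then b0 η else 0‖ ≤ ε
  rich_odd : ∀ ξ j, Odd j → (ξ = 0 ∨ wt ξ = j) → age ξ < nn j → ∀ η, wt η = sg j ξ →
    ∀ L', ∃ γ ≥ L', η < γ ∧ ξ < γ ∧ pred γ = ξ ∧ wt γ = j ∧ b γ = Pi.single η 1

theorem exists_strong_rec {T : Type} (G : ℕ → (ℕ → T) → T) (d : T) :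
    ∃ F : ℕ → T, ∀ γ, F γ = G γ (fun η => if η < γ then F η else d) := by
  classical
  let R : (γ : ℕ) → ((η : ℕ) → η < γ → T) → T :=
    fun γ r => G γ (fun η => if h : η < γ then r η h else d)
  refine ⟨WellFounded.fix Nat.lt_wfRel.wf R, fun γ => ?_⟩
  rw [WellFounded.fix_eq]
  simp only [R, dite_eq_ite]

theorem exists_recurrent (T : Type) [Countable T] [Nonempty T] :
    ∃ D : ℕ → T, ∀ d L, ∃ γ ≥ L, D γ = d := by
  obtain ⟨g, hg⟩ := exists_surjective_nat (T × ℕ)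
  refine ⟨fun γ => (g γ).1, fun d L => ?_⟩
  by_contra! h
  have hinf : Set.Infinite {γ | (g γ).1 = d} := by
    intro hfin
    have : (Set.univ : Set ℕ).Finite := by
      refine (hfin.image fun γ => (g γ).2).subset ?_
      intro n _
      obtain ⟨γ, hγ⟩ := hg (d, n)
      exact ⟨γ, by simp [hγ], by simp [hγ]⟩
    exact Set.infinite_univ this
  apply hinf
  refine (Set.finite_Iio L).subset fun γ hγ => ?_
  by_contra h'
  exact h γ (by simpa using h') hγ

/-- Codes for coefficients. -/
noncomputable def code : ℕ → A
  | 0 => 0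
  | 1 => 1
  | i + 2 => TopologicalSpace.denseSeq A i

theorem exists_code (a : A) {ε : ℝ} (hε : 0 < ε) : ∃ i, ‖code i - a‖ ≤ ε := by
  obtain ⟨i, hi⟩ := (TopologicalSpace.denseRange_denseSeq A).exists_dist_lt a hε
  exact ⟨i + 2, by rw [← dist_eq_norm, dist_comm]; exact hi.le⟩

/-- Admissible data for a new node. -/
def Valid (γ : ℕ) (w a : ℕ → ℕ) (d : ℕ × ℕ × (ℕ →₀ ℕ)) : Prop :=
  d.1 < γ ∧ (d.1 = 0 ∨ w d.1 = d.2.1) ∧ d.2.1 ≤ γ ∧ a d.1 < nn d.2.1 ∧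
    ∑ η ∈ range γ, ‖code (d.2.2 η)‖ ≤ 1 ∧
    (Odd d.2.1 → ∃ η < γ, (fun i => code (d.2.2 i)) = Pi.single η 1 ∧ w η = sg d.2.1 d.1)

theorem exists_code_approx (b0 : ℕ → A) (L : ℕ) (hb : ∑ η ∈ range L, ‖b0 η‖ ≤ 1) {ε : ℝ}
    (hε : 0 < ε) : ∃ f : ℕ →₀ ℕ, (∀ γ, L ≤ γ → ∑ η ∈ range γ, ‖code (f η)‖ ≤ 1) ∧
      ∀ γ, L ≤ γ → ∑ η ∈ range γ, ‖code (f η) - if η < L then b0 η else 0‖ ≤ ε := by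
  classical
  set r : ℝ := min (ε / 2) 1 with hr
  have hr0 : 0 < r := by positivity
  have hr1 : r ≤ 1 := min_le_right _ _
  have hr2 : r ≤ ε / 2 := min_le_left _ _
  choose c hc using fun η => exists_code ((1 - r) • b0 η) (ε := r / (L + 1)) (by positivity)
  have hsum : ∀ F : ℕ → ℝ, ∀ γ, L ≤ γ → (∀ η, L ≤ η → F η = 0) →
      ∑ η ∈ range γ, F η = ∑ η ∈ range L, F η := by
    intro F γ hγ hF
    symm
    apply sum_subset
    · intro x; simp; omega
    · intro x _ hx; exact hF x (by simpa using hx)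
  have hL : ∑ η ∈ range L, ‖code (c η) - (1 - r) • b0 η‖ ≤ r := by
    calc _ ≤ ∑ η ∈ range L, r / (L + 1) := sum_le_sum fun η _ => hc η
      _ = L * (r / (L + 1)) := by simp
      _ ≤ r := by
        rw [mul_div_assoc', div_le_iff₀ (by positivity)]
        nlinarith
  let f : ℕ →₀ ℕ := Finsupp.onFinset (range L) (fun η => if η < L then c η else 0) (by
    intro a ha; simp at ha ⊢; exact ha.1)
  have hf1 : ∀ η, η < L → f η = c η := fun η h => by simp [f, h]
  have hf2 : ∀ η, L ≤ η → f η = 0 := fun η h => by simp [f]; omega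
  refine ⟨f, fun γ hγ => ?_, fun γ hγ => ?_⟩
  · rw [hsum _ γ hγ (fun η h => by simp [hf2 η h, code])]
    calc ∑ η ∈ range L, ‖code (f η)‖
        ≤ ∑ η ∈ range L, (‖code (c η) - (1 - r) • b0 η‖ + (1 - r) * ‖b0 η‖) := by
          refine sum_le_sum fun η h => ?_
          rw [hf1 η (by simpa using h)]
          have h1 := norm_add_le (code (c η) - (1 - r) • b0 η) ((1 - r) • b0 η)
          rw [norm_smul, Real.norm_of_nonneg (by linarith)] at h1
          simpa using h1
      _ ≤ r + (1 - r) * 1 := by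
          rw [sum_add_distrib, ← mul_sum]
          gcongr
      _ = 1 := by ring
  · rw [hsum _ γ hγ (fun η h => by
      have : ¬ η < L := by omega
      simp [hf2 η h, code, this])]
    calc _ ≤ ∑ η ∈ range L, (‖code (c η) - (1 - r) • b0 η‖ + r * ‖b0 η‖) := by
          refine sum_le_sum fun η h => ?_
          have h : η < L := by simpa using h
          rw [hf1 η h, if_pos h]
          have h1 := norm_sub_le (code (c η) - (1 - r) • b0 η) (r • b0 η)
          rw [norm_smul, Real.norm_of_nonneg hr0.le] at h1
          refine le_trans (le_of_eq ?_) h1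
          congr 1
          rw [sub_smul, one_smul]; abel
      _ ≤ r + r * 1 := by
          rw [sum_add_distrib, ← mul_sum]
          gcongr
      _ ≤ ε := by linarith

theorem nonempty_nodes : Nonempty Nodes := by
  classical
  obtain ⟨D, hD⟩ := exists_recurrent (ℕ × ℕ × (ℕ →₀ ℕ))
  obtain ⟨F, hF⟩ := exists_strong_rec (T := ℕ × ℕ × ℕ × (ℕ → A)) (fun γ p =>
    if Valid γ (fun η => (p η).2.1) (fun η => (p η).2.2.1) (D γ) then
      ((D γ).1, (D γ).2.1, (p (D γ).1).2.2.1 + 1, fun η => code ((D γ).2.2 η))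
    else (0, 0, if γ = 0 then 0 else 1, 0)) (0, 0, 0, 0)
  set V : ℕ → Prop := fun γ => Valid γ (fun η => (F η).2.1) (fun η => (F η).2.2.1) (D γ) with hV
  have hVeq : ∀ γ, Valid γ (fun η => ((if η < γ then F η else (0, 0, 0, 0)) :
      ℕ × ℕ × ℕ × (ℕ → A)).2.1) (fun η => ((if η < γ then F η else (0, 0, 0, 0)) :
      ℕ × ℕ × ℕ × (ℕ → A)).2.2.1) (D γ) ↔ V γ := by
    intro γ
    simp only [hV, Valid]
    constructor
    · rintro ⟨h1, h2, h3, h4, h5, h6⟩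
      simp only [h1, if_true] at h2 h4
      refine ⟨h1, h2, h3, h4, h5, fun h => ?_⟩
      obtain ⟨η, h7, h8, h9⟩ := h6 h
      exact ⟨η, h7, h8, by simpa [h7] using h9⟩
    · rintro ⟨h1, h2, h3, h4, h5, h6⟩
      simp only [h1, if_true]
      refine ⟨trivial, h2, h3, h4, h5, fun h => ?_⟩
      obtain ⟨η, h7, h8, h9⟩ := h6 h
      exact ⟨η, h7, h8, by simpa [h7] using h9⟩
  have hpos : ∀ γ, V γ → F γ = ((D γ).1, (D γ).2.1, (F (D γ).1).2.2.1 + 1,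
      fun η => code ((D γ).2.2 η)) := by
    intro γ h
    rw [hF γ, if_pos ((hVeq γ).2 h)]
    simp only [if_pos h.1]
  have hneg : ∀ γ, ¬ V γ → F γ = (0, 0, if γ = 0 then 0 else 1, 0) := by
    intro γ h
    rw [hF γ, if_neg (fun h' => h ((hVeq γ).1 h'))]
  have h0 : F 0 = (0, 0, 0, 0) := by
    rw [hneg 0 (fun h => absurd h.1 (Nat.not_lt_zero _))]; rfl
  refine ⟨⟨fun γ => (F γ).1, fun γ => (F γ).2.1, fun γ => (F γ).2.2.1, fun γ => (F γ).2.2.2,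
    ?_, ?_, ?_, ?_, ?_, ?_, ?_, ?_, ?_, ?_⟩⟩
  · intro γ hγ
    by_cases h : V γ
    · rw [hpos γ h]; exact h.1
    · rw [hneg γ h]; exact hγ
  · intro γ
    by_cases h : V γ
    · rw [hpos γ h]; exact h.2.2.1
    · rw [hneg γ h]; exact Nat.zero_le _
  · intro γ
    by_cases h : V γ
    · rw [hpos γ h]; exact h.2.2.2.2.1
    · rw [hneg γ h]; simp
  · rw [h0]
  · intro γ hγ
    by_cases h : V γ
    · simp only [hpos γ h]
    · simp [hneg γ h, h0]; omega
  · intro γ hγ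
    by_cases h : V γ
    · rw [hpos γ h]; exact h.2.2.2.1
    · rw [hneg γ h, nn_zero]; dsimp only; split_ifs <;> omega
  · intro γ hγ
    by_cases h : V γ
    · rw [hpos γ h] at hγ ⊢
      exact h.2.1.resolve_left hγ
    · rw [hneg γ h] at hγ; exact absurd rfl hγ
  · intro γ hγ
    by_cases h : V γ
    · simp only [hpos γ h] at hγ ⊢
      exact h.2.2.2.2.2 hγ
    · rw [hneg γ h] at hγ
      exact absurd hγ (by simp)
  · intro ξ j hj hξ hage b0 L hb ε hε L'
    obtain ⟨f, hf1, hf2⟩ := exists_code_approx b0 L hb hε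
    obtain ⟨γ, hγ, hDγ⟩ := hD (ξ, j, f) (max L' (max L (max (ξ + 1) j)))
    simp only [ge_iff_le, max_le_iff] at hγ
    have h : V γ := by
      simp only [hV, hDγ]
      exact ⟨by simp; omega, hξ, by simp; omega, hage, hf1 γ (by omega), fun h =>
        absurd hj (Nat.not_even_iff_odd.2 h)⟩
    refine ⟨γ, by omega, by omega, by omega, ?_⟩
    rw [hpos γ h, hDγ]
    exact ⟨rfl, rfl, hf2 γ (by omega)⟩
  · intro ξ j hj hξ hage η hη L'
    obtain ⟨γ, hγ, hDγ⟩ := hD (ξ, j, Finsupp.single η 1) (max L' (max (η + 1) (max (ξ + 1) j)))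
    simp only [ge_iff_le, max_le_iff] at hγ
    have hb : (fun i => code ((Finsupp.single η 1 : ℕ →₀ ℕ) i)) = Pi.single η (1 : A) := by
      funext i
      by_cases hi : i = η
      · subst hi; simp [code]
      · rw [Finsupp.single_eq_of_ne hi, Pi.single_eq_of_ne hi]; rfl
    have h : V γ := by
      simp only [hV, hDγ]
      refine ⟨by simp; omega, hξ, by simp; omega, hage, ?_, fun h => ⟨η, by omega, hb, hη⟩⟩
      have : ∀ i, ‖code ((Finsupp.single η 1 : ℕ →₀ ℕ) i)‖ = if i = η then 1 else 0 := by
        intro i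
        rw [show code ((Finsupp.single η 1 : ℕ →₀ ℕ) i) = _ from congrFun hb i]
        by_cases hi : i = η
        · subst hi; simp
        · simp [hi]
      simp only [this]
      rw [sum_ite_eq']
      split_ifs <;> simp
    refine ⟨γ, by omega, by omega, by omega, ?_⟩
    rw [hpos γ h, hDγ]
    exact ⟨rfl, rfl, hb⟩

end BD

namespace BD

open Finset

/-- Restriction of a sequence to the indices larger than `p`. -/
noncomputable def tail (p : ℕ) : (ℕ → A) →ₗ[A] (ℕ → A) where
  toFun x n := if p < n then x n else 0
  map_add' x y := by funext n; by_cases h : p < n <;> simp [h]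
  map_smul' c x := by funext n; by_cases h : p < n <;> simp [h]

/-- Restriction of a sequence to the indices at most `p`. -/
noncomputable def head (p : ℕ) : (ℕ → A) →ₗ[A] (ℕ → A) := LinearMap.id - tail p

theorem tail_apply (p : ℕ) (x : ℕ → A) (n : ℕ) : tail p x n = if p < n then x n else 0 := rfl
theorem head_apply (p : ℕ) (x : ℕ → A) (n : ℕ) : head p x n = if n ≤ p then x n else 0 := by
  by_cases h : p < n
  · simp [head, tail_apply, h]
  · simp [head, tail_apply, h, not_lt.1 h]

theorem head_add_tail (p : ℕ) (x : ℕ → A) : head p x + tail p x = x := by simp [head]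

/-- The sequence is supported in `(p, q]`. -/
def Blk (p q : ℕ) (x : ℕ → A) : Prop := ∀ n, (n ≤ p ∨ q < n) → x n = 0

theorem Blk.mono {p q p' q' : ℕ} {x : ℕ → A} (h : Blk p q x) (hp : p' ≤ p) (hq : q ≤ q') :
    Blk p' q' x := fun n hn => h n (by omega)

theorem Blk.smul {p q : ℕ} {x : ℕ → A} (h : Blk p q x) (a : A) : Blk p q (a • x) :=
  fun n hn => by simp [h n hn]

theorem Blk.rsmul {p q : ℕ} {x : ℕ → A} (h : Blk p q x) (a : ℝ) : Blk p q (a • x) :=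
  fun n hn => by simp [h n hn]

theorem Blk.add {p q : ℕ} {x y : ℕ → A} (hx : Blk p q x) (hy : Blk p q y) : Blk p q (x + y) :=
  fun n hn => by simp [hx n hn, hy n hn]

theorem Blk.sub {p q : ℕ} {x y : ℕ → A} (hx : Blk p q x) (hy : Blk p q y) : Blk p q (x - y) :=
  fun n hn => by simp [hx n hn, hy n hn]

theorem Blk.sum {ι : Type*} {p q : ℕ} {x : ι → ℕ → A} (I : Finset ι) (h : ∀ i ∈ I, Blk p q (x i)) :
    Blk p q (∑ i ∈ I, x i) := fun n hn => by
  rw [Finset.sum_apply]; exact Finset.sum_eq_zero fun i hi => h i hi n hn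

theorem Blk.zero {p q : ℕ} : Blk p q 0 := fun _ _ => rfl

theorem Blk.tail_eq {p q r : ℕ} {x : ℕ → A} (h : Blk p q x) (hr : r ≤ p) : tail r x = x := by
  funext n; rw [tail_apply]; split_ifs with h1
  · rfl
  · exact (h n (by omega)).symm

theorem Blk.tail_zero {p q r : ℕ} {x : ℕ → A} (h : Blk p q x) (hr : q ≤ r) : tail r x = 0 := by
  funext n; rw [tail_apply]; split_ifs with h1
  · exact h n (by omega)
  · rfl

namespace Nodes

variable (Γ : Nodes)

/-- The evaluation functionals. -/
noncomputable def e : ℕ → (ℕ → A) →ₗ[A] A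
  | γ => LinearMap.proj γ + if _h : 0 < γ then
      e (Γ.pred γ) + th (Γ.wt γ) • ∑ η : Fin γ,
        Γ.b γ η • (e η).comp (tail (Γ.pred γ)) else 0
termination_by γ => γ
decreasing_by
  · exact Γ.pred_lt _ _h
  · exact η.2

/-- The evaluation block of a node. -/
noncomputable def B (γ : ℕ) (x : ℕ → A) : A :=
  ∑ η ∈ range γ, Γ.b γ η * Γ.e η (tail (Γ.pred γ) x)

theorem e_zero (x : ℕ → A) : Γ.e 0 x = x 0 := by
  rw [e]; simp

theorem e_pos {γ : ℕ} (h : 0 < γ) (x : ℕ → A) :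
    Γ.e γ x = x γ + (Γ.e (Γ.pred γ) x + th (Γ.wt γ) • Γ.B γ x) := by
  rw [e, dif_pos h]
  simp [B, Finset.sum_range]

theorem e_of_zero {γ : ℕ} : ∀ {x : ℕ → A}, (∀ n ≤ γ, x n = 0) → Γ.e γ x = 0 := by
  induction γ using Nat.strong_induction_on with
  | _ γ ih =>
    intro x hx
    rcases Nat.eq_zero_or_pos γ with rfl | h
    · rw [e_zero, hx 0 le_rfl]
    · have hp := Γ.pred_lt γ h
      rw [e_pos _ h, hx γ le_rfl, ih _ hp (fun n hn => hx n (by omega)), B]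
      rw [Finset.sum_eq_zero]
      · simp
      · intro η hη
        have hη : η < γ := by simpa using hη
        rw [ih η hη, mul_zero]
        intro n hn
        rw [tail_apply]; split_ifs
        · exact hx n (by omega)
        · rfl

theorem e_tail_of_le {γ p : ℕ} (h : γ ≤ p) (x : ℕ → A) : Γ.e γ (tail p x) = 0 :=
  Γ.e_of_zero fun n hn => by rw [tail_apply, if_neg (by omega)]

theorem e_head_of_le {γ p : ℕ} (h : γ ≤ p) (x : ℕ → A) : Γ.e γ (head p x) = Γ.e γ x := by
  conv_rhs => rw [← head_add_tail p x]
  rw [map_add, e_tail_of_le _ h, add_zero]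

theorem e_blk_of_le {γ p q : ℕ} (h : γ ≤ p) {x : ℕ → A} (hx : Blk p q x) : Γ.e γ x = 0 :=
  Γ.e_of_zero fun n hn => hx n (by omega)

theorem e_self {γ : ℕ} {x : ℕ → A} (hx : ∀ n < γ, x n = 0) : Γ.e γ x = x γ := by
  rcases Nat.eq_zero_or_pos γ with rfl | h
  · rw [e_zero]
  · have hp := Γ.pred_lt γ h
    rw [e_pos _ h, e_of_zero _ (fun n hn => hx n (by omega)), B, Finset.sum_eq_zero]
    · simp
    · intro η hη
      have hη : η < γ := by simpa using hη
      rw [e_of_zero, mul_zero]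
      intro n hn
      rw [tail_apply]; split_ifs
      · exact hx n (by omega)
      · rfl

theorem norm_sum_b_le {γ : ℕ} {f : ℕ → A} {C : ℝ} (hC : 0 ≤ C) (h : ∀ η < γ, ‖f η‖ ≤ C) :
    ‖∑ η ∈ range γ, Γ.b γ η * f η‖ ≤ C := by
  calc _ ≤ ∑ η ∈ range γ, ‖Γ.b γ η‖ * C := by
        refine (norm_sum_le _ _).trans (sum_le_sum fun η hη => (norm_mul_le _ _).trans ?_)
        gcongr
        exact h η (by simpa using hη)
    _ ≤ 1 * C := by
        rw [← sum_mul]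
        gcongr
        exact Γ.b_sum γ
    _ = C := one_mul C

theorem norm_B_le {γ : ℕ} {x : ℕ → A} {C : ℝ} (hC : 0 ≤ C)
    (h : ∀ η < γ, ‖Γ.e η (tail (Γ.pred γ) x)‖ ≤ C) : ‖Γ.B γ x‖ ≤ C :=
  Γ.norm_sum_b_le hC h

/-- The norm of `x` is at most `C`. -/
def NB (x : ℕ → A) (C : ℝ) : Prop := ∀ γ, ‖Γ.e γ x‖ ≤ C

variable {Γ}

theorem NB.nonneg {x : ℕ → A} {C : ℝ} (h : Γ.NB x C) : 0 ≤ C := (norm_nonneg _).trans (h 0)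

theorem NB.mono {x : ℕ → A} {C D : ℝ} (h : Γ.NB x C) (hCD : C ≤ D) : Γ.NB x D :=
  fun γ => (h γ).trans hCD

theorem NB.add {x y : ℕ → A} {C D : ℝ} (hx : Γ.NB x C) (hy : Γ.NB y D) : Γ.NB (x + y) (C + D) :=
  fun γ => by rw [map_add]; exact (norm_add_le _ _).trans (add_le_add (hx γ) (hy γ))

theorem NB.sub {x y : ℕ → A} {C D : ℝ} (hx : Γ.NB x C) (hy : Γ.NB y D) : Γ.NB (x - y) (C + D) :=
  fun γ => by rw [map_sub]; exact (norm_sub_le _ _).trans (add_le_add (hx γ) (hy γ))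

theorem NB.zero : Γ.NB 0 0 := fun γ => by simp

theorem NB.sum {ι : Type*} {x : ι → ℕ → A} {C : ι → ℝ} (I : Finset ι)
    (h : ∀ i ∈ I, Γ.NB (x i) (C i)) : Γ.NB (∑ i ∈ I, x i) (∑ i ∈ I, C i) :=
  fun γ => by rw [map_sum]; exact (norm_sum_le _ _).trans (sum_le_sum fun i hi => h i hi γ)

variable (Γ)

theorem e_rsmul (γ : ℕ) (r : ℝ) (x : ℕ → A) : Γ.e γ (r • x) = r • Γ.e γ x :=
  LinearMap.map_smul_of_tower _ r x

variable {Γ}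

theorem NB.rsmul {x : ℕ → A} {C : ℝ} (hx : Γ.NB x C) (r : ℝ) : Γ.NB (r • x) (|r| * C) :=
  fun γ => by
    rw [e_rsmul, norm_smul, Real.norm_eq_abs]
    exact mul_le_mul_of_nonneg_left (hx γ) (abs_nonneg r)

theorem NB.smul {x : ℕ → A} {C : ℝ} (hx : Γ.NB x C) (a : A) : Γ.NB (a • x) (‖a‖ * C) :=
  fun γ => by
    rw [map_smul, smul_eq_mul]
    exact (norm_mul_le _ _).trans (mul_le_mul_of_nonneg_left (hx γ) (norm_nonneg a))

theorem NB.head' {m : ℕ} {x : ℕ → A} {C : ℝ} (h : ∀ η ≤ m, ‖Γ.e η x‖ ≤ C) :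
    Γ.NB (head m x) (2 * C) := by
  intro γ
  have hC : 0 ≤ C := (norm_nonneg _).trans (h 0 (Nat.zero_le _))
  induction γ using Nat.strong_induction_on generalizing m with
  | _ γ ih =>
    rcases le_or_gt γ m with h1 | h1
    · rw [e_head_of_le _ h1]; linarith [h γ h1]
    · have h0 : 0 < γ := by omega
      have hp := Γ.pred_lt γ h0
      rw [e_pos _ h0, head_apply, if_neg (by omega), zero_add]
      rcases le_or_gt m (Γ.pred γ) with h2 | h2
      · rw [B, Finset.sum_eq_zero, smul_zero, add_zero]
        · exact ih _ hp h
        · intro η _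
          have : tail (Γ.pred γ) (head m x) = 0 := by
            funext n
            rw [tail_apply, head_apply]
            split_ifs <;> first | rfl | omega
          rw [this, map_zero, mul_zero]
      · have ht : tail (Γ.pred γ) (head m x) = head m x - head (Γ.pred γ) x := by
          funext n
          rw [tail_apply, Pi.sub_apply, head_apply, head_apply]
          split_ifs <;> first | omega | simp
        have hB : ‖Γ.B γ (head m x)‖ ≤ 4 * C := by
          refine Γ.norm_B_le (by linarith) fun η hη => ?_
          rw [ht, map_sub]
          refine (norm_sub_le _ _).trans ?_
          have := ih η hη h
          have h5 : ‖Γ.e η (BD.head (Γ.pred γ) x)‖ ≤ 2 * C :=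
            ih η hη (fun i hi => h i (by omega))
          linarith
        rw [e_head_of_le _ h2.le]
        refine (norm_add_le _ _).trans ?_
        rw [norm_smul, Real.norm_of_nonneg (th_pos _).le]
        have h4 : th (Γ.wt γ) * ‖Γ.B γ (head m x)‖ ≤ 1 / 4 * (4 * C) := by
          gcongr
          · exact th_le _
        linarith [h _ h2.le]

theorem NB.head {x : ℕ → A} {C : ℝ} (h : Γ.NB x C) (m : ℕ) : Γ.NB (head m x) (2 * C) :=
  NB.head' fun η _ => h η

theorem NB.tail {x : ℕ → A} {C : ℝ} (h : Γ.NB x C) (m : ℕ) : Γ.NB (tail m x) (3 * C) := by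
  have : BD.tail m x = x - BD.head m x := by
    conv_rhs => lhs; rw [← head_add_tail m x]
    simp
  rw [this]
  exact (h.sub (h.head m)).mono (by linarith)

theorem NB.coord {x : ℕ → A} {C : ℝ} (h : Γ.NB x C) (n : ℕ) : ‖x n‖ ≤ 3 * C := by
  rcases Nat.eq_zero_or_pos n with rfl | hn
  · have := h 0
    rw [e_zero] at this
    linarith [h.nonneg]
  · have h1 := h.tail (n - 1) n
    rw [e_self, tail_apply, if_pos (by omega)] at h1
    · exact h1
    · intro k hk; rw [tail_apply, if_neg (by omega)]

theorem exists_NB {q : ℕ} {x : ℕ → A} (h : ∀ n, q < n → x n = 0) : ∃ C, 0 < C ∧ Γ.NB x C := by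
  have hx : BD.head q x = x := by
    funext n; rw [head_apply]; split_ifs with h1
    · rfl
    · exact (h n (by omega)).symm
  refine ⟨2 * ∑ η ∈ range (q + 1), ‖Γ.e η x‖ + 1, by positivity, ?_⟩
  rw [← hx]
  refine (NB.head' (C := ∑ η ∈ range (q + 1), ‖Γ.e η x‖) fun η hη => ?_).mono ?_
  · exact single_le_sum (f := fun η => ‖Γ.e η x‖) (fun _ _ => norm_nonneg _) (by simp; omega)
  · rw [hx]; linarith

variable (Γ)

theorem e_injective {x : ℕ → A} {m : ℕ} (h : ∀ γ ≤ m, Γ.e γ x = 0) : ∀ n ≤ m, x n = 0 := by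
  intro n
  induction n using Nat.strong_induction_on with
  | _ n ih =>
    intro hn
    rw [← Γ.e_self (x := x) (fun k hk => ih k hk (by omega))]
    exact h n hn

theorem exists_e_eq (u : ℕ → A) : ∃ x : ℕ → A, ∀ γ, Γ.e γ x = u γ := by
  obtain ⟨x, hx⟩ := exists_strong_rec (T := A) (fun γ p => u γ - Γ.e γ p) 0
  refine ⟨x, fun γ => ?_⟩
  set y : ℕ → A := fun η => if η < γ then x η else 0 with hy
  have h1 : Γ.e γ (x - y) = (x - y) γ := Γ.e_self fun n hn => by simp [hy, hn]
  rw [map_sub] at h1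
  have h2 : (x - y) γ = x γ := by simp [hy]
  rw [h2, hx γ] at h1
  exact sub_left_inj.1 h1

/-- The triangular bijection between coordinates and evaluations. -/
noncomputable def E : (ℕ → A) ≃ₗ[A] (ℕ → A) :=
  LinearEquiv.ofBijective (LinearMap.pi Γ.e)
    ⟨by
      rw [← LinearMap.ker_eq_bot, LinearMap.ker_eq_bot']
      intro x hx
      funext n
      exact Γ.e_injective (m := n) (fun γ _ => congrFun hx γ) n le_rfl,
    fun u => by
      obtain ⟨x, hx⟩ := Γ.exists_e_eq u
      exact ⟨x, funext hx⟩⟩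

theorem E_apply (x : ℕ → A) (γ : ℕ) : Γ.E x γ = Γ.e γ x := rfl

theorem e_E_symm (u : ℕ → A) (γ : ℕ) : Γ.e γ (Γ.E.symm u) = u γ := by
  rw [← E_apply, LinearEquiv.apply_symm_apply]

end Nodes

end BD

namespace BD

open Finset

namespace Nodes

variable (Γ : Nodes)

/-- A finitely supported vector beyond `N` which is small on nodes of weight at most `N`. -/
structure Fine (C : ℝ) (N : ℕ) (x : ℕ → A) : Prop where
  blk : ∃ q, Blk N q x
  nb : Γ.NB x C
  small : ∀ γ, Γ.wt γ ≤ N → ‖Γ.e γ x‖ ≤ C * th (Γ.wt γ)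

/-- A bounded sequence of successive blocks. -/
structure Blocks (C : ℝ) (N : ℕ → ℕ) (x : ℕ → ℕ → A) : Prop where
  mono : StrictMono N
  blk : ∀ k, Blk (N k) (N (k + 1)) (x k)
  nb : ∀ k, Γ.NB (x k) C

/-- A rapidly increasing sequence. -/
structure RIS (C : ℝ) (N : ℕ → ℕ) (x : ℕ → ℕ → A) : Prop extends Γ.Blocks C N x where
  small : ∀ k γ, Γ.wt γ ≤ N k → ‖Γ.e γ (x k)‖ ≤ C * th (Γ.wt γ)

variable {Γ}

theorem Fine.mono {C D : ℝ} {N M : ℕ} {x : ℕ → A} (h : Γ.Fine C N x) (hC : C ≤ D) (hM : M ≤ N) :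
    Γ.Fine D M x := by
  obtain ⟨q, hq⟩ := h.blk
  exact ⟨⟨q, hq.mono hM le_rfl⟩, h.nb.mono hC, fun γ hγ => (h.small γ (hγ.trans hM)).trans
    (mul_le_mul_of_nonneg_right hC (th_pos _).le)⟩

theorem Fine.add {C D : ℝ} {N : ℕ} {x y : ℕ → A} (hx : Γ.Fine C N x) (hy : Γ.Fine D N y) :
    Γ.Fine (C + D) N (x + y) := by
  obtain ⟨q, hq⟩ := hx.blk
  obtain ⟨r, hr⟩ := hy.blk
  refine ⟨⟨max q r, (hq.mono le_rfl (le_max_left _ _)).add (hr.mono le_rfl (le_max_right _ _))⟩,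
    hx.nb.add hy.nb, fun γ hγ => ?_⟩
  rw [map_add, add_mul]
  exact (norm_add_le _ _).trans (add_le_add (hx.small γ hγ) (hy.small γ hγ))

theorem norm_e_le_of_lt_wt {q : ℕ} {x : ℕ → A} {C : ℝ} (hx : Blk 0 q x) (hC : Γ.NB x C) {γ : ℕ}
    (hγ : q < Γ.wt γ) : ‖Γ.e γ x‖ ≤ C * th (Γ.wt γ) := by
  induction γ using Nat.strong_induction_on with
  | _ γ ih =>
    have hw := Γ.wt_le γ
    have h0 : 0 < γ := by omega
    have hp := Γ.pred_lt γ h0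
    rw [e_pos _ h0, hx γ (by omega), zero_add]
    rcases eq_or_ne (Γ.pred γ) 0 with h1 | h1
    · rw [h1, Γ.e_blk_of_le le_rfl hx, zero_add, norm_smul, Real.norm_of_nonneg (th_pos _).le,
        mul_comm]
      refine mul_le_mul_of_nonneg_right (Γ.norm_B_le hC.nonneg fun η _ => ?_) (th_pos _).le
      rw [h1, hx.tail_eq le_rfl]
      exact hC η
    · have h2 := Γ.wt_pred γ h1
      have h3 := Γ.wt_le (Γ.pred γ)
      have h4 := ih _ hp (by omega)
      rw [B, hx.tail_zero (by omega)]
      simpa [h2] using h4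

variable {C : ℝ} {N : ℕ → ℕ} {x : ℕ → ℕ → A}

theorem Blocks.blk_zero (h : Γ.Blocks C N x) (k : ℕ) : Blk 0 (N (k + 1)) (x k) :=
  (h.blk k).mono (Nat.zero_le _) le_rfl

theorem Blocks.unique (h : Γ.Blocks C N x) {n k l : ℕ} (hk : N k < n) (hk' : n ≤ N (k + 1))
    (hl : N l < n) (hl' : n ≤ N (l + 1)) : k = l := by
  by_contra hne
  rcases lt_or_gt_of_ne hne with h1 | h1
  · have := h.mono.monotone (show k + 1 ≤ l by omega); omega
  · have := h.mono.monotone (show l + 1 ≤ k by omega); omega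

theorem RIS.exists_exception (h : Γ.RIS C N x) (γ : ℕ) :
    ∃ k0, ∀ k ≠ k0, ‖Γ.e γ (x k)‖ ≤ C * th (Γ.wt γ) := by
  have key : ∀ k, ¬ (N k < Γ.wt γ ∧ Γ.wt γ ≤ N (k + 1)) → ‖Γ.e γ (x k)‖ ≤ C * th (Γ.wt γ) := by
    intro k hk
    rcases le_or_gt (Γ.wt γ) (N k) with h1 | h1
    · exact h.small k γ h1
    · exact norm_e_le_of_lt_wt (h.blk_zero k) (h.nb k) (by_contra fun h2 => hk ⟨h1, by omega⟩)
  by_cases hex : ∃ k, N k < Γ.wt γ ∧ Γ.wt γ ≤ N (k + 1)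
  · obtain ⟨k0, h1, h2⟩ := hex
    refine ⟨k0, fun k hk => key k fun h3 => hk ?_⟩
    exact h.unique h3.1 h3.2 h1 h2
  · push Not at hex
    exact ⟨0, fun k _ => key k fun h3 => absurd h3.2 (not_le.2 (hex k h3.1))⟩

theorem norm_sum_le_of_unique {ι E : Type*} [SeminormedAddCommGroup E] {f : ι → E}
    {I : Finset ι} {D : ℝ}
    (hD : 0 ≤ D) (hf : ∀ k ∈ I, ‖f k‖ ≤ D)
    (hu : ∀ k ∈ I, ∀ l ∈ I, f k ≠ 0 → f l ≠ 0 → k = l) : ‖∑ k ∈ I, f k‖ ≤ D := by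
  classical
  by_cases h : ∃ k ∈ I, f k ≠ 0
  · obtain ⟨k, hk, hfk⟩ := h
    rw [sum_eq_single_of_mem k hk]
    · exact hf k hk
    · intro l hl hlk
      by_contra hfl
      exact hlk (hu l hl k hk hfl hfk)
  · push Not at h
    rw [sum_eq_zero h, norm_zero]
    exact hD

theorem Blocks.sum_coord_le (h : Γ.Blocks C N x) (n : ℕ) (I : Finset ℕ) :
    ‖∑ k ∈ I, x k n‖ ≤ 3 * C := by
  refine norm_sum_le_of_unique (by linarith [(h.nb 0).nonneg]) (fun k _ => (h.nb k).coord n) ?_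
  intro k _ l _ hk hl
  have h1 : ∀ k, x k n ≠ 0 → N k < n ∧ n ≤ N (k + 1) := by
    intro k hk
    by_contra h2
    exact hk (h.blk k n (by omega))
  exact h.unique (h1 k hk).1 (h1 k hk).2 (h1 l hl).1 (h1 l hl).2

theorem Blocks.sum_tail_sub_le (h : Γ.Blocks C N x) (γ ξ : ℕ) (I : Finset ℕ) :
    ‖∑ k ∈ I, Γ.e γ (BD.tail ξ (x k)) - ∑ k ∈ I with ξ ≤ N k, Γ.e γ (x k)‖ ≤ 3 * C := by
  have hC := (h.nb 0).nonneg
  rw [sum_filter, ← sum_sub_distrib]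
  have h1 : ∀ k, Γ.e γ (BD.tail ξ (x k)) - (if ξ ≤ N k then Γ.e γ (x k) else 0) ≠ 0 →
      N k < ξ ∧ ξ ≤ N (k + 1) := by
    intro k hk
    by_contra h2
    apply hk
    split_ifs with h3
    · rw [(h.blk k).tail_eq h3, sub_self]
    · rw [(h.blk k).tail_zero (by omega), map_zero, sub_zero]
  refine norm_sum_le_of_unique (by linarith) (fun k _ => ?_) ?_
  · split_ifs with h3
    · rw [(h.blk k).tail_eq h3, sub_self, norm_zero]; linarith
    · rw [sub_zero]; exact (h.nb k).tail ξ γ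
  · intro k _ l _ hk hl
    exact h.unique (h1 k hk).1 (h1 k hk).2 (h1 l hl).1 (h1 l hl).2

theorem Blocks.sum_tail_le (h : Γ.Blocks C N x) {κ D : ℝ} (hκ : 0 ≤ κ) {γ : ℕ}
    (hs : ∀ I : Finset ℕ, ‖∑ k ∈ I, Γ.e γ (x k)‖ ≤ C * (κ * #I + D)) (ξ : ℕ) (I : Finset ℕ) :
    ‖∑ k ∈ I, Γ.e γ (BD.tail ξ (x k))‖ ≤ C * (κ * #I + (D + 3)) := by
  have h1 := h.sum_tail_sub_le γ ξ I
  have h2 := hs ({k ∈ I | ξ ≤ N k})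
  have h3 := norm_add_le (∑ k ∈ I, Γ.e γ (BD.tail ξ (x k)) - ∑ k ∈ I with ξ ≤ N k, Γ.e γ (x k))
    (∑ k ∈ I with ξ ≤ N k, Γ.e γ (x k))
  rw [sub_add_cancel] at h3
  have h4 : C * (κ * #{k ∈ I | ξ ≤ N k} + D) ≤ C * (κ * #I + D) := by
    have := (h.nb 0).nonneg
    gcongr
    exact filter_subset _ _
  linarith

theorem Blocks.inner (h : Γ.Blocks C N x) {κ D : ℝ} (hκ : 0 ≤ κ) (hD : 0 ≤ D)
    (hs : ∀ γ (I : Finset ℕ), ‖∑ k ∈ I, Γ.e γ (x k)‖ ≤ C * (κ * #I + D)) (γ : ℕ) (I : Finset ℕ) :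
    ‖∑ k ∈ I, Γ.e γ (x k)‖ ≤ C * (th (Γ.wt γ) * κ * #I + Γ.age γ * (D + 5)) := by
  have hC := (h.nb 0).nonneg
  induction γ using Nat.strong_induction_on generalizing I with
  | _ γ ih =>
    rcases Nat.eq_zero_or_pos γ with rfl | h0
    · rw [sum_eq_zero]
      · rw [norm_zero]
        have := th_pos (Γ.wt 0)
        positivity
      · intro k _; exact Γ.e_blk_of_le (Nat.zero_le _) (h.blk k)
    set ξ := Γ.pred γ with hξ
    have hp : ξ < γ := Γ.pred_lt γ h0
    have hth := th_pos (Γ.wt γ)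
    have hsplit : ∑ k ∈ I, Γ.e γ (x k) = ∑ k ∈ I, x k γ + (∑ k ∈ I, Γ.e ξ (x k) +
        th (Γ.wt γ) • ∑ η ∈ range γ, Γ.b γ η * ∑ k ∈ I, Γ.e η (BD.tail ξ (x k))) := by
      simp_rw [e_pos _ h0, sum_add_distrib, ← smul_sum, B, mul_sum]
      rw [sum_comm]
    have hB : ‖∑ η ∈ range γ, Γ.b γ η * ∑ k ∈ I, Γ.e η (BD.tail ξ (x k))‖ ≤
        C * (κ * #{k ∈ I | ξ ≤ N k} + D) + 3 * C := by
      refine Γ.norm_sum_b_le (by positivity) fun η _ => ?_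
      have h1 := h.sum_tail_sub_le η ξ I
      have h2 := hs η ({k ∈ I | ξ ≤ N k})
      have h3 := norm_add_le (∑ k ∈ I, Γ.e η (BD.tail ξ (x k)) -
        ∑ k ∈ I with ξ ≤ N k, Γ.e η (x k)) (∑ k ∈ I with ξ ≤ N k, Γ.e η (x k))
      rw [sub_add_cancel] at h3
      linarith
    have hξs : ‖∑ k ∈ I, Γ.e ξ (x k)‖ ≤
        C * (th (Γ.wt γ) * κ * #{k ∈ I | N (k + 1) ≤ ξ} + Γ.age ξ * (D + 5)) + C := by
      rcases eq_or_ne ξ 0 with h1 | h1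
      · rw [sum_eq_zero]
        · rw [norm_zero]; positivity
        · intro k _; exact Γ.e_blk_of_le (by omega) (h.blk k)
      · have h2 : Γ.wt ξ = Γ.wt γ := Γ.wt_pred γ h1
        rw [← sum_filter_add_sum_filter_not I (fun k => N (k + 1) ≤ ξ)]
        refine (norm_add_le _ _).trans (add_le_add ?_ ?_)
        · rw [← h2]; exact ih ξ hp _
        · refine norm_sum_le_of_unique hC (fun k _ => h.nb k ξ) ?_
          have h3 : ∀ k ∈ ({k ∈ I | ¬ N (k + 1) ≤ ξ} : Finset ℕ), Γ.e ξ (x k) ≠ 0 →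
              N k < ξ ∧ ξ ≤ N (k + 1) := by
            intro k hk hne
            rw [mem_filter] at hk
            refine ⟨?_, by omega⟩
            by_contra h4
            exact hne (Γ.e_blk_of_le (by omega) (h.blk k))
          intro k hk l hl hk' hl'
          exact h.unique (h3 k hk hk').1 (h3 k hk hk').2 (h3 l hl hl').1 (h3 l hl hl').2
    have hcard : (#{k ∈ I | N (k + 1) ≤ ξ} : ℝ) + #{k ∈ I | ξ ≤ N k} ≤ #I := by
      rw [← Nat.cast_add, ← card_union_of_disjoint]
      · exact_mod_cast card_le_card (union_subset (filter_subset _ _) (filter_subset _ _))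
      · rw [disjoint_filter]
        intro k _ h1 h2
        have : N k < N (k + 1) := h.mono (Nat.lt_succ_self k)
        omega
    rw [hsplit]
    have h1 := h.sum_coord_le γ I
    have h2 := norm_add_le (∑ k ∈ I, Γ.e ξ (x k))
      (th (Γ.wt γ) • ∑ η ∈ range γ, Γ.b γ η * ∑ k ∈ I, Γ.e η (BD.tail ξ (x k)))
    rw [norm_smul, Real.norm_of_nonneg hth.le] at h2
    have h3 := mul_le_mul_of_nonneg_left hB hth.le
    refine (norm_add_le _ _).trans ?_
    have hage : (Γ.age γ : ℝ) = Γ.age ξ + 1 := by exact_mod_cast Γ.age_pos γ h0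
    have hth4 := th_le (Γ.wt γ)
    have h4 : th (Γ.wt γ) * κ * (#{k ∈ I | N (k + 1) ≤ ξ} + #{k ∈ I | ξ ≤ N k}) ≤
        th (Γ.wt γ) * κ * #I := mul_le_mul_of_nonneg_left hcard (by positivity)
    have h5 : C * (th (Γ.wt γ) * κ * (#{k ∈ I | N (k + 1) ≤ ξ} + #{k ∈ I | ξ ≤ N k})) ≤
        C * (th (Γ.wt γ) * κ * #I) := mul_le_mul_of_nonneg_left h4 hC
    have h6 : th (Γ.wt γ) * (C * D + 3 * C) ≤ 1 / 4 * (C * D + 3 * C) := by gcongr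
    rw [hage]
    have h7 : 0 ≤ C * D := by positivity
    nlinarith

theorem Blocks.sum_le_card (h : Γ.Blocks C N x) (γ : ℕ) (I : Finset ℕ) :
    ‖∑ k ∈ I, Γ.e γ (x k)‖ ≤ C * #I := by
  refine (norm_sum_le_of_le I (fun k _ => h.nb k γ)).trans ?_
  rw [sum_const, nsmul_eq_mul, mul_comm]

theorem age_le' {γ j : ℕ} (h : Γ.wt γ ≤ j) : Γ.age γ ≤ nn j := by
  rcases Nat.eq_zero_or_pos γ with rfl | h0
  · rw [Γ.age_zero]; exact Nat.zero_le _
  · exact (Γ.age_le γ h0).trans (nn_mono h)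

theorem Blocks.depth (h : Γ.Blocks C N x) {j : ℕ} {ρ : ℝ} (hρ : 0 ≤ ρ)
    (hH : ∀ γ, j < Γ.wt γ → ∀ I : Finset ℕ, ‖∑ k ∈ I, Γ.e γ (x k)‖ ≤ C * (ρ * #I + 1)) (s : ℕ) :
    ∀ γ (I : Finset ℕ), ‖∑ k ∈ I, Γ.e γ (x k)‖ ≤
      C * (max ρ ((1 / 4) ^ s) * #I + (6 * nn j) ^ s) := by
  have hC := (h.nb 0).nonneg
  have hn : (1 : ℝ) ≤ nn j := by exact_mod_cast one_le_nn j
  induction s with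
  | zero =>
    intro γ I
    refine (h.sum_le_card γ I).trans ?_
    gcongr
    have : (1 : ℝ) * #I ≤ max ρ ((1 / 4) ^ 0) * #I := by
      gcongr
      rw [pow_zero]; exact le_max_right _ _
    rw [pow_zero (6 * _)]
    linarith
  | succ s ih =>
    intro γ I
    have hpow : (1 : ℝ) ≤ (6 * nn j) ^ s := one_le_pow₀ (by linarith)
    rcases lt_or_ge j (Γ.wt γ) with hj | hj
    · refine (hH γ hj I).trans ?_
      gcongr
      · exact le_max_left _ _
      · exact one_le_pow₀ (by linarith)
    · refine (h.inner (le_max_of_le_left hρ) (by positivity) ih γ I).trans ?_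
      have hmax : 0 ≤ max ρ ((1 / 4) ^ s) := le_max_of_le_left hρ
      gcongr
      · calc th (Γ.wt γ) * max ρ ((1 / 4) ^ s) ≤ 1 / 4 * max ρ ((1 / 4) ^ s) := by
              gcongr; exact th_le _
          _ = max (1 / 4 * ρ) ((1 / 4) ^ (s + 1)) := by
              rw [mul_max_of_nonneg _ _ (by norm_num), pow_succ']
          _ ≤ _ := max_le_max (by linarith) le_rfl
      · calc (Γ.age γ : ℝ) * ((6 * nn j) ^ s + 5) ≤ nn j * (6 * (6 * nn j) ^ s) := by
              gcongr
              · exact age_le' hj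
              · linarith
          _ = _ := by ring

/-- The properties of normalised averages of rapidly increasing sequences. -/
structure Avg (Γ : Nodes) (C : ℝ) (j : ℕ) (z : ℕ → A) : Prop where
  nb : Γ.NB z (2 * C)
  lt : ∀ ξ γ, Γ.wt γ < j → ‖Γ.e γ (BD.tail ξ z)‖ ≤ 2 * C * th (Γ.wt γ)
  gt : ∀ ξ γ, j < Γ.wt γ → ‖Γ.e γ (BD.tail ξ z)‖ ≤ 2 * C * th j
  coord : ∀ n, ‖z n‖ ≤ 2 * C * th j

theorem RIS.sum_le (h : Γ.RIS C N x) (γ : ℕ) (I : Finset ℕ) :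
    ‖∑ k ∈ I, Γ.e γ (x k)‖ ≤ C * (th (Γ.wt γ) * #I + 1) := by
  classical
  have hC := (h.nb 0).nonneg
  obtain ⟨k0, hk0⟩ := h.exists_exception γ
  have hth := th_pos (Γ.wt γ)
  have h1 : ∀ k ∈ I, ‖Γ.e γ (x k)‖ ≤ C * th (Γ.wt γ) + if k = k0 then C else 0 := by
    intro k _
    split_ifs with hk
    · have := h.nb k γ
      have : 0 ≤ C * th (Γ.wt γ) := by positivity
      linarith [h.nb k γ]
    · rw [add_zero]; exact hk0 k hk
  refine (norm_sum_le_of_le I h1).trans ?_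
  rw [sum_add_distrib, sum_const, nsmul_eq_mul, sum_ite_eq']
  have : (if k0 ∈ I then C else 0) ≤ C := by split_ifs <;> linarith
  nlinarith

theorem RIS.avg (h : Γ.RIS C N x) (j : ℕ) :
    Γ.Avg C (j + 1) (((mm (j + 1) : ℝ) / nn (j + 1)) • ∑ k ∈ range (nn (j + 1)), x k) := by
  have hC := (h.nb 0).nonneg
  set m : ℝ := (mm (j + 1) : ℝ) with hm
  set n : ℝ := (nn (j + 1) : ℝ) with hn
  have hm4 : (4 : ℝ) ≤ m := by rw [hm]; exact_mod_cast four_le_mm (j + 1)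
  have hmth : m * th (j + 1) = 1 := mm_mul_th _
  have hth := th_pos (j + 1)
  set D : ℝ := (6 * nn j) ^ (mm (j + 1)) with hDdef
  have hnj : (1 : ℝ) ≤ nn j := by exact_mod_cast one_le_nn j
  have hD1 : 1 ≤ D := one_le_pow₀ (by linarith)
  have hn1 : 2 * m ^ 2 * (6 * nn j * D) ≤ n := by
    have := le_nn_succ j
    have h2 : ((2 * mm (j + 1) ^ 2 * (6 * nn j) ^ (mm (j + 1) + 1) : ℕ) : ℝ) ≤ nn (j + 1) := by
      exact_mod_cast this
    push_cast at h2
    rw [pow_succ] at h2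
    calc _ = 2 * m ^ 2 * (D * (6 * nn j)) := by ring
      _ ≤ _ := h2
  have hnj' : 1 ≤ nn j * D := by nlinarith
  have hn0 : 0 < n := by nlinarith [mul_pos (show 0 < m by linarith) (show 0 < m by linarith)]
  have hmax : max (th (j + 1)) ((1 / 4) ^ mm (j + 1)) = th (j + 1) := by
    apply max_eq_left
    unfold th
    rw [one_div_pow]
    gcongr
    exact_mod_cast (Nat.lt_pow_self (show 1 < 4 by norm_num)).le
  have hdep := h.depth (j := j) (ρ := th (j + 1)) hth.le (fun γ hγ I => (h.sum_le γ I).trans (by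
    gcongr; exact th_anti (by omega))) (mm (j + 1))
  rw [hmax] at hdep
  have hr : 0 ≤ m / n := by positivity
  have hcoef : ∀ {v : A} {s : ℝ}, ‖v‖ ≤ C * (s * n) → ‖(m / n) • v‖ ≤ C * (s * m) := by
    intro v s hv
    rw [norm_smul, Real.norm_of_nonneg hr]
    calc m / n * ‖v‖ ≤ m / n * (C * (s * n)) := by gcongr
      _ = _ := by field_simp
  have hcard : (#(range (nn (j + 1))) : ℝ) = n := by simp [hn]
  have hsmall : D + 3 ≤ th (j + 1) * n := by
    have : 4 * D ≤ th (j + 1) * (2 * m ^ 2 * (6 * nn j * D)) := by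
      calc 4 * D ≤ (m * th (j + 1)) * (2 * m * (6 * (nn j * D))) := by
            rw [hmth]; nlinarith
        _ = _ := by ring
    nlinarith
  have htail : ∀ ξ γ, ‖Γ.e γ (BD.tail ξ ((m / n) • ∑ k ∈ range (nn (j + 1)), x k))‖ ≤ 2 * C := by
    intro ξ γ
    rw [LinearMap.map_smul_of_tower, e_rsmul, map_sum, map_sum]
    refine (hcoef (s := 2 * th (j + 1)) ?_).trans (le_of_eq ?_)
    · refine (h.sum_tail_le hth.le (hdep γ) ξ _).trans ?_
      gcongr
      rw [hcard]
      linarith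
    · linear_combination 2 * C * hmth
  refine ⟨fun γ => ?_, fun ξ γ hγ => ?_, fun ξ γ hγ => ?_, fun i => ?_⟩
  · refine le_trans (le_of_eq ?_) (htail 0 γ)
    rw [Blk.tail_eq (p := 0) (q := N (nn (j + 1)))]
    · refine Blk.rsmul (Blk.sum _ fun k hk => (h.blk_zero k).mono le_rfl ?_) _
      exact h.mono.monotone (by have := mem_range.1 hk; omega)
    · exact le_rfl
  · rw [LinearMap.map_smul_of_tower, e_rsmul, map_sum, map_sum]
    refine (hcoef (s := 2 * th (Γ.wt γ) * th (j + 1)) ?_).trans (le_of_eq ?_)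
    · refine (h.sum_tail_le (mul_nonneg (th_pos _).le hth.le)
        (h.inner hth.le (by positivity) hdep γ) ξ _).trans ?_
      gcongr
      rw [hcard]
      have h1 : (Γ.age γ : ℝ) * (D + 5) ≤ nn j * (6 * D) := by
        gcongr
        · exact age_le' (by omega)
        · linarith
      have h2 : (nn j : ℝ) * (6 * D) + 3 ≤ th (j + 1) * th (j + 1) * n := by
        calc (nn j : ℝ) * (6 * D) + 3 ≤ (m * th (j + 1)) ^ 2 * (2 * (6 * nn j * D)) := by
              rw [hmth]; nlinarith
          _ = th (j + 1) * th (j + 1) * (2 * m ^ 2 * (6 * nn j * D)) := by ring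
          _ ≤ _ := by gcongr
      have h3 : th (j + 1) * th (j + 1) * n ≤ th (Γ.wt γ) * th (j + 1) * n := by
        gcongr
        exact th_anti (by omega)
      linarith
    · linear_combination 2 * C * th (Γ.wt γ) * hmth
  · rw [LinearMap.map_smul_of_tower, e_rsmul, map_sum, map_sum]
    refine (hcoef (s := 2 * th (j + 1) ^ 2) ?_).trans (le_of_eq ?_)
    · refine (h.sum_tail_le (th_pos _).le (h.sum_le γ) ξ _).trans ?_
      gcongr
      rw [hcard]
      have h1 := th_lt_sq hγ
      have h2 : 4 ≤ th (j + 1) ^ 2 * n := by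
        calc 4 ≤ (m * th (j + 1)) ^ 2 * (2 * (6 * (nn j * D))) := by rw [hmth]; linarith
          _ = th (j + 1) ^ 2 * (2 * m ^ 2 * (6 * nn j * D)) := by ring
          _ ≤ _ := by gcongr
      nlinarith
    · linear_combination 2 * C * th (j + 1) * hmth
  · rw [Pi.smul_apply, Finset.sum_apply]
    refine (hcoef (s := 2 * th (j + 1) ^ 2) ?_).trans (le_of_eq ?_)
    · refine (h.sum_coord_le i _).trans ?_
      rw [mul_comm]
      gcongr
      calc 3 ≤ (m * th (j + 1)) ^ 2 * (2 * (2 * (6 * (nn j * D)))) := by rw [hmth]; linarith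
        _ = 2 * th (j + 1) ^ 2 * (2 * m ^ 2 * (6 * nn j * D)) := by ring
        _ ≤ _ := by gcongr
    · linear_combination 2 * C * th (j + 1) * hmth

end Nodes

end BD

namespace BD

open Finset

theorem tau_mul_eps (a : A) : tau (a * eps) = re a := by simp [tau_mul, eps]

theorem exists_separating {m : ℕ} (u v : Fin m → A) {δ : ℝ}
    (h : ∀ a : A, ∃ η, δ ≤ ‖v η - a * u η‖) :
    ∃ b : Fin m → A, ∑ η, ‖b η‖ ≤ 1 ∧ ∑ η, b η * u η = 0 ∧ δ / 2 ≤ tau (∑ η, b η * v η) := by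
  let M : Submodule ℝ (Fin m → A) := LinearMap.range
    ((LinearMap.toSpanSingleton A (Fin m → A) u).restrictScalars ℝ)
  obtain ⟨g, hg1, hg2⟩ := exists_dual_vector'' ℝ (M.mkQ v)
  let f : (Fin m → A) →ₗ[ℝ] ℝ := g.toLinearMap.comp M.mkQ
  have hf1 : ∀ w, |f w| ≤ ‖w‖ := fun w => by
    have h1 := g.le_opNorm (M.mkQ w)
    have h2 : ‖M.mkQ w‖ ≤ ‖w‖ := Submodule.Quotient.norm_mk_le M w
    have h3 : ‖g‖ * ‖M.mkQ w‖ ≤ 1 * ‖w‖ := by gcongr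
    rw [one_mul] at h3
    exact h1.trans h3
  have hf2 : ∀ a : A, f (a • u) = 0 := fun a => by
    have : M.mkQ (a • u) = 0 := by
      rw [Submodule.mkQ_apply, Submodule.Quotient.mk_eq_zero]
      exact ⟨a, rfl⟩
    simp only [f, LinearMap.comp_apply, this, map_zero]
  have hf3 : δ ≤ f v := by
    have h1 : f v = ‖M.mkQ v‖ := hg2
    rw [h1]
    refine le_of_forall_pos_le_add fun r hr => ?_
    obtain ⟨w, hw1, hw2⟩ := Submodule.Quotient.norm_mk_lt (S := M) (M.mkQ v) hr
    have h2 : v - w ∈ M := by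
      rw [← Submodule.Quotient.eq]; exact hw1.symm
    obtain ⟨a, ha⟩ := h2
    obtain ⟨η, hη⟩ := h a
    have h3 : w = v - a • u := by
      have : a • u = v - w := ha
      rw [this]; abel
    have h4 := norm_le_pi_norm w η
    rw [h3, Pi.sub_apply, Pi.smul_apply, smul_eq_mul, ← h3] at h4
    linarith
  let c : Fin m → A := fun η => A.mk (f (Pi.single η eps)) (f (Pi.single η 1))
  have hfc : ∀ w, f w = tau (∑ η, c η * w η) := by
    intro w
    have h1 : w = ∑ η, (re (w η) • (Pi.single η 1 : Fin m → A) +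
        tau (w η) • (Pi.single η eps : Fin m → A)) := by
      funext i
      rw [Finset.sum_apply, Finset.sum_eq_single i]
      · simp only [Pi.add_apply, Pi.smul_apply, Pi.single_eq_same]
        ext <;> simp [eps, re_one, tau_one]
      · intro j _ hj
        simp [Pi.single_eq_of_ne hj.symm]
      · simp
    conv_lhs => rw [h1]
    rw [map_sum, map_sum]
    refine Finset.sum_congr rfl fun η _ => ?_
    rw [map_add, map_smul, map_smul, tau_mul]
    simp only [c, re_mk, tau_mk, smul_eq_mul]
    ring
  have hc : ∑ η, ‖c η‖ ≤ 2 := by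
    let w : Fin m → A := fun η =>
      A.mk (SignType.sign (tau (c η)) : ℝ) (SignType.sign (re (c η)) : ℝ)
    have h1 : f w = ∑ η, ‖c η‖ := by
      rw [hfc, map_sum]
      refine Finset.sum_congr rfl fun η _ => ?_
      rw [tau_mul, norm_eq]
      simp only [w, re_mk, tau_mk]
      rw [mul_comm (re _), mul_comm (tau _), sign_mul_self, sign_mul_self]
    have hs : ∀ r : ℝ, |(SignType.sign r : ℝ)| ≤ 1 := by
      intro r
      rcases lt_trichotomy r 0 with h | h | h <;> simp [h]
    have h2 : ‖w‖ ≤ 2 := by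
      refine (pi_norm_le_iff_of_nonneg (by norm_num)).2 fun η => ?_
      rw [norm_eq]
      simp only [w, re_mk, tau_mk]
      linarith [hs (tau (c η)), hs (re (c η))]
    rw [← h1]
    exact (le_abs_self _).trans ((hf1 w).trans h2)
  have h0 : ∑ η, c η * u η = 0 := by
    have h1 : ∀ a : A, tau ((∑ η, c η * u η) * a) = 0 := by
      intro a
      rw [← hf2 a, hfc, sum_mul]
      congr 1
      refine Finset.sum_congr rfl fun η _ => ?_
      simp only [Pi.smul_apply, smul_eq_mul]; ring
    ext
    · rw [← tau_mul_eps, h1, map_zero]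
    · rw [← mul_one (∑ η, c η * u η), h1, map_zero]
  refine ⟨fun η => (1 / 2 : ℝ) • c η, ?_, ?_, ?_⟩
  · simp_rw [norm_smul, ← mul_sum]
    norm_num
    linarith
  · simp_rw [smul_mul_assoc, ← smul_sum, h0, smul_zero]
  · simp_rw [smul_mul_assoc, ← smul_sum]
    rw [map_smul, ← hfc, smul_eq_mul]
    linarith

theorem exists_separating_range {m : ℕ} (u v : ℕ → A) {δ : ℝ}
    (h : ∀ a : A, ∃ η < m, δ ≤ ‖v η - a * u η‖) :
    ∃ b : ℕ → A, ∑ η ∈ range m, ‖b η‖ ≤ 1 ∧ ∑ η ∈ range m, b η * u η = 0 ∧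
      δ / 2 ≤ tau (∑ η ∈ range m, b η * v η) := by
  obtain ⟨b, h1, h2, h3⟩ := exists_separating (fun i : Fin m => u i) (fun i : Fin m => v i)
    (δ := δ) (fun a => by
      obtain ⟨η, hη, h'⟩ := h a
      exact ⟨⟨η, hη⟩, h'⟩)
  refine ⟨fun η => if h : η < m then b ⟨η, h⟩ else 0, ?_, ?_, ?_⟩
  · simpa [Finset.sum_range] using h1
  · simpa [Finset.sum_range] using h2
  · simpa [Finset.sum_range] using h3

namespace Nodes

variable (Γ : Nodes)

theorem exists_le_of_blk {p q : ℕ} {x : ℕ → A} (hx : Blk p q x) {δ : ℝ} (hδ : 0 < δ) {γ : ℕ}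
    (h : δ ≤ ‖Γ.e γ x‖) : ∃ η < q + 1, δ / 4 ≤ ‖Γ.e η x‖ := by
  by_contra! hc
  have h1 : BD.head q x = x := by
    funext n; rw [head_apply]; split_ifs with h1
    · rfl
    · exact (hx n (by omega)).symm
  have h2 := NB.head' (Γ := Γ) (x := x) (m := q) (C := δ / 4)
    (fun η hη => (hc η (by omega)).le) γ
  rw [h1] at h2
  linarith

/-- The graph-like subspace `G` contains pairs whose second component is far from the multiples
of a small first component. -/
def Sep (G : Submodule ℝ ((ℕ → A) × (ℕ → A))) (C δ : ℝ) : Prop :=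
  ∀ (N : ℕ) (ε : ℝ), 0 < ε → ∃ p ∈ G, ∃ x y, Γ.Fine C N x ∧ (∃ q, Blk N q y) ∧
    Γ.NB (p.1 - x) ε ∧ Γ.NB (p.2 - y) ε ∧ ∀ a : A, ∃ γ, δ ≤ ‖Γ.e γ (y - a • x)‖

theorem B_of_tail {γ : ℕ} {x : ℕ → A} (h : tail (Γ.pred γ) x = 0) : Γ.B γ x = 0 := by
  simp [B, h]

variable {Γ}

theorem exists_node {ξ j L q : ℕ} (hj : Even j) (hξ : ξ = 0 ∨ Γ.wt ξ = j) (hage : Γ.age ξ < nn j)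
    (hL : ξ ≤ L) {x y : ℕ → A} (hx : Blk L q x) (hy : Blk L q y) {δ ε : ℝ} (hδ : 0 < δ)
    (hε : 0 < ε) (hsep : ∀ a : A, ∃ γ, δ ≤ ‖Γ.e γ (y - a • x)‖) :
    ∃ ξ', q < ξ' ∧ L < ξ' ∧ Γ.pred ξ' = ξ ∧ Γ.wt ξ' = j ∧ ‖Γ.B ξ' x‖ ≤ ε ∧
      δ / 16 ≤ tau (Γ.B ξ' y) := by
  obtain ⟨b, hb1, hb2, hb3⟩ := exists_separating_range (m := q + 1) (fun η => Γ.e η x)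
    (fun η => Γ.e η y) (δ := δ / 4) (fun a => by
      obtain ⟨γ, hγ⟩ := hsep a
      obtain ⟨η, hη, h'⟩ := Γ.exists_le_of_blk (hy.sub (hx.smul a)) hδ hγ
      exact ⟨η, hη, by simpa using h'⟩)
  obtain ⟨Cx, hCx, hCx'⟩ := exists_NB (Γ := Γ) (x := x) (q := q) fun n hn => hx n (Or.inr hn)
  obtain ⟨Cy, hCy, hCy'⟩ := exists_NB (Γ := Γ) (x := y) (q := q) fun n hn => hy n (Or.inr hn)
  set r : ℝ := min ε (δ / 16) / (Cx + Cy) with hr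
  have hr0 : 0 < r := by positivity
  obtain ⟨ξ', h1, h2, h3, h4, h5, h6⟩ := Γ.rich_even ξ j hj hξ hage b (q + 1) hb1 r hr0
    (max (L + 1) (q + 1))
  have hB : ∀ {v : ℕ → A} {Cv : ℝ}, 0 < Cv → Cv ≤ Cx + Cy → Blk L q v → Γ.NB v Cv →
      ‖Γ.B ξ' v - ∑ η ∈ range (q + 1), b η * Γ.e η v‖ ≤ min ε (δ / 16) := by
    intro v Cv hCv hCv' hv hnb
    have hs : ∑ η ∈ range (q + 1), b η * Γ.e η v =
        ∑ η ∈ range ξ', (if η < q + 1 then b η else 0) * Γ.e η v := by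
      simp_rw [ite_mul, zero_mul]
      rw [← sum_filter]
      congr 1
      ext i; simp; omega
    rw [hs, B, h4, hv.tail_eq hL, ← sum_sub_distrib]
    calc _ ≤ ∑ η ∈ range ξ', ‖Γ.b ξ' η - if η < q + 1 then b η else 0‖ * Cv := by
          refine norm_sum_le_of_le _ fun η _ => ?_
          rw [← sub_mul]
          exact (norm_mul_le _ _).trans (mul_le_mul_of_nonneg_left (hnb η) (norm_nonneg _))
      _ ≤ r * (Cx + Cy) := by
          rw [← sum_mul]
          exact mul_le_mul h6 hCv' hCv.le hr0.le
      _ = _ := by rw [hr]; field_simp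
  refine ⟨ξ', by simp at h1; omega, by simp at h1; omega, h4, h5, ?_, ?_⟩
  · have := hB hCx (by linarith) hx hCx'
    rw [hb2, sub_zero] at this
    exact this.trans (min_le_left _ _)
  · have h7 := (hB hCy (by linarith) hy hCy').trans (min_le_right _ _)
    have h8 := (abs_tau_le _).trans h7
    rw [map_sub] at h8
    have h9 := (abs_le.1 h8).1
    linarith

/-- Successive nodes of weight `j`. -/
structure Chain (Γ : Nodes) (j : ℕ) (ξ N : ℕ → ℕ) : Prop where
  mono : StrictMono N
  zero : ξ 0 = 0
  pred : ∀ r < nn j, Γ.pred (ξ (r + 1)) = ξ r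
  wt : ∀ r < nn j, Γ.wt (ξ (r + 1)) = j
  eq : ∀ r < nn j, N (r + 1) = ξ (r + 1)

theorem exists_chain {P : Type*} [Inhabited P] {j : ℕ} (Q : ℕ → ℕ → P → ℕ → Prop)
    (step : ∀ ξ L, (ξ = 0 ∨ Γ.wt ξ = j) → Γ.age ξ < nn j → ξ ≤ L →
      ∃ p ξ', Q ξ L p ξ' ∧ L < ξ' ∧ Γ.pred ξ' = ξ ∧ Γ.wt ξ' = j) (L0 : ℕ) :
    ∃ (ξ N : ℕ → ℕ) (p : ℕ → P), Γ.Chain j ξ N ∧ N 0 = L0 ∧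
      ∀ r < nn j, Q (ξ r) (N r) (p r) (ξ (r + 1)) := by
  classical
  choose! f g h1 h2 h3 h4 using step
  let st : ℕ → ℕ × ℕ := fun r => Nat.rec (0, L0) (fun r s =>
    if r < nn j then (g s.1 s.2, g s.1 s.2) else (0, s.2 + 1)) r
  have hst : ∀ r, st (r + 1) = if r < nn j then (g (st r).1 (st r).2, g (st r).1 (st r).2)
    else (0, (st r).2 + 1) := fun r => rfl
  have hinv : ∀ r, r ≤ nn j → ((st r).1 = 0 ∨ Γ.wt (st r).1 = j) ∧ Γ.age (st r).1 = r ∧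
      (st r).1 ≤ (st r).2 := by
    intro r
    induction r with
    | zero => intro _; exact ⟨Or.inl rfl, Γ.age_zero, Nat.zero_le _⟩
    | succ r ih =>
      intro hr
      obtain ⟨i1, i2, i3⟩ := ih (by omega)
      have hlt : r < nn j := by omega
      rw [hst, if_pos hlt]
      have h5 := h2 _ _ i1 (by omega) i3
      refine ⟨Or.inr (h4 _ _ i1 (by omega) i3), ?_, le_rfl⟩
      rw [Γ.age_pos _ (by dsimp only; omega)]
      dsimp only
      rw [h3 _ _ i1 (by omega) i3, i2]
  refine ⟨fun r => (st r).1, fun r => (st r).2, fun r => f (st r).1 (st r).2,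
    ⟨strictMono_nat_of_lt_succ fun r => ?_, rfl, fun r hr => ?_, fun r hr => ?_, fun r hr => ?_⟩,
    rfl, fun r hr => ?_⟩
  · rw [hst]
    split_ifs with hr
    · obtain ⟨i1, i2, i3⟩ := hinv r hr.le
      exact h2 _ _ i1 (by omega) i3
    · exact Nat.lt_succ_self _
  all_goals
    obtain ⟨i1, i2, i3⟩ := hinv r hr.le
    simp only [hst, if_pos hr]
  · exact h3 _ _ i1 (by omega) i3
  · exact h4 _ _ i1 (by omega) i3
  · exact h1 _ _ i1 (by omega) i3

namespace Chain

variable {j : ℕ} {ξ N : ℕ → ℕ}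

theorem le (h : Γ.Chain j ξ N) {r : ℕ} (hr : r ≤ nn j) : ξ r ≤ N r := by
  rcases r with _ | r
  · rw [h.zero]; exact Nat.zero_le _
  · exact (h.eq r (by omega)).ge

theorem lt (h : Γ.Chain j ξ N) {r s : ℕ} (hrs : r < s) (hs : s ≤ nn j) : ξ r < ξ s := by
  obtain ⟨s, rfl⟩ : ∃ t, s = t + 1 := ⟨s - 1, by omega⟩
  rw [← h.eq s (by omega)]
  exact (h.le (by omega)).trans_lt (h.mono hrs)

theorem e_eq (h : Γ.Chain j ξ N) {r q : ℕ} {v : ℕ → A} (hv : Blk (N r) q v)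
    (hq : q < ξ (r + 1)) {s : ℕ} (hrs : r < s) (hs : s ≤ nn j) :
    Γ.e (ξ s) v = th j • Γ.B (ξ (r + 1)) v := by
  induction s, hrs using Nat.le_induction with
  | base =>
    have h1 := h.lt (Nat.lt_succ_self r) (by omega)
    rw [e_pos _ (by omega), hv _ (Or.inr hq), zero_add, h.pred r (by omega), h.wt r (by omega),
      Γ.e_blk_of_le (h.le (by omega)) hv, zero_add]
  | succ s hrs ih =>
    have h1 : ξ s < ξ (s + 1) := h.lt (Nat.lt_succ_self s) (by omega)
    have h2 : ξ (r + 1) ≤ ξ s := by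
      rcases eq_or_lt_of_le hrs with h3 | h3
      · exact (congrArg ξ h3).le
      · exact (h.lt h3 (by omega)).le
    have h3 := Γ.B_of_tail (γ := ξ (s + 1)) (hv.tail_zero (by rw [h.pred s (by omega)]; omega))
    rw [e_pos _ (by omega), hv _ (Or.inr (by omega)), zero_add, h.pred s (by omega),
      ih (by omega), h3, smul_zero, add_zero]

end Chain

end Nodes

end BD

namespace BD

open Finset

noncomputable instance : Inhabited A := ⟨0⟩

namespace Nodes

variable {Γ : Nodes} {G : Submodule ℝ ((ℕ → A) × (ℕ → A))} {C δ : ℝ}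

theorem Sep.nonneg (h : Γ.Sep G C δ) : 0 ≤ C := by
  obtain ⟨p, -, x, y, hx, -⟩ := h 0 1 one_pos
  exact hx.nb.nonneg

/-- A sequence cut off at the length of a chain. -/
noncomputable def cut (n : ℕ) (x : ℕ → ℕ → A) (r : ℕ) : ℕ → A := if r < n then x r else 0

theorem cut_of_lt {n r : ℕ} {x : ℕ → ℕ → A} (h : r < n) : cut n x r = x r := if_pos h
theorem cut_of_le {n r : ℕ} {x : ℕ → ℕ → A} (h : n ≤ r) : cut n x r = 0 := if_neg (by omega)

theorem sum_cut {n : ℕ} {x : ℕ → ℕ → A} : ∑ r ∈ range n, cut n x r = ∑ r ∈ range n, x r :=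
  sum_congr rfl fun _ hr => cut_of_lt (mem_range.1 hr)

theorem Chain.blk_sum {j : ℕ} {ξ N : ℕ → ℕ} (h : Γ.Chain j ξ N) {x : ℕ → ℕ → A} {q : ℕ → ℕ}
    (hx : ∀ r < nn j, Blk (N r) (q r) (x r)) (hq : ∀ r < nn j, q r < ξ (r + 1)) :
    Blk (N 0) (N (nn j)) (∑ r ∈ range (nn j), x r) := by
  refine Blk.sum _ fun r hr => ?_
  have hr := mem_range.1 hr
  refine (hx r hr).mono (h.mono.monotone (Nat.zero_le _)) ?_
  have h1 := hq r hr
  rw [← h.eq r hr] at h1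
  exact h1.le.trans (h.mono.monotone hr)

theorem Chain.blocks {j : ℕ} {ξ N : ℕ → ℕ} (h : Γ.Chain j ξ N) {x : ℕ → ℕ → A} {q : ℕ → ℕ}
    (hx : ∀ r < nn j, Blk (N r) (q r) (x r)) (hq : ∀ r < nn j, q r < ξ (r + 1)) (hC : 0 ≤ C)
    (hnb : ∀ r < nn j, Γ.NB (x r) C) : Γ.Blocks C N (cut (nn j) x) := by
  refine ⟨h.mono, fun k => ?_, fun k => ?_⟩
  all_goals rcases lt_or_ge k (nn j) with hk | hk
  · rw [cut_of_lt hk]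
    refine (hx k hk).mono le_rfl ?_
    rw [h.eq k hk]; exact (hq k hk).le
  · rw [cut_of_le hk]; exact Blk.zero
  · rw [cut_of_lt hk]; exact hnb k hk
  · rw [cut_of_le hk]; exact NB.zero.mono hC

theorem Chain.e_sum {j : ℕ} {ξ N : ℕ → ℕ} (h : Γ.Chain j ξ N) {x : ℕ → ℕ → A} {q : ℕ → ℕ}
    (hx : ∀ r < nn j, Blk (N r) (q r) (x r)) (hq : ∀ r < nn j, q r < ξ (r + 1)) :
    Γ.e (ξ (nn j)) (∑ r ∈ range (nn j), x r) =
      th j • ∑ r ∈ range (nn j), Γ.B (ξ (r + 1)) (x r) := by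
  rw [map_sum, smul_sum]
  refine sum_congr rfl fun r hr => ?_
  have hr := mem_range.1 hr
  exact h.e_eq (hx r hr) (hq r hr) hr le_rfl

theorem Chain.wt_last {j : ℕ} {ξ N : ℕ → ℕ} (h : Γ.Chain j ξ N) : Γ.wt (ξ (nn j)) = j := by
  have := one_le_nn j
  have h1 := h.wt (nn j - 1) (by omega)
  rwa [show nn j - 1 + 1 = nn j by omega] at h1

theorem Sep.exists_avg (hG : Γ.Sep G C δ) (hδ : 0 < δ) {j : ℕ} (hj : Even (j + 1)) (L : ℕ)
    {ε : ℝ} (hε : 0 < ε) : ∃ p ∈ G, ∃ z y q η, Γ.Avg C (j + 1) z ∧ Blk L q z ∧ Blk L q y ∧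
      Γ.wt η = j + 1 ∧ ‖Γ.e η z‖ ≤ ε ∧ δ / 16 ≤ tau (Γ.e η y) ∧
      Γ.NB (p.1 - z) ε ∧ Γ.NB (p.2 - y) ε := by
  have hC := hG.nonneg
  set m : ℝ := (mm (j + 1) : ℝ) with hm
  set n : ℝ := (nn (j + 1) : ℝ) with hn
  have hm0 : 0 < m := by
    rw [hm]; exact_mod_cast (show 0 < mm (j + 1) by have := four_le_mm (j + 1); omega)
  have hm1 : 1 ≤ m := by
    rw [hm]; exact_mod_cast (show 1 ≤ mm (j + 1) by have := four_le_mm (j + 1); omega)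
  have hn0 : 0 < n := by rw [hn]; exact_mod_cast one_le_nn (j + 1)
  have hmth : m * th (j + 1) = 1 := mm_mul_th _
  have hth := th_pos (j + 1)
  let Q : ℕ → ℕ → ((ℕ → A) × (ℕ → A)) × (ℕ → A) × (ℕ → A) × ℕ → ℕ → Prop := fun ξ L s ξ' =>
    s.1 ∈ G ∧ Γ.Fine C L s.2.1 ∧ Blk L s.2.2.2 s.2.1 ∧ Blk L s.2.2.2 s.2.2.1 ∧ s.2.2.2 < ξ' ∧
      Γ.NB (s.1.1 - s.2.1) (ε / m) ∧ Γ.NB (s.1.2 - s.2.2.1) (ε / m) ∧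
      ‖Γ.B ξ' s.2.1‖ ≤ ε ∧ δ / 16 ≤ tau (Γ.B ξ' s.2.2.1)
  obtain ⟨ξ, N, s, hch, hN0, hQ⟩ := exists_chain (Γ := Γ) (j := j + 1) Q (by
    intro ξ L hξ hage hL
    obtain ⟨p, hp, x, y, hx, ⟨q, hy⟩, hpx, hpy, hsep⟩ := hG L (ε / m) (by positivity)
    obtain ⟨q', hx'⟩ := hx.blk
    have hx'' := hx'.mono le_rfl (le_max_left q' q)
    have hy'' := hy.mono le_rfl (le_max_right q' q)
    obtain ⟨ξ', h1, h2, h3, h4, h5, h6⟩ := exists_node hj hξ hage hL hx'' hy'' hδ hε hsep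
    exact ⟨(p, x, y, max q' q), ξ', ⟨hp, hx, hx'', hy'', h1, hpx, hpy, h5, h6⟩, h2, h3, h4⟩) L
  set I := range (nn (j + 1)) with hI
  set X : ℕ → ℕ → A := fun r => (s r).2.1
  set Y : ℕ → ℕ → A := fun r => (s r).2.2.1
  have hq : ∀ r < nn (j + 1), (s r).2.2.2 < ξ (r + 1) := fun r hr => (hQ r hr).2.2.2.2.1
  have hX : ∀ r < nn (j + 1), Blk (N r) (s r).2.2.2 (X r) := fun r hr => (hQ r hr).2.2.1
  have hY : ∀ r < nn (j + 1), Blk (N r) (s r).2.2.2 (Y r) := fun r hr => (hQ r hr).2.2.2.1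
  have hris : Γ.RIS C N (cut (nn (j + 1)) X) :=
    ⟨hch.blocks hX hq hC fun r hr => (hQ r hr).2.1.nb, fun k γ hγ => by
      rcases lt_or_ge k (nn (j + 1)) with hk | hk
      · rw [cut_of_lt hk]; exact (hQ k hk).2.1.small γ hγ
      · rw [cut_of_le hk, map_zero, norm_zero]
        exact mul_nonneg hC (th_pos _).le⟩
  have havg := hris.avg j
  rw [sum_cut, ← hm, ← hn, ← hI] at havg
  have hr : 0 ≤ m / n := by positivity
  have hmn : ∀ t : ℝ, m / n * (∑ r ∈ I, t) = m * t := by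
    intro t
    rw [hI, sum_const, card_range, nsmul_eq_mul, ← hn]; field_simp
  refine ⟨(m / n) • ∑ r ∈ I, (s r).1, G.smul_mem _ (G.sum_mem fun r hr =>
    (hQ r (mem_range.1 hr)).1), _, (m / n) • ∑ r ∈ I, Y r, N (nn (j + 1)), ξ (nn (j + 1)), havg,
    ?_, ?_, hch.wt_last, ?_, ?_, ?_, ?_⟩
  · rw [← hN0]; exact (hch.blk_sum hX hq).rsmul _
  · rw [← hN0]; exact (hch.blk_sum hY hq).rsmul _
  · rw [e_rsmul, hch.e_sum hX hq, norm_smul, norm_smul, Real.norm_of_nonneg hr,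
      Real.norm_of_nonneg hth.le]
    calc m / n * (th (j + 1) * ‖∑ r ∈ I, Γ.B (ξ (r + 1)) (X r)‖)
        ≤ m / n * (th (j + 1) * ∑ r ∈ I, ε) := by
          gcongr
          exact norm_sum_le_of_le _ fun r hr => (hQ r (mem_range.1 hr)).2.2.2.2.2.2.2.1
      _ = th (j + 1) * (m / n * ∑ r ∈ I, ε) := by ring
      _ = (m * th (j + 1)) * ε := by rw [hmn]; ring
      _ = ε := by rw [hmth, one_mul]
  · rw [e_rsmul, hch.e_sum hY hq, map_smul, map_smul, map_sum, smul_eq_mul, smul_eq_mul]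
    calc δ / 16 = (m * th (j + 1)) * (δ / 16) := by rw [hmth, one_mul]
      _ = th (j + 1) * (m / n * ∑ r ∈ I, δ / 16) := by rw [hmn]; ring
      _ = m / n * (th (j + 1) * ∑ r ∈ I, δ / 16) := by ring
      _ ≤ _ := by
        gcongr with r hr
        exact (hQ r (mem_range.1 hr)).2.2.2.2.2.2.2.2
  · have h1 := (NB.sum I fun r hr => (hQ r (mem_range.1 hr)).2.2.2.2.2.1).rsmul (m / n)
    rw [abs_of_nonneg hr, hmn, mul_div_cancel₀ _ hm0.ne'] at h1
    convert h1 using 1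
    rw [sum_sub_distrib, smul_sub, Prod.smul_fst, Prod.fst_sum]
  · have h1 := (NB.sum I fun r hr => (hQ r (mem_range.1 hr)).2.2.2.2.2.2.1).rsmul (m / n)
    rw [abs_of_nonneg hr, hmn, mul_div_cancel₀ _ hm0.ne'] at h1
    convert h1 using 1
    rw [sum_sub_distrib, smul_sub, Prod.smul_snd, Prod.snd_sum]

theorem B_of_single {γ η : ℕ} (hη : η < γ) (hb : Γ.b γ = Pi.single η 1) (x : ℕ → A) :
    Γ.B γ x = Γ.e η (BD.tail (Γ.pred γ) x) := by
  rw [B, sum_eq_single_of_mem η (mem_range.2 hη)]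
  · rw [hb, Pi.single_eq_same, one_mul]
  · intro i _ hi
    rw [hb, Pi.single_eq_of_ne hi, zero_mul]

/-- A dependent sequence of averages attached to a chain of odd weight. -/
structure Dep (Γ : Nodes) (C : ℝ) (ε : ℝ) (j : ℕ) (ξ N : ℕ → ℕ) (z : ℕ → ℕ → A) (q η : ℕ → ℕ) :
    Prop extends Γ.Chain j ξ N where
  zero' : N 0 = 0
  avg : ∀ r < nn j, Γ.Avg C (sg j (ξ r)) (z r)
  blk : ∀ r < nn j, Blk (N r) (q r) (z r)
  q_lt : ∀ r < nn j, q r < ξ (r + 1)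
  η_lt : ∀ r < nn j, η r < ξ (r + 1)
  single : ∀ r < nn j, Γ.b (ξ (r + 1)) = Pi.single (η r) 1
  small : ∀ r < nn j, ‖Γ.e (η r) (z r)‖ ≤ ε

theorem Sep.exists_dep (hG : Γ.Sep G C δ) (hδ : 0 < δ) {j : ℕ} (hj : Odd j) {ε : ℝ}
    (hε : 0 < ε) : ∃ ξ N z q η, Γ.Dep C ε j ξ N z q η ∧ ∃ (y : ℕ → ℕ → A)
      (p : ℕ → (ℕ → A) × (ℕ → A)), ∀ r < nn j, Blk (N r) (q r) (y r) ∧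
        δ / 16 ≤ tau (Γ.e (η r) (y r)) ∧ p r ∈ G ∧ Γ.NB ((p r).1 - z r) ε ∧
        Γ.NB ((p r).2 - y r) ε := by
  let Q : ℕ → ℕ → ((ℕ → A) × (ℕ → A)) × (ℕ → A) × (ℕ → A) × ℕ × ℕ → ℕ → Prop := fun ξ L s ξ' =>
    s.1 ∈ G ∧ Γ.Avg C (sg j ξ) s.2.1 ∧ Blk L s.2.2.2.1 s.2.1 ∧ Blk L s.2.2.2.1 s.2.2.1 ∧
      s.2.2.2.1 < ξ' ∧ s.2.2.2.2 < ξ' ∧ Γ.b ξ' = Pi.single s.2.2.2.2 1 ∧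
      ‖Γ.e s.2.2.2.2 s.2.1‖ ≤ ε ∧ δ / 16 ≤ tau (Γ.e s.2.2.2.2 s.2.2.1) ∧
      Γ.NB (s.1.1 - s.2.1) ε ∧ Γ.NB (s.1.2 - s.2.2.1) ε
  obtain ⟨ξ, N, s, hch, hN0, hQ⟩ := exists_chain (Γ := Γ) (j := j) Q (by
    intro ξ L hξ hage hL
    obtain ⟨p, hp, z, y, q, η, h1, h2, h3, h4, h5, h6, h7, h8⟩ := hG.exists_avg hδ
      (j := sg j ξ - 1) (by
        have := lt_sg j ξ
        rw [show sg j ξ - 1 + 1 = sg j ξ by omega]; exact even_sg j ξ) L hε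
    have h9 : sg j ξ - 1 + 1 = sg j ξ := by
      have := lt_sg j ξ
      omega
    rw [h9] at h1 h4
    obtain ⟨ξ', i1, i2, i3, i4, i5, i6⟩ := Γ.rich_odd ξ j hj hξ hage η h4 (max (L + 1) (q + 1))
    have i1 : L + 1 ≤ ξ' ∧ q + 1 ≤ ξ' := by simpa using i1
    exact ⟨(p, z, y, q, η), ξ', ⟨hp, h1, h2, h3, by dsimp only; omega, i2, i6, h5, h6, h7, h8⟩,
      by omega, i4, i5⟩) 0
  refine ⟨ξ, N, fun r => (s r).2.1, fun r => (s r).2.2.2.1, fun r => (s r).2.2.2.2,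
    ⟨hch, hN0, fun r hr => (hQ r hr).2.1, fun r hr => (hQ r hr).2.2.1,
      fun r hr => (hQ r hr).2.2.2.2.1, fun r hr => (hQ r hr).2.2.2.2.2.1,
      fun r hr => (hQ r hr).2.2.2.2.2.2.1, fun r hr => (hQ r hr).2.2.2.2.2.2.2.1⟩,
    fun r => (s r).2.2.1, fun r => (s r).1, fun r hr => ?_⟩
  exact ⟨(hQ r hr).2.2.2.1, (hQ r hr).2.2.2.2.2.2.2.2.1, (hQ r hr).1,
    (hQ r hr).2.2.2.2.2.2.2.2.2.1, (hQ r hr).2.2.2.2.2.2.2.2.2.2⟩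

namespace Dep

variable {ε : ℝ} {j : ℕ} {ξ N q η : ℕ → ℕ} {z : ℕ → ℕ → A}

theorem N_eq (h : Γ.Dep C ε j ξ N z q η) {r : ℕ} (hr : r ≤ nn j) : N r = ξ r := by
  rcases r with _ | r
  · rw [h.zero', h.zero]
  · exact h.eq r hr

theorem B_eq (h : Γ.Dep C ε j ξ N z q η) {r : ℕ} (hr : r < nn j) {v : ℕ → A}
    (hv : Blk (N r) (q r) v) : Γ.B (ξ (r + 1)) v = Γ.e (η r) v := by
  rw [B_of_single (h.η_lt r hr) (h.single r hr), h.pred r hr, hv.tail_eq]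
  exact h.le hr.le

theorem e_eq_single (h : Γ.Dep C ε j ξ N z q η) {r s : ℕ} (hrs : r < s) (hs : s ≤ nn j)
    {v : ℕ → A} (hv : Blk (N r) (q r) v) : Γ.e (ξ s) v = th j • Γ.e (η r) v := by
  rw [h.e_eq hv (h.q_lt r (by omega)) hrs hs, h.B_eq (by omega) hv]

theorem le_of_ne (h : Γ.Dep C ε j ξ N z q η) (hC : 0 ≤ C) {r : ℕ} (hr : r < nn j) {γ ζ : ℕ}
    (hγ : Γ.wt γ = sg j ζ) (hne : ζ ≠ ξ r) (p : ℕ) :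
    ‖Γ.e γ (BD.tail p (z r))‖ ≤ 2 * C * th (j + 1) := by
  have h1 := h.avg r hr
  rcases lt_trichotomy (Γ.wt γ) (sg j (ξ r)) with h2 | h2 | h2
  · refine (h1.lt p γ h2).trans ?_
    gcongr
    apply th_anti
    rw [hγ]; exact lt_sg _ _
  · rw [hγ] at h2; exact absurd (sg_inj h2) hne
  · refine (h1.gt p γ h2).trans ?_
    gcongr
    apply th_anti
    exact lt_sg _ _

theorem exists_exception (h : Γ.Dep C ε j ξ N z q η) (hC : 0 ≤ C) (hε : 0 ≤ ε) (hj : Odd j)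
    (γ : ℕ) : (γ = 0 ∨ Γ.wt γ = j) → ∃ r0, ∀ r < nn j, r ≠ r0 →
      ‖Γ.e γ (z r)‖ ≤ 4 * C * th (j + 1) * Γ.age γ + ε := by
  induction γ using Nat.strong_induction_on with
  | _ γ ih =>
    intro hγ
    have hth := th_pos (j + 1)
    have hz0 : ∀ r < nn j, ∀ p ≤ N r, Γ.e p (z r) = 0 := fun r hr p hp =>
      Γ.e_blk_of_le hp (h.blk r hr)
    rcases Nat.eq_zero_or_pos γ with rfl | h0
    · refine ⟨0, fun r hr _ => ?_⟩
      rw [hz0 r hr 0 (Nat.zero_le _), norm_zero]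
      positivity
    have hwt := hγ.resolve_left h0.ne'
    set p := Γ.pred γ with hp
    have hpγ : p < γ := Γ.pred_lt γ h0
    obtain ⟨ζ, hζ, hb, hwζ⟩ := Γ.odd_cases γ (hwt ▸ hj)
    rw [hwt, ← hp] at hwζ
    have hage : (Γ.age γ : ℝ) = Γ.age p + 1 := by exact_mod_cast Γ.age_pos γ h0
    set t := 2 * C * th (j + 1) with ht
    have ht0 : 0 ≤ t := by positivity
    have hθ : th (Γ.wt γ) ≤ 1 := (th_le _).trans (by norm_num)
    have hθ0 := th_pos (Γ.wt γ)
    have hcoord : ∀ r < nn j, ‖z r γ‖ ≤ t := fun r hr => by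
      refine ((h.avg r hr).coord γ).trans ?_
      rw [ht]; gcongr
      exact th_anti (lt_sg _ _)
    have hexp : ∀ r, ‖Γ.e γ (z r)‖ ≤
        ‖z r γ‖ + (‖Γ.e p (z r)‖ + th (Γ.wt γ) * ‖Γ.e ζ (BD.tail p (z r))‖) := by
      intro r
      rw [e_pos _ h0, B_of_single hζ hb]
      refine (norm_add_le _ _).trans (add_le_add_right ((norm_add_le _ _).trans ?_) _)
      rw [norm_smul, Real.norm_of_nonneg hθ0.le]
    have hmain : ∀ r < nn j, p ≠ ξ r → ‖Γ.e γ (z r)‖ ≤ 2 * t + ‖Γ.e p (z r)‖ := by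
      intro r hr hne
      have h1 := h.le_of_ne hC hr hwζ hne p
      have h2 := hexp r
      have h3 := hcoord r hr
      have h4 : th (Γ.wt γ) * ‖Γ.e ζ (BD.tail p (z r))‖ ≤ 1 * t := by gcongr
      linarith
    by_cases hcase : ∃ l < nn j, p = ξ l
    · obtain ⟨l, hl, hpl⟩ := hcase
      refine ⟨l, fun r hr hrl => ?_⟩
      have hage1 : (1 : ℝ) ≤ Γ.age γ := by
        rw [hage]; linarith [(Nat.cast_nonneg (Γ.age p) : (0 : ℝ) ≤ _)]
      rcases lt_or_gt_of_ne hrl with h1 | h1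
      · have h2 : N (r + 1) ≤ p := by
          rw [hpl, ← h.N_eq hl.le]; exact h.mono.monotone h1
        have h3 := h.q_lt r hr
        rw [← h.eq r hr] at h3
        have h4 : Γ.e γ (z r) = th j • Γ.e (η r) (z r) := by
          rw [e_pos _ h0, h.blk r hr γ (Or.inr (by omega)), B_of_single hζ hb,
            (h.blk r hr).tail_zero (by omega), map_zero, smul_zero, add_zero, zero_add, ← hp, hpl,
            h.e_eq_single h1 hl.le (h.blk r hr)]
        rw [h4, norm_smul, Real.norm_of_nonneg (th_pos j).le]
        have h5 : th j * ‖Γ.e (η r) (z r)‖ ≤ 1 * ε := by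
          gcongr
          · exact (th_le _).trans (by norm_num)
          · exact h.small r hr
        have : 0 ≤ 4 * C * th (j + 1) * Γ.age γ := by positivity
        linarith
      · have h2 : p ≠ ξ r := by
          rw [hpl]; exact (h.lt h1 hr.le).ne
        have h3 := hmain r hr h2
        rw [hz0 r hr p (by rw [hpl, h.N_eq hr.le]; exact (h.lt h1 hr.le).le), norm_zero] at h3
        have : 2 * t * 1 ≤ 2 * t * Γ.age γ := by gcongr
        have h4 : 4 * C * th (j + 1) * Γ.age γ = 2 * t * Γ.age γ := by rw [ht]; ring
        linarith
    · push Not at hcase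
      have hp0 : p ≠ 0 := by
        rw [← h.zero]; exact hcase 0 (one_le_nn j)
      obtain ⟨r0, hr0⟩ := ih p hpγ (Or.inr (by rw [hp, Γ.wt_pred γ hp0, hwt]))
      refine ⟨r0, fun r hr hne => ?_⟩
      have h1 := hmain r hr (hcase r hr)
      have h2 := hr0 r hr hne
      rw [hage]
      have h4 : 4 * C * th (j + 1) * (Γ.age p + 1) = 4 * C * th (j + 1) * Γ.age p + 2 * t := by
        rw [ht]; ring
      linarith

theorem ris (h : Γ.Dep C ε j ξ N z q η) (hC : 0 ≤ C) : Γ.RIS (2 * C) N (cut (nn j) z) :=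
  ⟨h.blocks h.blk h.q_lt (by linarith) fun r hr => (h.avg r hr).nb, fun k γ hγ => by
    rcases lt_or_ge k (nn j) with hk | hk
    · rw [cut_of_lt hk]
      have h1 := (h.avg k hk).lt 0 γ (by
        have := lt_sg' j (ξ k)
        rw [h.N_eq hk.le] at hγ
        omega)
      rwa [(h.blk k hk).tail_eq (Nat.zero_le _)] at h1
    · rw [cut_of_le hk, map_zero, norm_zero]
      exact mul_nonneg (by linarith) (th_pos _).le⟩

end Dep

end Nodes

end BD

namespace BD

open Finset

namespace Nodes

variable {Γ : Nodes} {G : Submodule ℝ ((ℕ → A) × (ℕ → A))} {C δ : ℝ}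

theorem Dep.nb_sum {ε : ℝ} {i : ℕ} {ξ N q η : ℕ → ℕ} {z : ℕ → ℕ → A}
    (h : Γ.Dep C ε (i + 1) ξ N z q η) (hC : 0 ≤ C) (hj : Odd (i + 1)) (hε : 0 ≤ ε)
    (hε' : ε ≤ C * th (i + 1) ^ 2) :
    Γ.NB (∑ r ∈ range (nn (i + 1)), z r) (4 * C * th (i + 1) ^ 2 * nn (i + 1)) := by
  classical
  have hris := h.ris hC
  set j := i + 1 with hjd
  have hth := th_pos j
  have hH : ∀ γ, i < Γ.wt γ → ∀ I : Finset ℕ,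
      ‖∑ k ∈ I, Γ.e γ (cut (nn j) z k)‖ ≤ 2 * C * (th j ^ 2 * #I + 1) := by
    intro γ hγ I
    rcases eq_or_lt_of_le (show j ≤ Γ.wt γ from hγ) with h1 | h1
    · obtain ⟨r0, hr0⟩ := h.exists_exception hC hε hj γ (Or.inr h1.symm)
      have hage : (Γ.age γ : ℝ) ≤ nn j := by exact_mod_cast age_le' h1.ge
      have h2 : 4 * C * th (j + 1) * Γ.age γ + ε ≤ 2 * C * th j ^ 2 := by
        have h3 : 4 * nn j * th (j + 1) ≤ th j ^ 2 := th_lt_le (Nat.lt_succ_self j)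
        have h4 := th_pos (j + 1)
        calc 4 * C * th (j + 1) * Γ.age γ + ε ≤ 4 * C * th (j + 1) * nn j + C * th j ^ 2 := by
              gcongr
          _ = C * (4 * nn j * th (j + 1)) + C * th j ^ 2 := by ring
          _ ≤ C * th j ^ 2 + C * th j ^ 2 := by gcongr
          _ = _ := by ring
      have h3 : ∀ k ∈ I, ‖Γ.e γ (cut (nn j) z k)‖ ≤
          2 * C * th j ^ 2 + if k = r0 then 2 * C else 0 := by
        intro k _
        have h5 : 0 ≤ 2 * C * th j ^ 2 := by positivity
        split_ifs with hk
        · have := hris.nb k γ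
          linarith
        · rw [add_zero]
          rcases lt_or_ge k (nn j) with h4 | h4
          · rw [cut_of_lt h4]; exact (hr0 k h4 hk).trans h2
          · rw [cut_of_le h4, map_zero, norm_zero]; exact h5
      refine (norm_sum_le_of_le I h3).trans ?_
      rw [sum_add_distrib, sum_const, nsmul_eq_mul, sum_ite_eq']
      split_ifs <;> nlinarith
    · refine (hris.sum_le γ I).trans ?_
      have := th_lt_sq h1
      gcongr
  intro γ
  have hd := hris.toBlocks.depth (sq_nonneg (th j)) hH (mm j) γ (range (nn j))
  rw [← map_sum, sum_cut, card_range] at hd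
  refine hd.trans ?_
  have hm4 : 4 ≤ mm j := four_le_mm j
  have hm0 : (0 : ℝ) < mm j := by exact_mod_cast (by omega : 0 < mm j)
  have hmax : max (th j ^ 2) ((1 / 4) ^ mm j) = th j ^ 2 := by
    apply max_eq_left
    have h1 : ∀ m : ℕ, 4 ≤ m → m ^ 2 ≤ 4 ^ m := by
      intro m hm
      induction m, hm using Nat.le_induction with
      | base => norm_num
      | succ m hm ih => rw [pow_succ 4]; nlinarith
    have h2 : ((mm j : ℝ)) ^ 2 ≤ 4 ^ mm j := by exact_mod_cast h1 _ hm4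
    unfold th
    rw [one_div_pow, one_div_pow]
    gcongr
  have h6 : ((6 : ℝ) * nn i) ^ mm j ≤ nn j * th j ^ 2 := by
    have h1 : 2 * (mm j : ℝ) ^ 2 * (6 * nn i) ^ (mm j + 1) ≤ nn j := by
      exact_mod_cast le_nn_succ i
    have h2 : (1 : ℝ) ≤ nn i := by exact_mod_cast one_le_nn i
    have h3 : ((6 : ℝ) * nn i) ^ mm j ≤ 2 * (6 * nn i) ^ (mm j + 1) := by
      have h5 : 0 < ((6 : ℝ) * nn i) ^ mm j := by positivity
      rw [pow_succ]; nlinarith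
    have h4 := mm_mul_th j
    calc ((6 : ℝ) * nn i) ^ mm j = ((mm j : ℝ) * th j) ^ 2 * (6 * nn i) ^ mm j := by
          rw [h4]; ring
      _ = (mm j : ℝ) ^ 2 * (6 * nn i) ^ mm j * th j ^ 2 := by ring
      _ ≤ (mm j : ℝ) ^ 2 * (2 * (6 * nn i) ^ (mm j + 1)) * th j ^ 2 := by gcongr
      _ = 2 * (mm j : ℝ) ^ 2 * (6 * nn i) ^ (mm j + 1) * th j ^ 2 := by ring
      _ ≤ _ := by gcongr
  rw [hmax]
  calc 2 * C * (th j ^ 2 * nn j + (6 * nn i) ^ mm j)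
      ≤ 2 * C * (th j ^ 2 * nn j + nn j * th j ^ 2) := by gcongr
    _ = _ := by ring

theorem Sep.mono {D : ℝ} (h : Γ.Sep G C δ) (hCD : C ≤ D) : Γ.Sep G D δ := fun N ε hε => by
  obtain ⟨p, hp, x, y, hx, h⟩ := h N ε hε
  exact ⟨p, hp, x, y, hx.mono hCD le_rfl, h⟩

theorem exists_th_lt {r : ℝ} (hr : 0 < r) : ∃ n, ∀ j, n ≤ j → th j < r := by
  obtain ⟨n, hn⟩ := exists_nat_gt (1 / r)
  refine ⟨n, fun j hj => ?_⟩
  have h1 : (j : ℝ) ≤ mm j := by exact_mod_cast mm_strictMono.le_apply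
  have h2 : (n : ℝ) ≤ j := by exact_mod_cast hj
  unfold th
  rw [one_div_lt (by positivity [four_le_mm j]) hr]
  linarith

/-- A subspace of pairs as in `Sep` is not the graph of a bounded operator. -/
theorem Sep.unbounded (h : Γ.Sep G C δ) (hδ : 0 < δ) (K : ℝ) :
    ∃ p ∈ G, ∃ D > 0, Γ.NB p.1 D ∧ ∃ γ, K * D < ‖Γ.e γ p.2‖ := by
  wlog hC : 1 ≤ C generalizing C
  · exact this (h.mono (le_max_left C 1)) (le_max_right _ _)
  wlog hK : 0 ≤ K generalizing K
  · obtain ⟨p, hp, D, hD, h1, γ, h2⟩ := this 0 le_rfl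
    refine ⟨p, hp, D, hD, h1, γ, lt_trans ?_ h2⟩
    have : K < 0 := not_le.1 hK
    nlinarith
  obtain ⟨i, hi⟩ := exists_th_lt (r := δ / 16 / ((5 * K + 1) * C)) (by positivity)
  set j := 2 * i + 1 with hj
  have hij := hi j (by omega)
  have hodd : Odd j := ⟨i, rfl⟩
  have hth := th_pos j
  have hn0 : (0 : ℝ) < nn j := by exact_mod_cast one_le_nn j
  obtain ⟨ξ, N, z, q, η, hdep, y, p, hyp⟩ := h.exists_dep hδ hodd (ε := C * th j ^ 2)
    (by positivity)
  have h1 := hdep.nb_sum (by linarith) hodd (by positivity) le_rfl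
  rw [← hj] at h1
  have hI : ∀ t : ℝ, ∑ r ∈ range (nn j), t = nn j * t := fun t => by
    rw [sum_const, card_range, nsmul_eq_mul]
  refine ⟨∑ r ∈ range (nn j), p r, G.sum_mem fun r hr => (hyp r (mem_range.1 hr)).2.2.1,
    5 * C * th j ^ 2 * nn j, by positivity, ?_, ξ (nn j), ?_⟩
  · have h2 := NB.sum _ fun r hr => (hyp r (mem_range.1 hr)).2.2.2.1
    have h3 := h2.add h1
    rw [hI, sum_sub_distrib, sub_add_cancel, ← Prod.fst_sum] at h3
    exact h3.mono (by linarith)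
  · have h2 := (NB.sum _ fun r hr => (hyp r (mem_range.1 hr)).2.2.2.2) (ξ (nn j))
    have h3 := hdep.toChain.e_sum (fun r hr => (hyp r hr).1) hdep.q_lt
    have h4 : th j * (nn j * (δ / 16)) ≤ tau (Γ.e (ξ (nn j)) (∑ r ∈ range (nn j), y r)) := by
      rw [h3, map_smul, map_sum, smul_eq_mul, ← hI]
      gcongr with r hr
      have hr := mem_range.1 hr
      rw [hdep.B_eq hr (hyp r hr).1]
      exact (hyp r hr).2.1
    have h5 := (le_abs_self _).trans (abs_tau_le (Γ.e (ξ (nn j)) (∑ r ∈ range (nn j), y r)))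
    rw [hI, sum_sub_distrib, map_sub, ← Prod.snd_sum] at h2
    have h6 := norm_sub_norm_le (Γ.e (ξ (nn j)) (∑ r ∈ range (nn j), y r))
      (Γ.e (ξ (nn j)) (∑ r ∈ range (nn j), p r).2)
    rw [norm_sub_rev] at h6
    have h7 : (5 * K + 1) * C * th j < δ / 16 := by
      rwa [lt_div_iff₀ (by positivity), mul_comm] at hij
    have h8 : K * (5 * C * th j ^ 2 * nn j) + nn j * (C * th j ^ 2) <
        th j * (nn j * (δ / 16)) := by
      calc K * (5 * C * th j ^ 2 * nn j) + nn j * (C * th j ^ 2)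
          = th j * (nn j * ((5 * K + 1) * C * th j)) := by ring
        _ < _ := by gcongr
    linarith

end Nodes

end BD

namespace BD

open Finset BoundedContinuousFunction

theorem tail_tail {p q : ℕ} (h : p ≤ q) (x : ℕ → A) : tail q (tail p x) = tail q x := by
  funext n
  simp only [tail_apply]
  split_ifs <;> first | rfl | omega

theorem blk_head (p : ℕ) (x : ℕ → A) {n : ℕ} (h : p < n) : head p x n = 0 := by
  rw [head_apply, if_neg (by omega)]

theorem tail_eq_zero {p : ℕ} {x : ℕ → A} (h : ∀ n, p < n → x n = 0) : tail p x = 0 := by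
  funext n; rw [tail_apply]; split_ifs with h1
  · exact h n h1
  · rfl

namespace Nodes

variable (Γ : Nodes)

/-- The tails of a sequence tend to zero. -/
def Tails (x : ℕ → A) : Prop := ∀ ε : ℝ, 0 < ε → ∃ q, ∀ r ≥ q, Γ.NB (BD.tail r x) ε

variable {Γ}

theorem Tails.add {x y : ℕ → A} (hx : Γ.Tails x) (hy : Γ.Tails y) : Γ.Tails (x + y) :=
  fun ε hε => by
    obtain ⟨p, hp⟩ := hx (ε / 2) (by positivity)
    obtain ⟨q, hq⟩ := hy (ε / 2) (by positivity)
    refine ⟨max p q, fun r hr => ?_⟩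
    rw [map_add]
    exact ((hp r (by omega)).add (hq r (by omega))).mono (by linarith)

theorem Tails.smul {x : ℕ → A} (hx : Γ.Tails x) (a : A) : Γ.Tails (a • x) := fun ε hε => by
  obtain ⟨p, hp⟩ := hx (ε / (‖a‖ + 1)) (by positivity)
  refine ⟨p, fun r hr => ?_⟩
  rw [map_smul]
  refine ((hp r hr).smul a).mono ?_
  rw [mul_div_assoc', div_le_iff₀ (by positivity)]
  nlinarith [norm_nonneg a]

theorem algebraMap_smul_seq (r : ℝ) (x : ℕ → A) : (algebraMap ℝ A r) • x = r • x := by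
  funext n; simp [Algebra.smul_def]

theorem Tails.rsmul {x : ℕ → A} (hx : Γ.Tails x) (a : ℝ) : Γ.Tails (a • x) := by
  rw [← algebraMap_smul_seq]; exact hx.smul _

theorem Tails.of_finite {x : ℕ → A} {q : ℕ} (h : ∀ n, q < n → x n = 0) : Γ.Tails x :=
  fun ε hε => ⟨q, fun r hr => by
    rw [tail_eq_zero fun n hn => h n (by omega)]
    exact NB.zero.mono hε.le⟩

theorem Tails.of_nb {x : ℕ → A}
    (h : ∀ ε : ℝ, 0 < ε → ∃ y, Γ.Tails y ∧ Γ.NB (x - y) ε) : Γ.Tails x := fun ε hε => by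
  obtain ⟨y, hy, hxy⟩ := h (ε / 6) (by positivity)
  obtain ⟨q, hq⟩ := hy (ε / 2) (by positivity)
  refine ⟨q, fun r hr => ?_⟩
  have := (hxy.tail r).add (hq r hr)
  rw [← map_add, sub_add_cancel] at this
  exact this.mono (by linarith)

theorem Tails.tail {x : ℕ → A} (hx : Γ.Tails x) (q : ℕ) : Γ.Tails (BD.tail q x) := fun ε hε => by
  obtain ⟨p, hp⟩ := hx ε hε
  refine ⟨max p q, fun r hr => ?_⟩
  rw [tail_tail (by omega)]
  exact hp r (by omega)

variable (Γ)

theorem E_symm_rsmul (r : ℝ) (u : ℕ → A) : Γ.E.symm (r • u) = r • Γ.E.symm u := by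
  rw [← algebraMap_smul_seq, map_smul, algebraMap_smul_seq]

/-- The space of bounded evaluation sequences with vanishing tails. -/
noncomputable def space : Submodule ℝ (ℕ →ᵇ A) where
  carrier := {u | Γ.Tails (Γ.E.symm u)}
  zero_mem' := by
    change Γ.Tails (Γ.E.symm 0)
    rw [map_zero]
    exact Tails.of_finite (q := 0) fun _ _ => rfl
  add_mem' {u v} hu hv := by
    change Γ.Tails (Γ.E.symm (u + v))
    rw [map_add]
    exact Tails.add hu hv
  smul_mem' r u hu := by
    change Γ.Tails (Γ.E.symm (r • u))
    rw [E_symm_rsmul]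
    exact Tails.rsmul hu r

/-- The Banach space of bounded evaluation sequences with vanishing tails. -/
def X : Type := ↥Γ.space

noncomputable instance : NormedAddCommGroup Γ.X := inferInstanceAs (NormedAddCommGroup ↥Γ.space)
noncomputable instance : NormedSpace ℝ Γ.X := inferInstanceAs (NormedSpace ℝ ↥Γ.space)

variable {Γ}

/-- The coordinates of a vector. -/
noncomputable def vec : Γ.X →ₗ[ℝ] (ℕ → A) where
  toFun u := Γ.E.symm u.1
  map_add' u v := map_add Γ.E.symm (u.1 : ℕ → A) v.1
  map_smul' r u := Γ.E_symm_rsmul r u.1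

theorem e_vec (u : Γ.X) (γ : ℕ) : Γ.e γ (vec u) = u.1 γ := Γ.e_E_symm _ _

theorem nb_vec (u : Γ.X) : Γ.NB (vec u) ‖u‖ := fun γ => by
  rw [e_vec]; exact u.1.norm_coe_le_norm γ

theorem tails_vec (u : Γ.X) : Γ.Tails (vec u) := u.2

theorem norm_le_of_nb {u : Γ.X} {C : ℝ} (h : Γ.NB (vec u) C) : ‖u‖ ≤ C :=
  (BoundedContinuousFunction.norm_le h.nonneg).2 fun γ => (congrArg norm (e_vec u γ)).ge.trans (h γ)

theorem vec_injective : Function.Injective (vec : Γ.X → ℕ → A) := fun u v h => by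
  have h1 : vec (u - v) = 0 := by rw [map_sub, h, sub_self]
  have h2 : ‖u - v‖ ≤ 0 := norm_le_of_nb (by rw [h1]; exact NB.zero)
  exact sub_eq_zero.1 (norm_le_zero_iff.1 h2)

theorem exists_vec_eq {x : ℕ → A} {C : ℝ} (hx : Γ.NB x C) (ht : Γ.Tails x) :
    ∃ u : Γ.X, vec u = x := by
  refine ⟨⟨BoundedContinuousFunction.ofNormedAddCommGroupDiscrete (fun γ => Γ.e γ x) C hx, ?_⟩, ?_⟩
  · change Γ.Tails (Γ.E.symm (Γ.E x))
    rwa [LinearEquiv.symm_apply_apply]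
  · exact LinearEquiv.symm_apply_apply Γ.E x

theorem exists_vec_eq_of_finite {x : ℕ → A} {q : ℕ} (h : ∀ n, q < n → x n = 0) :
    ∃ u : Γ.X, vec u = x := by
  obtain ⟨C, -, hC⟩ := exists_NB (Γ := Γ) h
  exact exists_vec_eq hC (Tails.of_finite h)

theorem isClosed_space : IsClosed (Γ.space : Set (ℕ →ᵇ A)) := by
  rw [← isSeqClosed_iff_isClosed]
  intro u v hu hv
  refine Tails.of_nb fun ε hε => ?_
  obtain ⟨n, hn⟩ := ((tendsto_iff_norm_sub_tendsto_zero.1 hv).eventually_lt_const hε).exists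
  refine ⟨Γ.E.symm (u n), hu n, fun γ => ?_⟩
  rw [map_sub, e_E_symm, e_E_symm, ← norm_neg, neg_sub]
  exact ((u n - v).norm_coe_le_norm γ).trans hn.le

instance : CompleteSpace Γ.X := isClosed_space.completeSpace_coe

theorem exists_lift (f : (ℕ → A) →ₗ[A] (ℕ → A)) (C : ℝ)
    (hf : ∀ x D, Γ.NB x D → Γ.NB (f x) (C * D)) (ht : ∀ x, Γ.Tails x → Γ.Tails (f x)) :
    ∃ F : Γ.X →L[ℝ] Γ.X, (∀ u, vec (F u) = f (vec u)) ∧ ∀ u, ‖F u‖ ≤ C * ‖u‖ := by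
  choose F hF using fun u : Γ.X => exists_vec_eq (hf _ _ (nb_vec u)) (ht _ (tails_vec u))
  have h1 : ∀ u, ‖F u‖ ≤ C * ‖u‖ := fun u => norm_le_of_nb (by
    rw [hF]; exact hf _ _ (nb_vec u))
  refine ⟨LinearMap.mkContinuous ⟨⟨F, fun u v => vec_injective ?_⟩, fun r u => vec_injective ?_⟩ C
    h1, hF, h1⟩
  · rw [hF, map_add, map_add, map_add, hF, hF]
  · change vec (F (r • u)) = vec (r • F u)
    rw [hF, vec.map_smul, vec.map_smul, hF, ← algebraMap_smul_seq, f.map_smul, algebraMap_smul_seq]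

theorem exists_act (a : A) : ∃ F : Γ.X →L[ℝ] Γ.X, (∀ u, vec (F u) = a • vec u) ∧
    ∀ u, ‖F u‖ ≤ ‖a‖ * ‖u‖ :=
  exists_lift (LinearMap.lsmul A (ℕ → A) a) ‖a‖ (fun _ _ h => h.smul a) fun _ h => h.smul a

theorem exists_tail (p : ℕ) : ∃ F : Γ.X →L[ℝ] Γ.X, (∀ u, vec (F u) = BD.tail p (vec u)) ∧
    ∀ u, ‖F u‖ ≤ 3 * ‖u‖ :=
  exists_lift (BD.tail p) 3 (fun _ _ h => h.tail p) fun _ h => h.tail p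

/-- The action of the coefficients. -/
noncomputable def act (a : A) : Γ.X →L[ℝ] Γ.X := (exists_act a).choose
theorem vec_act (a : A) (u : Γ.X) : vec (act a u) = a • vec u := (exists_act a).choose_spec.1 u
theorem norm_act_le (a : A) (u : Γ.X) : ‖act a u‖ ≤ ‖a‖ * ‖u‖ := (exists_act a).choose_spec.2 u

/-- The projection to the coordinates larger than `p`. -/
noncomputable def tl (p : ℕ) : Γ.X →L[ℝ] Γ.X := (exists_tail p).choose
theorem vec_tl (p : ℕ) (u : Γ.X) : vec (tl p u) = BD.tail p (vec u) :=
  (exists_tail p).choose_spec.1 u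
theorem norm_tl_le (p : ℕ) (u : Γ.X) : ‖tl p u‖ ≤ 3 * ‖u‖ := (exists_tail p).choose_spec.2 u

theorem act_sub (a b : A) (u : Γ.X) : act (a - b) u = act a u - act b u :=
  vec_injective (by rw [map_sub, vec_act, vec_act, vec_act, sub_smul])

theorem act_mk (s t : ℝ) : act (A.mk s t) = s • (1 : Γ.X →L[ℝ] Γ.X) + t • act eps := by
  ext1 u
  apply vec_injective
  change vec (act (A.mk s t) u) = vec (s • u + t • act eps u)
  rw [map_add, map_smul, map_smul, vec_act, vec_act]
  funext n
  ext <;> simp [eps, re_mul, tau_mul]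

theorem exists_tl_lt (u : Γ.X) {ε : ℝ} (hε : 0 < ε) : ∃ q, ∀ r ≥ q, ‖tl r u‖ ≤ ε := by
  obtain ⟨q, hq⟩ := tails_vec u ε hε
  exact ⟨q, fun r hr => norm_le_of_nb (by rw [vec_tl]; exact hq r hr)⟩

theorem exists_coords (p : ℕ) : ∃ (c : Γ.X →L[ℝ] (Fin (p + 1) → A))
    (l : (Fin (p + 1) → A) →L[ℝ] Γ.X),
    ∀ u, u - tl p u = l (c u) := by
  have h1 : ∀ w : Fin (p + 1) → A, ∃ u : Γ.X,
      vec u = fun n => if h : n < p + 1 then w ⟨n, h⟩ else 0 := fun w =>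
    exists_vec_eq_of_finite (q := p) fun n hn => dif_neg (by omega)
  choose l hl using h1
  let L : (Fin (p + 1) → A) →ₗ[ℝ] Γ.X :=
    { toFun := l
      map_add' := fun v w => vec_injective (by
        rw [map_add, hl, hl, hl]; funext n
        by_cases h : n ≤ p <;> simp [h])
      map_smul' := fun r w => vec_injective (by
        rw [map_smul, hl, hl]; funext n
        by_cases h : n ≤ p <;> simp [h]) }
  let c : Γ.X →ₗ[ℝ] (Fin (p + 1) → A) :=
    { toFun := fun u i => vec u i
      map_add' := fun u v => by rw [map_add]; rfl
      map_smul' := fun r u => by rw [map_smul]; rfl }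
  refine ⟨c.mkContinuous 3 fun u => (pi_norm_le_iff_of_nonneg (by positivity)).2 fun i =>
    (nb_vec u).coord i, LinearMap.toContinuousLinearMap L, fun u => vec_injective ?_⟩
  change vec (u - tl p u) = vec (l (c u))
  rw [hl, map_sub, vec_tl]
  funext n
  by_cases h : n < p + 1
  · simp [tail_apply, h, show ¬ p < n by omega, c]
  · simp [tail_apply, h, show p < n by omega]

theorem isCompactOperator_one_sub_tl (p : ℕ) : IsCompactOperator ((1 - tl p : Γ.X →L[ℝ] Γ.X)) := by
  obtain ⟨c, l, h⟩ := exists_coords (Γ := Γ) p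
  have h1 : (1 : Γ.X →L[ℝ] Γ.X) - tl p = l.comp c := by ext1 u; exact h u
  rw [h1]
  exact (isCompactOperator_of_locallyCompactSpace_rng l).comp_clm c

instance : TopologicalSpace.SeparableSpace Γ.X := by
  choose c l h using exists_coords (Γ := Γ)
  have h1 : TopologicalSpace.IsSeparable (⋃ p, Set.range (l p)) :=
    TopologicalSpace.IsSeparable.iUnion fun p => TopologicalSpace.isSeparable_range (l p).continuous
  refine TopologicalSpace.isSeparable_univ_iff.1 (h1.closure.mono fun u _ => ?_)
  rw [Metric.mem_closure_iff]
  intro ε hε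
  obtain ⟨q, hq⟩ := exists_tl_lt u (half_pos hε)
  refine ⟨l q (c q u), Set.mem_iUnion.2 ⟨q, Set.mem_range_self _⟩, ?_⟩
  rw [← h q u, dist_eq_norm, sub_sub_cancel]
  linarith [hq q le_rfl]

end Nodes

end BD

namespace BD

open Finset Filter Topology

namespace Nodes

variable {Γ : Nodes}

theorem exists_fine_unit (M : ℕ) : ∃ u : Γ.X, Γ.Fine 4 M (vec u) ∧ ∃ n, Γ.e n (vec u) = 1 := by
  obtain ⟨n, hn, -, h0, -, hw, -⟩ := Γ.rich_even 0 0 (by decide) (Or.inl rfl)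
    (by rw [Γ.age_zero]; exact one_le_nn 0) 0 0 (by simp) 1 one_pos (M + 1)
  set x : ℕ → A := Pi.single n 1 with hx
  have hx0 : ∀ m, m ≠ n → x m = 0 := fun m hm => by rw [hx, Pi.single_eq_of_ne hm]
  have hx1 : x n = 1 := by rw [hx, Pi.single_eq_same]
  have hblk : Blk M n x := fun m hm => hx0 m (by omega)
  have he : Γ.e n x = 1 := by rw [Γ.e_self fun m hm => hx0 m hm.ne, hx1]
  have hnb : Γ.NB x 2 := by
    have h1 : BD.head n x = x := by
      funext m; rw [head_apply]; split_ifs with h1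
      · rfl
      · exact (hx0 m (by omega)).symm
    have h2 : Γ.NB (BD.head n x) (2 * 1) := NB.head' fun η hη => by
      rcases eq_or_lt_of_le hη with rfl | hη
      · rw [he, norm_one]
      · rw [Γ.e_of_zero fun m hm => hx0 m (by omega), norm_zero]; exact zero_le_one
    rw [h1] at h2
    exact h2.mono (by norm_num)
  have hth : ∀ γ, ‖Γ.e γ x‖ ≤ 4 * th (Γ.wt γ) := by
    intro γ
    induction γ using Nat.strong_induction_on with
    | _ γ ih =>
      have ht := th_pos (Γ.wt γ)
      rcases lt_trichotomy γ n with h1 | rfl | h1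
      · rw [Γ.e_of_zero fun m hm => hx0 m (by omega), norm_zero]; positivity
      · rw [he, hw, norm_one, th, mm_zero]; norm_num
      · rw [e_pos _ (by omega), hx0 γ h1.ne', zero_add]
        have hp := Γ.pred_lt γ (by omega)
        rcases lt_or_ge (Γ.pred γ) n with h2 | h2
        · rw [Γ.e_of_zero fun m hm => hx0 m (by omega), zero_add, norm_smul,
            Real.norm_of_nonneg ht.le, mul_comm]
          gcongr
          refine Γ.norm_B_le (by norm_num) fun η _ => ?_
          have h3 : BD.tail (Γ.pred γ) x = x := by
            funext m; rw [tail_apply]; split_ifs with h4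
            · rfl
            · exact (hx0 m (by omega)).symm
          rw [h3]
          exact (hnb η).trans (by norm_num)
        · rw [B_of_tail _ (hblk.tail_zero h2), smul_zero, add_zero]
          have := ih _ hp
          rwa [Γ.wt_pred γ (by omega)] at this
  obtain ⟨u, hu⟩ := exists_vec_eq_of_finite (Γ := Γ) (x := x) (q := n) fun m hm => hx0 m (by omega)
  exact ⟨u, by rw [hu]; exact ⟨⟨n, hblk⟩, hnb.mono (by norm_num), fun γ _ => hth γ⟩, n,
    by rw [hu]; exact he⟩

/-- The filter of fine vectors. -/
def fineFilter (Γ : Nodes) (C : ℝ) : Filter Γ.X := ⨅ N, 𝓟 {u | Γ.Fine C N (vec u)}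

theorem hasBasis_fineFilter (C : ℝ) :
    (Γ.fineFilter C).HasBasis (fun _ => True) fun N => {u | Γ.Fine C N (vec u)} := by
  refine hasBasis_iInf_principal fun N M => ⟨max N M, ?_, ?_⟩
  · exact fun u hu => Fine.mono hu le_rfl (le_max_left _ _)
  · exact fun u hu => Fine.mono hu le_rfl (le_max_right _ _)

theorem eventually_fineFilter {C : ℝ} {p : Γ.X → Prop} :
    (∀ᶠ u in Γ.fineFilter C, p u) ↔ ∃ N, ∀ u, Γ.Fine C N (vec u) → p u := by
  rw [(hasBasis_fineFilter C).eventually_iff]; simp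

theorem exists_ris {C : ℝ} {p : Γ.X → Prop} (h : ∀ N, ∃ u, Γ.Fine C N (vec u) ∧ p u) :
    ∃ (N : ℕ → ℕ) (u : ℕ → Γ.X), Γ.RIS C N (fun k => vec (u k)) ∧ ∀ k, p (u k) := by
  choose u hu hp using h
  choose q hq using fun N => (hu N).blk
  let N : ℕ → ℕ := fun k => Nat.rec 0 (fun _ n => max (n + 1) (q n)) k
  have hN : ∀ k, N (k + 1) = max (N k + 1) (q (N k)) := fun _ => rfl
  refine ⟨N, fun k => u (N k), ⟨⟨strictMono_nat_of_lt_succ fun k => ?_, fun k => ?_,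
    fun k => (hu _).nb⟩, fun k => (hu _).small⟩, fun k => hp _⟩
  · rw [hN]; omega
  · exact (hq _).mono le_rfl (by rw [hN]; omega)

theorem exists_mm_gt (K : ℝ) : ∃ j, K < mm (j + 1) := by
  obtain ⟨n, hn⟩ := exists_nat_gt K
  refine ⟨n, hn.trans ?_⟩
  exact_mod_cast (Nat.lt_succ_self n).trans_le mm_strictMono.le_apply

theorem tendsto_functional (C : ℝ) (f : Γ.X →L[ℝ] ℝ) : Tendsto f (Γ.fineFilter C) (𝓝 0) := by
  have key : ∀ (f : Γ.X →L[ℝ] ℝ) (ε : ℝ), 0 < ε → ∀ᶠ u in Γ.fineFilter C, f u < ε := by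
    intro f ε hε
    rw [eventually_fineFilter]
    by_contra! h
    obtain ⟨N, u, hris, hu⟩ := exists_ris h
    obtain ⟨j, hj⟩ := exists_mm_gt (‖f‖ * (2 * C) / ε)
    have hm0 : (0 : ℝ) < mm (j + 1) := by
      exact_mod_cast (show 0 < mm (j + 1) by have := four_le_mm (j + 1); omega)
    have hn0 : (0 : ℝ) < nn (j + 1) := by exact_mod_cast one_le_nn (j + 1)
    set v : Γ.X := ((mm (j + 1) : ℝ) / nn (j + 1)) • ∑ k ∈ range (nn (j + 1)), u k with hv
    have h1 : ‖v‖ ≤ 2 * C := norm_le_of_nb (by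
      rw [hv, map_smul, map_sum]; exact (hris.avg j).nb)
    have h2 : (mm (j + 1) : ℝ) * ε ≤ f v := by
      rw [hv, map_smul, map_sum, smul_eq_mul]
      calc (mm (j + 1) : ℝ) * ε = (mm (j + 1) : ℝ) / nn (j + 1) *
            ∑ k ∈ range (nn (j + 1)), ε := by
            rw [sum_const, card_range, nsmul_eq_mul]; field_simp
        _ ≤ _ := by gcongr with k; exact hu k
    have h3 := (le_abs_self _).trans (f.le_opNorm v)
    have h4 : ‖f‖ * ‖v‖ ≤ ‖f‖ * (2 * C) := by gcongr
    rw [div_lt_iff₀ hε] at hj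
    linarith
  rw [Metric.tendsto_nhds]
  intro ε hε
  filter_upwards [key f ε hε, key (-f) ε hε] with u h1 h2
  rw [dist_zero_right, Real.norm_eq_abs, abs_lt]
  have h2 : -f u < ε := h2
  exact ⟨by linarith, h1⟩

theorem tendsto_of_finiteDimensional (C : ℝ) {F : Type*} [NormedAddCommGroup F] [NormedSpace ℝ F]
    [FiniteDimensional ℝ F] (g : Γ.X →L[ℝ] F) : Tendsto g (Γ.fineFilter C) (𝓝 0) := by
  let e := (Module.finBasis ℝ F).equivFunL
  have h1 : Tendsto (fun u => e (g u)) (Γ.fineFilter C) (𝓝 0) := by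
    rw [tendsto_pi_nhds]
    intro i
    exact tendsto_functional C ((ContinuousLinearMap.proj i).comp (e.toContinuousLinearMap.comp g))
  have h2 := (e.symm.continuous.tendsto 0).comp h1
  rw [map_zero] at h2
  exact h2.congr fun u => e.symm_apply_apply _

theorem tendsto_sub_tl (C : ℝ) (T : Γ.X →L[ℝ] Γ.X) (p : ℕ) :
    Tendsto (fun u => T u - tl p (T u)) (Γ.fineFilter C) (𝓝 0) := by
  obtain ⟨c, l, h⟩ := exists_coords (Γ := Γ) p
  have h1 := (l.continuous.tendsto 0).comp (tendsto_of_finiteDimensional C (c.comp T))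
  rw [map_zero] at h1
  exact h1.congr fun u => (h _).symm

/-- The graph of an operator, in coordinates. -/
noncomputable def graph (T : Γ.X →L[ℝ] Γ.X) : Submodule ℝ ((ℕ → A) × (ℕ → A)) :=
  LinearMap.range ((vec (Γ := Γ)).prod (vec.comp T.toLinearMap))

theorem not_sep_graph (T : Γ.X →L[ℝ] Γ.X) {C δ : ℝ} (hδ : 0 < δ) : ¬Γ.Sep (graph T) C δ := by
  intro h
  obtain ⟨p, ⟨u, rfl⟩, D, -, hD, γ, hγ⟩ := h.unbounded hδ ‖T‖
  have h1 : ‖u‖ ≤ D := norm_le_of_nb hD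
  have h2 := (nb_vec (T u) γ).trans (T.le_opNorm u)
  have h3 : ‖T‖ * ‖u‖ ≤ ‖T‖ * D := by gcongr
  exact absurd hγ (not_lt.2 (h2.trans h3))

theorem eventually_exists_act (T : Γ.X →L[ℝ] Γ.X) (C : ℝ) {δ : ℝ} (hδ : 0 < δ) :
    ∀ᶠ u in Γ.fineFilter C, ∃ a, ‖T u - act a u‖ ≤ δ := by
  rw [eventually_fineFilter]
  by_contra! h
  refine not_sep_graph T (C := C) (half_pos hδ) fun N ε hε => ?_
  have h1 : ∀ᶠ u in Γ.fineFilter C, ‖T u - tl N (T u)‖ < min (ε / 2) (δ / 4) := by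
    have := (tendsto_sub_tl C T N).norm
    rw [norm_zero] at this
    exact this.eventually_lt_const (by positivity)
  obtain ⟨N', hN'⟩ := eventually_fineFilter.1 h1
  obtain ⟨u, hu, hT⟩ := h (max N N')
  have h2 := hN' u (hu.mono le_rfl (le_max_right _ _))
  obtain ⟨q, hq⟩ := exists_tl_lt (T u) (show 0 < min (ε / 2) (δ / 4) by positivity)
  set r := max q N
  have h3 := hq r (le_max_left _ _)
  set y : ℕ → A := vec (T u) - (vec (T u - tl N (T u)) + vec (tl r (T u))) with hy
  have h4 : Γ.NB (vec (T u) - y) (min (ε / 2) (δ / 4) + min (ε / 2) (δ / 4)) := by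
    rw [hy, sub_sub_cancel]
    exact ((nb_vec _).mono h2.le).add ((nb_vec _).mono h3)
  have h5 : min (ε / 2) (δ / 4) + min (ε / 2) (δ / 4) ≤ min ε (δ / 2) := by
    have i1 := min_le_left (ε / 2) (δ / 4)
    have i2 := min_le_right (ε / 2) (δ / 4)
    exact le_min (by linarith) (by linarith)
  refine ⟨(vec u, vec (T u)), ⟨u, rfl⟩, vec u, y, hu.mono le_rfl (le_max_left _ _), ⟨r, ?_⟩, ?_,
    h4.mono (h5.trans (min_le_left _ _)), fun a => ?_⟩
  · intro n hn
    have hNr : N ≤ r := le_max_right _ _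
    simp only [hy, map_sub, vec_tl, Pi.sub_apply, Pi.add_apply, tail_apply]
    rcases hn with hn | hn
    · rw [if_neg (by omega), if_neg (by omega)]; simp
    · rw [if_pos (by omega), if_pos (by omega)]; simp
  · simpa using NB.zero.mono hε.le
  · by_contra! hc
    have h6 : Γ.NB (vec (T u - act a u)) (δ / 2 + δ / 2) := by
      have h7 : vec (T u - act a u) = (y - a • vec u) + (vec (T u) - y) := by
        rw [map_sub, vec_act]; abel
      rw [h7]
      exact NB.add (fun γ => (hc γ).le) (h4.mono (h5.trans (min_le_right _ _)))
    have := norm_le_of_nb h6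
    linarith [hT a]

theorem norm_le_of_act {u : Γ.X} {n : ℕ} (hn : Γ.e n (vec u) = 1) (a : A) : ‖a‖ ≤ ‖act a u‖ := by
  have := nb_vec (act a u) n
  rwa [vec_act, map_smul, hn, smul_eq_mul, mul_one] at this

theorem tl_eq_zero {u : Γ.X} {p q r : ℕ} (h : Blk p q (vec u)) (hr : q ≤ r) : tl r u = 0 :=
  vec_injective (by rw [vec_tl, h.tail_zero hr, map_zero])

theorem tl_eq_self {u : Γ.X} {p q r : ℕ} (h : Blk p q (vec u)) (hr : r ≤ p) : tl r u = u :=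
  vec_injective (by rw [vec_tl, h.tail_eq hr])

/-- An operator is a multiplication up to an operator vanishing along fine vectors. -/
theorem exists_tendsto_sub_act (T : Γ.X →L[ℝ] Γ.X) :
    ∃ a : A, ∀ C, Tendsto (fun u => T u - act a u) (Γ.fineFilter C) (𝓝 0) := by
  have h1 : ∀ r : ℕ, ∃ (a : A) (w : Γ.X), ‖T w - act a w‖ ≤ 1 / (r + 1) ∧ Γ.Fine 4 r (vec w) ∧
      ∃ n, Γ.e n (vec w) = 1 := by
    intro r
    obtain ⟨N, hN⟩ := eventually_fineFilter.1
      (eventually_exists_act T 4 (show (0 : ℝ) < 1 / (r + 1) by positivity))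
    obtain ⟨w, hw, hn⟩ := exists_fine_unit (Γ := Γ) (max r N)
    obtain ⟨a, ha⟩ := hN w (hw.mono le_rfl (le_max_right _ _))
    exact ⟨a, w, ha, hw.mono le_rfl (le_max_left _ _), hn⟩
  choose a w ha hw n hn using h1
  have hw4 : ∀ r, ‖w r‖ ≤ 4 := fun r => norm_le_of_nb (hw r).nb
  have hbd : ∀ r, a r ∈ Metric.closedBall (0 : A) (‖T‖ * 4 + 1) := fun r => by
    rw [mem_closedBall_zero_iff]
    refine (norm_le_of_act (hn r) (a r)).trans ?_
    have i1 := norm_sub_norm_le (act (a r) (w r)) (T (w r))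
    rw [norm_sub_rev] at i1
    have i2 := (T.le_opNorm (w r)).trans (mul_le_mul_of_nonneg_left (hw4 r) (norm_nonneg _))
    have i3 : (1 : ℝ) / (r + 1) ≤ 1 := by
      rw [div_le_one (by positivity)]; linarith [(Nat.cast_nonneg r : (0 : ℝ) ≤ r)]
    linarith [ha r]
  obtain ⟨b, -, φ, hφ, hb⟩ := (isCompact_closedBall (0 : A) _).tendsto_subseq hbd
  refine ⟨b, fun C => ?_⟩
  have hlim : Tendsto (fun r => ‖T (w (φ r)) - act b (w (φ r))‖) atTop (𝓝 0) := by
    have i1 : Tendsto (fun r : ℕ => 1 / ((φ r : ℝ) + 1) + ‖a (φ r) - b‖ * 4) atTop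
        (𝓝 (0 + 0 * 4)) :=
      (tendsto_one_div_add_atTop_nhds_zero_nat.comp hφ.tendsto_atTop).add
        ((tendsto_iff_norm_sub_tendsto_zero.1 hb).mul_const 4)
    rw [zero_mul, add_zero] at i1
    refine squeeze_zero (fun _ => norm_nonneg _) (fun r => ?_) i1
    have i2 : T (w (φ r)) - act b (w (φ r)) =
        (T (w (φ r)) - act (a (φ r)) (w (φ r))) + act (a (φ r) - b) (w (φ r)) := by
      rw [act_sub]; abel
    rw [i2]
    refine (norm_add_le _ _).trans (add_le_add (ha _) ((norm_act_le _ _).trans ?_))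
    gcongr
    exact hw4 _
  rw [Metric.tendsto_nhds]
  intro ε hε
  rw [eventually_fineFilter]
  set C' := max C 0 with hC'
  have hC0 : 0 ≤ C' := le_max_right _ _
  set δ := ε / (10 + 7 * C') with hδ
  have hδ0 : 0 < δ := by positivity
  obtain ⟨N, hN⟩ := eventually_fineFilter.1 (eventually_exists_act T (C + 4) hδ0)
  refine ⟨N, fun u hu => ?_⟩
  obtain ⟨q, hq⟩ := hu.blk
  obtain ⟨q', hq'⟩ := exists_tl_lt (T u) hδ0
  set p := max q (max q' N) with hp
  obtain ⟨r, hr1, hr2⟩ := ((hlim.eventually_lt_const hδ0).and (eventually_ge_atTop p)).exists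
  have hφr : p ≤ φ r := hr2.trans hφ.le_apply
  set v := w (φ r) with hv
  have hvf : Γ.Fine 4 (φ r) (vec v) := hw _
  obtain ⟨q'', hvb⟩ := hvf.blk
  obtain ⟨a', ha'⟩ := hN (u + v) (by
    rw [map_add]; exact hu.add (hvf.mono le_rfl (by omega)))
  have j1 : T (u + v) - act a' (u + v) - (T v - act b v) = (T u - act a' u) + act (b - a') v := by
    rw [map_add, map_add, act_sub]; abel
  have j2 : ‖(T u - act a' u) + act (b - a') v‖ ≤ δ + δ := by
    rw [← j1]; exact (norm_sub_le _ _).trans (add_le_add ha' hr1.le)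
  have j3 : tl p ((T u - act a' u) + act (b - a') v) = tl p (T u) + act (b - a') v := by
    rw [map_add, map_sub, tl_eq_zero (u := act a' u) (p := N) (q := q)
      (by rw [vec_act]; exact hq.smul _) (by omega), sub_zero,
      tl_eq_self (u := act (b - a') v) (by rw [vec_act]; exact hvb.smul _) hφr]
  have j4 : ‖act (b - a') v‖ ≤ 7 * δ := by
    have i1 := norm_tl_le p ((T u - act a' u) + act (b - a') v)
    rw [j3] at i1
    have i2 := norm_sub_le (tl p (T u) + act (b - a') v) (tl p (T u))
    rw [add_sub_cancel_left] at i2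
    have := hq' p (by omega)
    linarith
  have j5 := (norm_le_of_act (hn _) (b - a')).trans j4
  have j6 : T u - act b u =
      ((T u - act a' u) + act (b - a') v) - act (b - a') v - act (b - a') u := by
    rw [act_sub b a' u]; abel
  have j7 : ‖act (b - a') u‖ ≤ 7 * δ * C' := by
    refine (norm_act_le _ _).trans ?_
    gcongr
    exact (norm_le_of_nb hu.nb).trans (le_max_left _ _)
  have j8 : ‖T u - act b u‖ ≤ 9 * δ + 7 * δ * C' := by
    rw [j6]
    have i1 := norm_sub_le (((T u - act a' u) + act (b - a') v) - act (b - a') v) (act (b - a') u)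
    have i2 := norm_sub_le ((T u - act a' u) + act (b - a') v) (act (b - a') v)
    linarith
  rw [dist_zero_right]
  have j9 : δ * (10 + 7 * C') = ε := by rw [hδ]; field_simp
  linarith

end Nodes

end BD

namespace BD

open Finset Filter Topology

namespace Nodes

variable {Γ : Nodes}

theorem norm_e_le_of_wt {n q : ℕ} {z : ℕ → A} {D : ℝ} (hz : Blk n q z) (hD : Γ.NB z D)
    (P : ℕ → Prop) (h0 : ∀ γ ≤ q, P (Γ.wt γ) → Γ.e γ z = 0) (γ : ℕ) :
    P (Γ.wt γ) → ‖Γ.e γ z‖ ≤ 3 * D * th (Γ.wt γ) := by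
  have hD0 := hD.nonneg
  have hz0 : Γ.e 0 z = 0 := Γ.e_blk_of_le (Nat.zero_le _) hz
  induction γ using Nat.strong_induction_on with
  | _ γ ih =>
    intro hP
    have ht := th_pos (Γ.wt γ)
    rcases le_or_gt γ q with h1 | h1
    · rw [h0 γ h1 hP, norm_zero]; positivity
    rw [e_pos _ (by omega), hz γ (Or.inr h1), zero_add]
    have hp := Γ.pred_lt γ (by omega)
    rcases lt_or_ge (Γ.pred γ) q with h2 | h2
    · have h3 : Γ.e (Γ.pred γ) z = 0 := by
        rcases eq_or_ne (Γ.pred γ) 0 with h4 | h4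
        · rw [h4, hz0]
        · exact h0 _ h2.le (by rwa [Γ.wt_pred γ h4])
      rw [h3, zero_add, norm_smul, Real.norm_of_nonneg ht.le, mul_comm]
      gcongr
      exact Γ.norm_B_le (by positivity) fun η _ => hD.tail _ η
    · rw [B_of_tail _ (hz.tail_zero h2), smul_zero, add_zero]
      rcases eq_or_ne (Γ.pred γ) 0 with h4 | h4
      · rw [h4, hz0, norm_zero]; positivity
      · have := ih _ hp
        rw [Γ.wt_pred γ h4] at this
        exact this hP

theorem exists_split {n q : ℕ} {x : ℕ → A} {C : ℝ} (hx : Blk n q x) (hC : Γ.NB x C) {N : ℕ}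
    (hN : N ≤ n) : ∃ y z, x = y + z ∧ Γ.Fine (6 * C * mm N) n y ∧ Γ.Fine (9 * C) N z := by
  classical
  have hC0 := hC.nonneg
  set w : ℕ → A := Γ.E.symm fun γ => if Γ.wt γ ≤ N then Γ.e γ x else 0 with hw
  set y := BD.head q w with hy
  have hyq : ∀ γ ≤ q, Γ.e γ y = if Γ.wt γ ≤ N then Γ.e γ x else 0 := fun γ hγ => by
    rw [hy, Γ.e_head_of_le hγ, hw, e_E_symm]
  have hynb : Γ.NB y (2 * C) := by
    refine NB.head' fun γ hγ => ?_
    rw [hw, e_E_symm]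
    split_ifs
    · exact hC γ
    · rw [norm_zero]; exact hC0
  have hyb : Blk n q y := by
    intro m hm
    by_cases h : m ≤ q
    · refine Γ.e_injective (m := min n q) (fun γ hγ => ?_) m (by omega)
      rw [hyq γ (by omega), Γ.e_blk_of_le (by omega) hx, ite_self]
    · exact blk_head q w (by omega)
  have hzb := hx.sub hyb
  have hznb : Γ.NB (x - y) (3 * C) := (hC.sub hynb).mono (by linarith)
  have hm : (1 : ℝ) ≤ mm N := by exact_mod_cast (show 1 ≤ mm N by have := four_le_mm N; omega)
  refine ⟨y, x - y, by abel, ⟨⟨q, hyb⟩, hynb.mono (by nlinarith), fun γ _ => ?_⟩,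
    ⟨q, hzb.mono hN le_rfl⟩, hznb.mono (by linarith), fun γ hγ => ?_⟩
  · have ht := th_pos (Γ.wt γ)
    by_cases h : Γ.wt γ ≤ N
    · have h2 : (1 : ℝ) ≤ mm N * th (Γ.wt γ) := by
        rw [← mm_mul_th N]; gcongr; exact th_anti h
      refine (hynb γ).trans ?_
      calc 2 * C = 2 * C * 1 := by ring
        _ ≤ 6 * C * (mm N * th (Γ.wt γ)) := by gcongr; norm_num
        _ = _ := by ring
    · refine (norm_e_le_of_wt hyb hynb (fun w => ¬ w ≤ N) (fun γ h1 h2 => ?_) γ h).trans ?_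
      · rw [hyq γ h1, if_neg h2]
      · refine mul_le_mul_of_nonneg_right ?_ ht.le
        nlinarith
  · refine (norm_e_le_of_wt hzb hznb (fun w => w ≤ N) (fun γ h1 h2 => ?_) γ hγ).trans
      (le_of_eq (by ring))
    rw [map_sub, hyq γ h1, if_pos h2, sub_self]

theorem isCompactOperator_of_tendsto_fine (R : Γ.X →L[ℝ] Γ.X)
    (hR : ∀ C, Tendsto R (Γ.fineFilter C) (𝓝 0)) : IsCompactOperator R := by
  have hR' : ∀ C δ : ℝ, 0 < δ → ∃ N, ∀ u, Γ.Fine C N (vec u) → ‖R u‖ < δ := fun C δ hδ =>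
    eventually_fineFilter.1 (by
      have := (hR C).norm
      rw [norm_zero] at this
      exact this.eventually_lt_const hδ)
  have hcomp : ∀ n, IsCompactOperator (R.comp (1 - tl n : Γ.X →L[ℝ] Γ.X)) := fun n =>
    (isCompactOperator_one_sub_tl n).clm_comp R
  refine isCompactOperator_of_tendsto (l := atTop)
    (F := fun n => R.comp (1 - tl n : Γ.X →L[ℝ] Γ.X)) ?_ (Eventually.of_forall hcomp)
  rw [tendsto_iff_norm_sub_tendsto_zero, Metric.tendsto_atTop]
  intro ε hε
  set δ := ε / 4 with hδ
  obtain ⟨N, hN⟩ := hR' (9 * 6) δ (by positivity)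
  obtain ⟨N', hN'⟩ := hR' (6 * 6 * mm N) δ (by positivity)
  refine ⟨max N N', fun n hn => ?_⟩
  rw [dist_zero_right, norm_norm]
  refine lt_of_le_of_lt (ContinuousLinearMap.opNorm_le_of_unit_norm (C := 3 * δ) (by positivity)
    fun u hu => ?_) (show 3 * δ < ε by rw [hδ]; linarith)
  have h1 : ((R.comp (1 - tl n : Γ.X →L[ℝ] Γ.X)) - R) u = - R (tl n u) := by
    change R (u - tl n u) - R u = _
    rw [map_sub]; abel
  rw [h1, norm_neg]
  obtain ⟨q, hq⟩ := exists_tl_lt (tl n u) (show 0 < δ / (‖R‖ + 1) by positivity)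
  set x := tl n u - tl q (tl n u) with hx
  have h2 : ‖R (tl q (tl n u))‖ ≤ δ := by
    refine (R.le_opNorm _).trans ?_
    refine (mul_le_mul_of_nonneg_left (hq q le_rfl) (norm_nonneg _)).trans ?_
    rw [mul_div_assoc', div_le_iff₀ (by positivity)]
    nlinarith [norm_nonneg R]
  have hxv : vec x = BD.head q (BD.tail n (vec u)) := by
    rw [hx, map_sub, vec_tl q, vec_tl, sub_eq_iff_eq_add, head_add_tail]
  have hxb : Blk n q (vec x) := by
    intro m hm
    rw [hxv, head_apply, tail_apply]
    rcases hm with hm | hm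
    · rw [if_neg (show ¬ n < m by omega), ite_self]
    · rw [if_neg (by omega)]
  have hxnb : Γ.NB (vec x) 6 := by
    rw [hxv]
    have := ((nb_vec u).tail n).head q
    rw [hu] at this
    exact this.mono (by norm_num)
  obtain ⟨y, z, hyz, hy, hz⟩ := exists_split hxb hxnb (N := N) (by omega)
  obtain ⟨qy, hqy⟩ := hy.blk
  obtain ⟨qz, hqz⟩ := hz.blk
  obtain ⟨y', rfl⟩ := exists_vec_eq_of_finite (Γ := Γ) fun m hm => hqy m (Or.inr hm)
  obtain ⟨z', rfl⟩ := exists_vec_eq_of_finite (Γ := Γ) fun m hm => hqz m (Or.inr hm)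
  have h3 : x = y' + z' := vec_injective (by rw [hyz, map_add])
  have h4 : tl n u = (y' + z') + tl q (tl n u) := by rw [← h3, hx]; abel
  have h5 := hN' y' (hy.mono le_rfl (by omega))
  have h6 := hN z' hz
  rw [h4, map_add, map_add]
  refine (norm_add_le _ _).trans ?_
  have := norm_add_le (R y') (R z')
  linarith

/-- Every operator is a multiplication plus a compact operator. -/
theorem exists_act_add_compact (T : Γ.X →L[ℝ] Γ.X) :
    ∃ (a : A) (K : Γ.X →L[ℝ] Γ.X), IsCompactOperator K ∧ T = act a + K := by
  obtain ⟨a, ha⟩ := exists_tendsto_sub_act T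
  exact ⟨a, T - act a, isCompactOperator_of_tendsto_fine _ ha, by abel⟩

theorem not_isCompactOperator_act_eps : ¬IsCompactOperator (act eps : Γ.X →L[ℝ] Γ.X) := by
  intro h
  have h1 : ∀ r : ℕ, ∃ w : Γ.X, Γ.Fine 4 r (vec w) ∧ ∃ n, Γ.e n (vec w) = 1 := exists_fine_unit
  choose w hw n hn using h1
  have hcpt := (isCompactOperator_iff_isCompact_closure_image_closedBall
    ((act eps : Γ.X →L[ℝ] Γ.X) : Γ.X →ₗ[ℝ] Γ.X) (show (0 : ℝ) < 4 by norm_num)).1 h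
  obtain ⟨v, -, φ, hφ, hv⟩ := hcpt.tendsto_subseq (x := fun r => act eps (w r)) fun r =>
    subset_closure ⟨w r, mem_closedBall_zero_iff.2 (norm_le_of_nb (hw r).nb), rfl⟩
  have heps : ‖eps‖ = 1 := by simp [norm_eq, eps]
  have key : v = 0 := by
    rw [← norm_le_zero_iff]
    refine le_of_forall_pos_le_add fun ε hε => ?_
    obtain ⟨q, hq⟩ := exists_tl_lt v (half_pos hε)
    have hlim : Tendsto (fun r => ‖tl q (act eps (w (φ r))) - act eps (w (φ r))‖) atTop
        (𝓝 ‖tl q v - v‖) := (((tl q).continuous.tendsto v).comp hv |>.sub hv).norm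
    have h2 : ‖tl q v - v‖ ≤ 0 := by
      refine le_of_tendsto hlim ((eventually_ge_atTop q).mono fun r hr => ?_)
      obtain ⟨q', hb⟩ := (hw (φ r)).blk
      rw [tl_eq_self (u := act eps (w (φ r))) (by rw [vec_act]; exact hb.smul _)
        (hr.trans hφ.le_apply), sub_self, norm_zero]
    have h3 := hq q le_rfl
    rw [sub_eq_zero.1 (norm_le_zero_iff.1 h2)] at h3
    linarith
  have h1 : (1 : ℝ) ≤ ‖v‖ := ge_of_tendsto' hv.norm fun r => by
    have := norm_le_of_act (hn (φ r)) eps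
    rwa [heps] at this
  rw [key, norm_zero] at h1
  linarith

end Nodes

end BD

namespace BD

open Finset

theorem sum_range_mul_eq {V : Type*} [AddCommMonoid V] (f : ℕ → V) (a b : ℕ) :
    ∑ m ∈ range (a * b), f m = ∑ k ∈ range a, ∑ q ∈ range b, f (k * b + q) := by
  induction a with
  | zero => simp
  | succ a ih => rw [Nat.succ_mul, sum_range_add, ih, sum_range_succ]

/-- In a long sequence of vectors of the unit ball whose sum is large there are consecutive groups
of equal length whose sums add up almost without cancellation. -/
theorem exists_groups {V : Type*} [NormedAddCommGroup V] [NormedSpace ℝ V] {L : ℕ} (hL : 2 ≤ L)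
    (t : ℕ) : ∀ v : ℕ → V, (∀ k < L ^ t, ‖v k‖ ≤ 1) →
    (L : ℝ) ^ t < 2 ^ t * ‖∑ k ∈ range (L ^ t), v k‖ →
    ∃ a l : ℕ, ∃ β : ℝ, 0 < l ∧ 0 < β ∧ l ≤ 2 ^ t * β ∧ a + L * l ≤ L ^ t ∧
      (∀ r < L, ‖∑ k ∈ range l, v (a + r * l + k)‖ ≤ β) ∧
      β * L < 2 * ‖∑ r ∈ range L, ∑ k ∈ range l, v (a + r * l + k)‖ := by
  have hL0 : (0 : ℝ) < L := by exact_mod_cast (by omega : 0 < L)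
  induction t with
  | zero =>
    intro v h1 h2
    have := h1 0 (by simp)
    simp at h2
    linarith
  | succ t ih =>
    intro v h1 h2
    have hlt : ∀ r < L ^ t, ∀ k < L, r * L + k < L ^ (t + 1) := fun r hr k hk => by
      have : (r + 1) * L ≤ L ^ t * L := Nat.mul_le_mul_right _ hr
      rw [pow_succ]; rw [add_mul] at this; omega
    by_cases h : ∃ r < L ^ t, (L : ℝ) / 2 < ‖∑ q ∈ range L, v (r * L + q)‖
    · obtain ⟨r, hr, h3⟩ := h
      refine ⟨r * L, 1, 1, one_pos, one_pos, ?_, ?_, fun q hq => ?_, ?_⟩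
      · rw [mul_one, Nat.cast_one]; exact one_le_pow₀ one_le_two
      · have : (r + 1) * L ≤ L ^ t * L := Nat.mul_le_mul_right _ hr
        rw [pow_succ]; rw [add_mul] at this; omega
      · simpa using h1 _ (hlt r hr q hq)
      · simp only [range_one, sum_singleton, mul_one, add_zero]
        linarith
    · push Not at h
      obtain ⟨a, l, β, hl, hβ, h3, h4, h5, h6⟩ := ih
        (fun r => (2 / L : ℝ) • ∑ q ∈ range L, v (r * L + q)) (fun r hr => by
          rw [norm_smul, Real.norm_of_nonneg (by positivity)]
          calc 2 / (L : ℝ) * _ ≤ 2 / L * (L / 2) := by gcongr; exact h r hr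
            _ = 1 := by field_simp) (by
          rw [← smul_sum, ← sum_range_mul_eq, ← pow_succ, norm_smul,
            Real.norm_of_nonneg (by positivity)]
          rw [pow_succ, pow_succ] at h2
          rw [show (2 : ℝ) ^ t * (2 / L * ‖∑ k ∈ range (L ^ (t + 1)), v k‖) =
            2 ^ t * 2 * ‖∑ k ∈ range (L ^ (t + 1)), v k‖ / L by ring, lt_div_iff₀ hL0]
          exact h2)
      have key : ∀ r, ∑ k ∈ range (l * L), v (a * L + r * (l * L) + k) =
          (L / 2 : ℝ) • ∑ k ∈ range l, (2 / L : ℝ) • ∑ q ∈ range L, v ((a + r * l + k) * L + q) := by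
        intro r
        rw [← smul_sum, smul_smul, show (L / 2 * (2 / L) : ℝ) = 1 by field_simp, one_smul,
          sum_range_mul_eq]
        refine sum_congr rfl fun k _ => sum_congr rfl fun q _ => ?_
        congr 1; ring
      refine ⟨a * L, l * L, L / 2 * β, by positivity, by positivity, ?_, ?_, fun r hr => ?_, ?_⟩
      · push_cast
        rw [pow_succ]
        nlinarith
      · rw [pow_succ]
        have := Nat.mul_le_mul_right L h4
        calc _ = (a + L * l) * L := by ring
          _ ≤ _ := this
      · rw [key, norm_smul, Real.norm_of_nonneg (by positivity)]
        gcongr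
        exact h5 r hr
      · rw [sum_congr rfl fun r _ => key r, ← smul_sum, norm_smul,
          Real.norm_of_nonneg (by positivity)]
        have : (0 : ℝ) < L / 2 := by positivity
        calc L / 2 * β * L = L / 2 * (β * L) := by ring
          _ < L / 2 * (2 * _) := by gcongr
          _ = _ := by ring

end BD

namespace BD

open Finset

namespace Nodes

variable {Γ : Nodes}

theorem exists_mem_tl_eq {Y : Submodule ℝ Γ.X} (hY : ¬FiniteDimensional ℝ Y) (p : ℕ) :
    ∃ y ∈ Y, ‖y‖ = 1 / 2 ∧ tl p y = y := by
  obtain ⟨c, l, hcl⟩ := exists_coords (Γ := Γ) p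
  let f : Y →ₗ[ℝ] (Fin (p + 1) → A) := c.toLinearMap.comp Y.subtype
  have hf : ¬Function.Injective f := fun h => hY (FiniteDimensional.of_injective f h)
  rw [← LinearMap.ker_eq_bot, Submodule.eq_bot_iff] at hf
  push Not at hf
  obtain ⟨y, hy, hy0⟩ := hf
  have hn : 0 < ‖(y : Γ.X)‖ := norm_pos_iff.2 fun h => hy0 (Subtype.ext h)
  have h1 : (y : Γ.X) - tl p y = 0 := by
    rw [hcl, show c (y : Γ.X) = 0 from hy, map_zero]
  refine ⟨(1 / 2 * ‖(y : Γ.X)‖⁻¹ : ℝ) • (y : Γ.X), Y.smul_mem _ y.2, ?_, ?_⟩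
  · rw [norm_smul, Real.norm_of_nonneg (by positivity)]
    field_simp
  · rw [map_smul, ← sub_eq_zero.1 h1]

/-- Every infinite-dimensional subspace contains a sequence that is close to successive blocks, all
of whose long initial sums have large norm. -/
theorem exists_blocks_of_submodule {Y : Submodule ℝ Γ.X} (hY : ¬FiniteDimensional ℝ Y) {j : ℕ}
    (hj : Even j) (L : ℕ) {ε : ℝ} (hε : 0 < ε) (hε' : ε ≤ 1 / 4) :
    ∃ (N : ℕ → ℕ) (y v : ℕ → Γ.X), StrictMono N ∧ N 0 = L ∧ (∀ k < nn j, y k ∈ Y ∧ ‖y k - v k‖ ≤ ε ∧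
      ‖v k‖ ≤ 1 ∧ Blk (N k) (N (k + 1)) (vec (v k))) ∧
      ∀ n ≤ nn j, th j * n ≤ 128 * ‖∑ k ∈ range n, v k‖ := by
  have : Inhabited (Γ.X × Γ.X × ℕ) := ⟨(0, 0, 0)⟩
  obtain ⟨ξ, N, p, hc, h0, hp⟩ := exists_chain (Γ := Γ) (P := Γ.X × Γ.X × ℕ) (j := j)
    (fun _ L p ξ' => p.1 ∈ Y ∧ ‖p.1 - p.2.1‖ ≤ ε ∧ ‖p.2.1‖ ≤ 1 ∧ Blk L p.2.2 (vec p.2.1) ∧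
      p.2.2 < ξ' ∧ 1 / 128 ≤ tau (Γ.B ξ' (vec p.2.1))) (fun ξ L h1 h2 h3 => by
      obtain ⟨y, hy, hy1, hy2⟩ := exists_mem_tl_eq hY L
      obtain ⟨q, hq⟩ := exists_tl_lt y hε
      set q' := max q L
      have h4 := hq q' (le_max_left _ _)
      have hsub : ‖y - (y - tl q' y)‖ ≤ ε := by rwa [sub_sub_cancel]
      have hblk : Blk L q' (vec (y - tl q' y)) := by
        intro n hn
        rw [map_sub, Pi.sub_apply, vec_tl, BD.tail_apply]
        rcases hn with hn | hn
        · rw [if_neg (by have := le_max_right q L; omega), sub_zero, ← hy2, vec_tl, BD.tail_apply,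
            if_neg (by omega)]
        · rw [if_pos hn, sub_self]
      have hle : ‖y - tl q' y‖ ≤ 1 := (norm_sub_le _ _).trans (by linarith)
      have hge : 1 / 4 ≤ ‖y - tl q' y‖ := by
        have := norm_sub_norm_le y (tl q' y)
        linarith
      obtain ⟨γ, hγ⟩ : ∃ γ, 1 / 8 ≤ ‖Γ.e γ (vec (y - tl q' y))‖ := by
        by_contra! hcon
        have := norm_le_of_nb (u := y - tl q' y) (C := 1 / 8) fun γ => (hcon γ).le
        linarith
      obtain ⟨ξ', h5, h6, h7, h8, -, h9⟩ := exists_node (Γ := Γ) hj h1 h2 h3 (Blk.zero) hblk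
        (δ := 1 / 8) (ε := 1) (by norm_num) one_pos (fun a => ⟨γ, by rwa [smul_zero, sub_zero]⟩)
      exact ⟨(y, y - tl q' y, q'), ξ', ⟨hy, hsub, hle, hblk, h5, by linarith⟩, h6, h7, h8⟩) L
  refine ⟨N, fun k => (p k).1, fun k => (p k).2.1, hc.mono, h0, fun k hk => ?_, fun n hn => ?_⟩
  · obtain ⟨h1, h2, h3, h4, h5, -⟩ := hp k hk
    exact ⟨h1, h2, h3, h4.mono le_rfl (by rw [hc.eq k hk]; exact h5.le)⟩
  · have h1 : tau (Γ.e (ξ (nn j)) (vec (∑ k ∈ range n, (p k).2.1))) =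
        th j * ∑ k ∈ range n, tau (Γ.B (ξ (k + 1)) (vec (p k).2.1)) := by
      rw [map_sum, map_sum, map_sum, mul_sum]
      refine sum_congr rfl fun k hk => ?_
      have hk := mem_range.1 hk
      obtain ⟨-, -, -, h4, h5, -⟩ := hp k (by omega)
      rw [hc.e_eq h4 h5 (by omega) le_rfl, map_smul, smul_eq_mul]
    have h2 : (n : ℝ) * (1 / 128) ≤ ∑ k ∈ range n, tau (Γ.B (ξ (k + 1)) (vec (p k).2.1)) := by
      rw [← card_range n, ← nsmul_eq_mul, card_range]
      have := card_nsmul_le_sum (range n) (fun k => tau (Γ.B (ξ (k + 1)) (vec (p k).2.1))) (1 / 128)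
        fun k hk => (hp k (by have := mem_range.1 hk; omega)).2.2.2.2.2
      rwa [card_range] at this
    have h3 := (le_abs_self _).trans ((abs_tau_le _).trans
      (nb_vec (∑ k ∈ range n, (p k).2.1) (ξ (nn j))))
    have h4 := mul_le_mul_of_nonneg_left h2 (th_pos j).le
    rw [h1] at h3
    linarith

theorem exists_fine_of_submodule {Y : Submodule ℝ Γ.X} (hY : ¬FiniteDimensional ℝ Y) (M : ℕ)
    {ε : ℝ} (hε : 0 < ε) :
    ∃ z ∈ Y, ∃ z' : Γ.X, Γ.Fine 2 M (vec z') ∧ 1 / 2 ≤ ‖z'‖ ∧ ‖z - z'‖ ≤ ε := by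
  set i := 2 * M + 1 with hi
  set j := i + 1 with hj
  set L := 6 * nn i with hL
  set t := mm j + 1 with ht
  have hLn : L ^ t ≤ nn j := by
    have h1 := le_nn_succ i
    have h2 : 1 ≤ 2 * mm (i + 1) ^ 2 := by have := four_le_mm (i + 1); nlinarith
    exact (Nat.le_mul_of_pos_left _ h2).trans h1
  have hL5 : 5 * nn M * mm M ≤ L := by
    have h1 := le_nn_succ M
    have h2 : nn (M + 1) ≤ nn i := nn_mono (by omega)
    have h3 : nn M ≤ (6 * nn M) ^ (mm (M + 1) + 1) :=
      (Nat.le_mul_of_pos_left _ (by norm_num)).trans (Nat.le_self_pow (by omega) _)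
    have h4 : mm M ≤ 2 * mm (M + 1) ^ 2 := by
      have h5 := mm_lt_succ M
      have h6 : mm (M + 1) ≤ mm (M + 1) ^ 2 := Nat.le_self_pow (by omega) _
      omega
    have h5 := Nat.mul_le_mul h4 h3
    have h6 : 5 * nn M * mm M = 5 * (mm M * nn M) := by ring
    omega
  have hL2 : 2 ≤ L := by have := one_le_nn i; omega
  have h2t : (128 : ℝ) * mm j < 2 ^ t := by
    have h1 : ∀ m : ℕ, 10 ≤ m → 128 * m < 2 ^ (m + 1) := fun m hm => by
      induction m, hm using Nat.le_induction with
      | base => norm_num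
      | succ m hm ih => rw [pow_succ]; omega
    have h2 : 10 ≤ mm j := by
      have h3 := mm_lt_succ M
      have h4 := sq_mm_le 0
      have h5 : mm (0 + 1) ≤ mm j := mm_mono (by omega)
      rw [mm_zero] at h4
      omega
    exact_mod_cast h1 _ h2
  have hLt : (0 : ℝ) < (L : ℝ) ^ t := by
    have : (0 : ℝ) < L := by exact_mod_cast (by omega : 0 < L)
    positivity
  obtain ⟨N, y, v, hN, hN0, hyv, hsum⟩ := exists_blocks_of_submodule hY (j := j)
    ⟨M + 1, by omega⟩ M (ε := min (1 / 4) (ε / 2 ^ t)) (by positivity) (min_le_left _ _)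
  have hbig : (L : ℝ) ^ t < 2 ^ t * ‖∑ k ∈ range (L ^ t), v k‖ := by
    have h1 := hsum _ hLn
    have h2 := mm_mul_th j
    have h3 := th_pos j
    push_cast at h1
    have h4 : (L : ℝ) ^ t = mm j * (th j * L ^ t) := by rw [← mul_assoc, h2, one_mul]
    have h5 : (mm j : ℝ) * (th j * L ^ t) ≤ mm j * (128 * ‖∑ k ∈ range (L ^ t), v k‖) := by gcongr
    have h6 : 0 < ‖∑ k ∈ range (L ^ t), v k‖ := by
      have : 0 < th j * (L : ℝ) ^ t := by positivity
      linarith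
    calc (L : ℝ) ^ t ≤ 128 * mm j * ‖∑ k ∈ range (L ^ t), v k‖ := by rw [h4]; linarith
      _ < _ := by gcongr
  obtain ⟨a, l, β, hl, hβ, h1, h2, h3, h4⟩ := exists_groups hL2 t v
    (fun k hk => (hyv k (by omega)).2.2.1) hbig
  have hL0 : (0 : ℝ) < L := by exact_mod_cast (by omega : 0 < L)
  have hidx : ∀ r < L, ∀ k < l, a + r * l + k < nn j := fun r hr k hk => by
    have := Nat.mul_le_mul_right l (show r + 1 ≤ L from hr)
    rw [add_mul] at this; omega
  set w : ℕ → ℕ → A := fun r => vec (β⁻¹ • ∑ k ∈ range l, v (a + r * l + k)) with hw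
  set c : ℝ := (L * β)⁻¹ with hcd
  have hc0 : 0 < c := by positivity
  have hz' : vec (c • ∑ r ∈ range L, ∑ k ∈ range l, v (a + r * l + k)) =
      (L : ℝ)⁻¹ • ∑ r ∈ range L, w r := by
    rw [hw, ← map_sum, ← map_smul, ← smul_sum, smul_smul, hcd, mul_inv]
  have hblocks : Γ.Blocks 1 (fun r => N (a + r * l)) (cut L w) := by
    refine ⟨fun r s hrs => hN ?_, fun r => ?_, fun r => ?_⟩
    · have := (Nat.mul_lt_mul_right hl).2 hrs
      omega
    all_goals rcases lt_or_ge r L with hr | hr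
    · rw [cut_of_lt hr, hw]
      dsimp only
      rw [map_smul, map_sum]
      refine (Blk.sum _ fun k hk => ?_).rsmul _
      have hk := mem_range.1 hk
      refine (hyv _ (hidx r hr k hk)).2.2.2.mono (hN.monotone (by omega)) (hN.monotone ?_)
      rw [add_mul]; omega
    · rw [cut_of_le hr]; exact Blk.zero
    · rw [cut_of_lt hr]
      refine (nb_vec _).mono ?_
      rw [norm_smul, Real.norm_of_nonneg (by positivity), inv_mul_le_one₀ hβ]
      exact h3 r hr
    · rw [cut_of_le hr]; exact NB.zero.mono zero_le_one
  have hinner := hblocks.inner (κ := 1) (D := 0) zero_le_one le_rfl (fun γ I => by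
    simpa using hblocks.sum_le_card γ I)
  have hnorm : ‖c • ∑ r ∈ range L, ∑ k ∈ range l, v (a + r * l + k)‖ ≤ 2 := by
    refine norm_le_of_nb ?_
    rw [hz', ← sum_cut]
    intro γ
    have := hblocks.sum_le_card γ (range L)
    rw [e_rsmul, norm_smul, map_sum, Real.norm_of_nonneg (by positivity), inv_mul_le_iff₀ hL0]
    rw [card_range] at this
    linarith
  refine ⟨c • ∑ r ∈ range L, ∑ k ∈ range l, y (a + r * l + k), ?_,
    c • ∑ r ∈ range L, ∑ k ∈ range l, v (a + r * l + k),
    ⟨⟨N (nn j), ?_⟩, (nb_vec _).mono hnorm, fun γ hγ => ?_⟩, ?_, ?_⟩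
  · exact Y.smul_mem _ (Y.sum_mem fun r hr => Y.sum_mem fun k hk =>
      (hyv _ (hidx r (mem_range.1 hr) k (mem_range.1 hk))).1)
  · rw [map_smul, map_sum]
    refine (Blk.sum _ fun r hr => ?_).rsmul _
    rw [map_sum]
    refine Blk.sum _ fun k hk => ?_
    have := hidx r (mem_range.1 hr) k (mem_range.1 hk)
    refine (hyv _ this).2.2.2.mono ?_ (hN.monotone this)
    rw [← hN0]; exact hN.monotone (Nat.zero_le _)
  · rw [hz', e_rsmul, norm_smul, Real.norm_of_nonneg (by positivity), inv_mul_le_iff₀ hL0,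
      ← sum_cut, map_sum]
    refine (hinner γ (range L)).trans ?_
    have h5 : (Γ.age γ : ℝ) ≤ nn M := by exact_mod_cast age_le' hγ
    have h6 : (5 * nn M * mm M : ℝ) ≤ L := by exact_mod_cast hL5
    have h7 := th_pos (Γ.wt γ)
    have h8 : 1 ≤ mm M * th (Γ.wt γ) := by
      rw [← mm_mul_th M]; gcongr; exact th_anti hγ
    have h9 : (5 * nn M : ℝ) ≤ L * th (Γ.wt γ) := by
      calc (5 * nn M : ℝ) = 5 * nn M * 1 := by ring
        _ ≤ 5 * nn M * (mm M * th (Γ.wt γ)) := by gcongr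
        _ = 5 * nn M * mm M * th (Γ.wt γ) := by ring
        _ ≤ _ := by gcongr
    rw [card_range]
    linarith
  · rw [norm_smul, Real.norm_of_nonneg hc0.le, hcd, ← div_eq_inv_mul, le_div_iff₀ (by positivity)]
    linarith
  · rw [← smul_sub, ← sum_sub_distrib, norm_smul, Real.norm_of_nonneg hc0.le, hcd,
      inv_mul_le_iff₀ (by positivity)]
    have h5 : ∀ r ∈ range L, ‖∑ k ∈ range l, y (a + r * l + k) - ∑ k ∈ range l, v (a + r * l + k)‖ ≤
        l * (ε / 2 ^ t) := fun r hr => by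
      rw [← sum_sub_distrib]
      refine (norm_sum_le_of_le _ fun k hk =>
        (hyv _ (hidx r (mem_range.1 hr) k (mem_range.1 hk))).2.1.trans (min_le_right _ _)).trans ?_
      rw [sum_const, card_range, nsmul_eq_mul]
    refine (norm_sum_le_of_le _ h5).trans ?_
    rw [sum_const, card_range, nsmul_eq_mul, mul_assoc]
    refine mul_le_mul_of_nonneg_left ?_ hL0.le
    calc (l : ℝ) * (ε / 2 ^ t) ≤ 2 ^ t * β * (ε / 2 ^ t) := by gcongr
      _ = β * ε := by field_simp

/-- Multiplication by `ε` is strictly singular. -/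
theorem exists_norm_act_eps_lt {Y : Submodule ℝ Γ.X} (hY : ¬FiniteDimensional ℝ Y) {c : ℝ}
    (hc : 0 < c) : ∃ y ∈ Y, ‖act eps y‖ < c * ‖y‖ := by
  by_contra! h
  let G : Submodule ℝ ((ℕ → A) × (ℕ → A)) :=
    Y.map (((vec (Γ := Γ)).comp (act eps).toLinearMap).prod vec)
  have heps : ‖eps‖ = 1 := by rw [norm_eq, eps, re_mk, tau_mk]; simp
  have hact : ∀ u : Γ.X, ‖act eps u‖ ≤ ‖u‖ := fun u => by
    simpa [heps] using norm_act_le eps u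
  have hsep : Γ.Sep G 2 (min (c / 8) 1) := by
    intro N ε hε
    obtain ⟨z, hz, z', h1, h2, h3⟩ := exists_fine_of_submodule hY N
      (ε := min ε (min (1 / 8) (c / 16) / (1 + c))) (by positivity)
    have h3' : ‖z - z'‖ ≤ min (1 / 8) (c / 16) / (1 + c) := h3.trans (min_le_right _ _)
    have h4 : (1 + c) * ‖z - z'‖ ≤ min (1 / 8) (c / 16) := by
      rw [le_div_iff₀ (by positivity)] at h3'; linarith
    have h4' := h4.trans (min_le_right _ _)
    refine ⟨(vec (act eps z), vec z), ⟨z, hz, rfl⟩, vec (act eps z'), vec z',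
      ?_, h1.blk, ?_, ?_, ?_⟩
    · obtain ⟨q, hq⟩ := h1.blk
      rw [vec_act]
      refine ⟨⟨q, hq.smul _⟩, ?_, fun γ hγ => ?_⟩
      · have := h1.nb.smul eps
        rwa [heps, one_mul] at this
      · rw [map_smul, smul_eq_mul]
        refine (norm_mul_le _ _).trans ?_
        rw [heps, one_mul]
        exact h1.small γ hγ
    · rw [← map_sub, ← map_sub]
      exact (nb_vec _).mono ((hact _).trans (h3.trans (min_le_left _ _)))
    · rw [← map_sub]
      exact (nb_vec _).mono (h3.trans (min_le_left _ _))
    · intro a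
      have h5 : c / 4 ≤ ‖act eps z'‖ := by
        have h6 := h z hz
        have h7 := hact (z - z')
        rw [map_sub] at h7
        have h8 := norm_sub_norm_le (act eps z) (act eps z')
        have h9 := norm_sub_norm_le z' z
        rw [norm_sub_rev] at h9
        have h10 : c * (‖z'‖ - ‖z - z'‖) ≤ c * ‖z‖ := by gcongr; linarith
        nlinarith
      obtain ⟨γ, hγ⟩ : ∃ γ, c / 8 ≤ ‖Γ.e γ (vec (act eps z'))‖ := by
        by_contra! hcon
        have := norm_le_of_nb (u := act eps z') (C := c / 8) fun γ => (hcon γ).le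
        linarith
      refine ⟨γ, (min_le_left _ _).trans (hγ.trans ?_)⟩
      have h6 : Γ.e γ (vec (act eps z')) = eps * Γ.e γ (vec z' - a • vec (act eps z')) := by
        simp only [vec_act, map_sub, map_smul, smul_eq_mul]
        rw [mul_sub, mul_left_comm eps a, ← mul_assoc eps eps, eps_mul_eps, zero_mul, mul_zero,
          sub_zero]
      rw [h6]
      refine (norm_mul_le _ _).trans ?_
      rw [heps, one_mul]
  obtain ⟨p, ⟨y, hy, rfl⟩, D, hD, hnb, γ, hγ⟩ := hsep.unbounded (by positivity) c⁻¹
  have h1 : ‖act eps y‖ ≤ D := norm_le_of_nb hnb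
  have h2 := h y hy
  have h3 := nb_vec y γ
  have h4 : ‖y‖ ≤ c⁻¹ * D := by
    rw [← div_eq_inv_mul, le_div_iff₀ hc]; linarith
  exact absurd hγ (not_lt.2 (h3.trans h4))

end Nodes

end BD

namespace BD

open Filter Topology

variable {X : Type*} [NormedAddCommGroup X] [NormedSpace ℝ X]

/-- The complexification of a real normed space. -/
def Cx (X : Type*) [NormedAddCommGroup X] [NormedSpace ℝ X] : Type _ := ℂ →L[ℝ] X

namespace Cx

noncomputable instance : NormedAddCommGroup (Cx X) :=
  inferInstanceAs (NormedAddCommGroup (ℂ →L[ℝ] X))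
noncomputable instance : NormedSpace ℝ (Cx X) := inferInstanceAs (NormedSpace ℝ (ℂ →L[ℝ] X))
instance [CompleteSpace X] : CompleteSpace (Cx X) := inferInstanceAs (CompleteSpace (ℂ →L[ℝ] X))

noncomputable instance : FunLike (Cx X) ℂ X := inferInstanceAs (FunLike (ℂ →L[ℝ] X) ℂ X)

theorem map_add' (f : Cx X) (w z : ℂ) : f (w + z) = f w + f z :=
  ContinuousLinearMap.map_add (f : ℂ →L[ℝ] X) w z

theorem map_smul' (f : Cx X) (r : ℝ) (z : ℂ) : f (r • z) = r • f z :=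
  ContinuousLinearMap.map_smul (f : ℂ →L[ℝ] X) r z

@[ext] theorem ext {f g : Cx X} (h : ∀ z, f z = g z) : f = g :=
  ContinuousLinearMap.ext (f := (f : ℂ →L[ℝ] X)) h

theorem map_zero' (f : Cx X) : f 0 = 0 := ContinuousLinearMap.map_zero (f : ℂ →L[ℝ] X)

noncomputable instance : SMul ℂ (Cx X) :=
  ⟨fun z f => ContinuousLinearMap.comp (f : ℂ →L[ℝ] X) (ContinuousLinearMap.mul ℝ ℂ z)⟩

theorem smul_apply (z : ℂ) (f : Cx X) (w : ℂ) : (z • f) w = f (z * w) := rfl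
theorem add_apply (f g : Cx X) (w : ℂ) : (f + g) w = f w + g w := rfl
theorem zero_apply (w : ℂ) : (0 : Cx X) w = 0 := rfl

theorem le_norm (f : Cx X) (w : ℂ) : ‖f w‖ ≤ ‖f‖ * ‖w‖ :=
  ContinuousLinearMap.le_opNorm (f : ℂ →L[ℝ] X) w

theorem norm_le (f : Cx X) {M : ℝ} (hM : 0 ≤ M) (h : ∀ w, ‖f w‖ ≤ M * ‖w‖) : ‖f‖ ≤ M :=
  ContinuousLinearMap.opNorm_le_bound (f : ℂ →L[ℝ] X) hM h

noncomputable instance : Module ℂ (Cx X) where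
  one_smul f := by ext w; rw [smul_apply, one_mul]
  mul_smul a b f := by ext w; simp only [smul_apply]; congr 1; ring
  smul_zero a := by ext w; rfl
  smul_add a f g := by ext w; rfl
  add_smul a b f := by ext w; simp only [smul_apply, add_apply, add_mul, map_add']
  zero_smul f := by
    ext w
    rw [smul_apply, zero_apply, zero_mul, map_zero']

noncomputable instance : NormedSpace ℂ (Cx X) where
  norm_smul_le z f := norm_le _ (by positivity) fun w => by
    rw [smul_apply]
    refine (le_norm f _).trans (le_of_eq ?_)
    rw [norm_mul]; ring

theorem norm_map_le (T : X →L[ℝ] X) (f : Cx X) :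
    ‖(T.comp (f : ℂ →L[ℝ] X) : Cx X)‖ ≤ ‖T‖ * ‖f‖ :=
  ContinuousLinearMap.opNorm_comp_le T (f : ℂ →L[ℝ] X)

/-- The complexification of an operator. -/
noncomputable def map (T : X →L[ℝ] X) : Cx X →L[ℂ] Cx X :=
  LinearMap.mkContinuous
    { toFun := fun f => (T.comp (f : ℂ →L[ℝ] X) : Cx X)
      map_add' := fun _ _ => ContinuousLinearMap.comp_add T _ _
      map_smul' := fun _ _ => rfl } ‖T‖ fun f => norm_map_le T f

/-- A vector of the real space, as a vector of the complexification. -/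
noncomputable def of (x : X) : Cx X := ContinuousLinearMap.smulRight Complex.reCLM x

theorem of_apply (x : X) (w : ℂ) : of x w = w.re • x := rfl

theorem norm_of_le (x : X) : ‖of x‖ ≤ ‖x‖ := norm_le _ (norm_nonneg _) fun w => by
  rw [of_apply, norm_smul, mul_comm]
  gcongr
  exact Complex.abs_re_le_norm w

theorem map_pow_apply (T : X →L[ℝ] X) (n : ℕ) (f : Cx X) (w : ℂ) :
    (map T ^ n) f w = (T ^ n) (f w) := by
  induction n generalizing f with
  | zero => rfl
  | succ n ih => rw [pow_succ, pow_succ, mul_apply_eq_comp, ih]; rfl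

theorem norm_pow_le (T : X →L[ℝ] X) (n : ℕ) : ‖T ^ n‖ ≤ ‖map T ^ n‖ := by
  refine ContinuousLinearMap.opNorm_le_bound _ (norm_nonneg _) fun x => ?_
  have h1 := le_norm ((map T ^ n) (of x)) 1
  rw [map_pow_apply, of_apply, Complex.one_re, one_smul, norm_one, mul_one] at h1
  refine h1.trans ((ContinuousLinearMap.le_opNorm _ _).trans ?_)
  gcongr
  exact norm_of_le x

theorem isCompactOperator_map {T : X →L[ℝ] X} (hT : IsCompactOperator T) :
    IsCompactOperator (map T) := by
  let ev (z : ℂ) : Cx X →L[ℝ] X :=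
    (ContinuousLinearMap.apply ℝ X z : (ℂ →L[ℝ] X) →L[ℝ] X)
  let bk (φ : ℂ →L[ℝ] ℝ) : X →L[ℝ] Cx X :=
    (ContinuousLinearMap.smulRightL ℝ ℂ X φ : X →L[ℝ] (ℂ →L[ℝ] X))
  have h1 := ((hT.comp_clm (ev 1)).clm_comp (bk Complex.reCLM)).add
    ((hT.comp_clm (ev Complex.I)).clm_comp (bk Complex.imCLM))
  have h2 : (map T : Cx X → Cx X) =
      bk Complex.reCLM ∘ T ∘ ev 1 + bk Complex.imCLM ∘ T ∘ ev Complex.I := by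
    funext f
    ext w
    change T (f w) = w.re • T (f 1) + w.im • T (f Complex.I)
    rw [← T.map_smul, ← T.map_smul, ← T.map_add, ← map_smul' f, ← map_smul' f, ← map_add' f]
    congr 2
    apply Complex.ext <;> simp
  rw [h2]
  exact h1

end Cx

theorem exists_quadratic [CompleteSpace X] {Q : X →L[ℝ] X} (hQ : IsCompactOperator Q) :
    (∀ r : ℝ, 0 < r → ∀ᶠ n in atTop, ‖Q ^ n‖ ≤ r ^ n) ∨
    ∃ a b : ℝ, (a ≠ 0 ∨ b ≠ 0) ∧
      ∃ u, u ≠ 0 ∧ Q (Q u) - (2 * a) • Q u + (a ^ 2 + b ^ 2) • u = 0 := by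
  by_cases h : ∃ z ∈ spectrum ℂ (Cx.map Q), z ≠ 0
  · right
    obtain ⟨z, hz, hz0⟩ := h
    have h1 := (IsCompactOperator.hasEigenvalue_iff_mem_spectrum
      (Cx.isCompactOperator_map hQ) hz0).2 hz
    obtain ⟨f, hf⟩ := h1.exists_hasEigenvector
    have h2 : ∀ w, Q (f w) = f (z * w) := fun w => congrArg (fun g : Cx X => g w) hf.apply_eq_smul
    refine ⟨z.re, z.im, ?_, ?_⟩
    · by_contra! hc
      exact hz0 (Complex.ext hc.1 hc.2)
    · obtain ⟨w, hw⟩ : ∃ w, f w ≠ 0 := by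
        by_contra! hc
        exact hf.2 (Cx.ext hc)
      refine ⟨f w, hw, ?_⟩
      rw [h2, h2, ← Cx.map_smul', ← Cx.map_smul', sub_eq_add_neg, ← neg_one_smul ℝ (f _),
        ← Cx.map_smul', ← Cx.map_add', ← Cx.map_add', ← f.map_zero']
      congr 1
      apply Complex.ext <;> simp [pow_two] <;> ring
  · left
    push Not at h
    intro r hr
    have h1 : spectralRadius ℂ (Cx.map Q) = 0 := by
      simp only [spectralRadius, ENNReal.iSup_eq_zero]
      intro z hz
      simp [h z hz]
    have h2 := spectrum.pow_nnnorm_pow_one_div_tendsto_nhds_spectralRadius (Cx.map Q)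
    rw [h1] at h2
    have h3 := h2.eventually_lt_const (show (0 : ENNReal) < ENNReal.ofReal r by simpa using hr)
    filter_upwards [h3, eventually_gt_atTop 0] with n hn hn0
    refine (Cx.norm_pow_le Q n).trans ?_
    have hn' : (0 : ℝ) < n := by exact_mod_cast hn0
    have h4 := ENNReal.rpow_le_rpow hn.le hn'.le
    rw [← ENNReal.rpow_mul, one_div, inv_mul_cancel₀ hn'.ne', ENNReal.rpow_one, ENNReal.rpow_natCast,
      ← ENNReal.ofReal_pow hr.le] at h4
    have h5 := ENNReal.toReal_mono ENNReal.ofReal_ne_top h4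
    rwa [ENNReal.toReal_ofReal (by positivity)] at h5

end BD

namespace BD

open Filter Topology Polynomial

variable {X : Type*} [NormedAddCommGroup X] [NormedSpace ℝ X]

theorem exists_invariant_of_cyclic (R : X →L[ℝ] X) {y : X} (hy : y ≠ 0)
    (h : ∃ x, ∃ r > 0, ∀ p : ℝ[X], r ≤ ‖aeval R p y - x‖) :
    ∃ W : Submodule ℝ X, IsClosed (W : Set X) ∧ W ≠ ⊥ ∧ W ≠ ⊤ ∧ ∀ w ∈ W, R w ∈ W := by
  obtain ⟨x, r, hr, h⟩ := h
  let f : ℝ[X] →ₗ[ℝ] X :=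
    (ContinuousLinearMap.apply ℝ X y).toLinearMap.comp (aeval R).toLinearMap
  have hf : ∀ p, f p = aeval R p y := fun p => rfl
  refine ⟨(LinearMap.range f).topologicalClosure, Submodule.isClosed_topologicalClosure _,
    ?_, ?_, ?_⟩
  · intro hbot
    have h1 : y ∈ (LinearMap.range f).topologicalClosure :=
      Submodule.le_topologicalClosure _ ⟨1, by rw [hf, map_one]; rfl⟩
    rw [hbot] at h1
    exact hy ((Submodule.mem_bot ℝ).1 h1)
  · intro htop
    have h1 : x ∈ closure (LinearMap.range f : Set X) := by
      rw [← Submodule.topologicalClosure_coe, htop]; trivial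
    obtain ⟨_, ⟨p, rfl⟩, hp⟩ := Metric.mem_closure_iff.1 h1 r hr
    rw [dist_eq_norm, norm_sub_rev] at hp
    exact absurd hp (not_lt.2 (h p))
  · intro w hw
    refine map_mem_closure R.continuous hw ?_
    rintro _ ⟨p, rfl⟩
    refine ⟨Polynomial.X * p, ?_⟩
    rw [hf, hf, map_mul, aeval_X]
    rfl

/-- Hilden's argument. -/
theorem exists_invariant_of_quasinilpotent {R Q : X →L[ℝ] X} (hRQ : Commute R Q)
    (hQ : IsCompactOperator Q) (hQ0 : Q ≠ 0) (h : ∀ r : ℝ, 0 < r → ∀ᶠ n in atTop, ‖Q ^ n‖ ≤ r ^ n) :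
    ∃ W : Submodule ℝ X, IsClosed (W : Set X) ∧ W ≠ ⊥ ∧ W ≠ ⊤ ∧ ∀ w ∈ W, R w ∈ W := by
  by_contra hno
  have hcyc : ∀ y : X, y ≠ 0 → ∀ x, ∃ p : ℝ[X], ‖aeval R p y - x‖ < 1 := by
    intro y hy x
    by_contra! hc
    exact hno (exists_invariant_of_cyclic R hy ⟨x, 1, one_pos, hc⟩)
  obtain ⟨x0, hx0⟩ : ∃ x0, ‖Q‖ + 1 ≤ ‖Q x0‖ := by
    obtain ⟨u, hu⟩ : ∃ u, Q u ≠ 0 := by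
      by_contra! hc
      exact hQ0 (ContinuousLinearMap.ext hc)
    have hu' := norm_pos_iff.2 hu
    refine ⟨((‖Q‖ + 1) / ‖Q u‖) • u, ?_⟩
    rw [map_smul, norm_smul, Real.norm_of_nonneg (by positivity), div_mul_cancel₀ _ hu'.ne']
  have hx01 : 1 < ‖x0‖ := by
    have h1 := Q.le_opNorm x0
    by_contra! hc
    have h2 : ‖Q‖ * ‖x0‖ ≤ ‖Q‖ * 1 := by gcongr
    linarith
  have hK := hQ.isCompact_closure_image_of_bounded (f := Q.toLinearMap)
    (Metric.isBounded_closedBall (x := x0) (r := 1))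
  set K := closure (Q '' Metric.closedBall x0 1) with hKd
  have hK0 : ∀ y ∈ K, y ≠ 0 := by
    intro y hy hy0
    have h1 : K ⊆ {z | 1 ≤ ‖z‖} := by
      refine closure_minimal ?_ (isClosed_le continuous_const continuous_norm)
      rintro _ ⟨x, hx, rfl⟩
      rw [Metric.mem_closedBall, dist_eq_norm] at hx
      have h2 := Q.le_opNorm (x - x0)
      rw [map_sub] at h2
      have h3 := norm_sub_norm_le (Q x0) (Q x)
      rw [norm_sub_rev] at h3
      have h4 : ‖Q‖ * ‖x - x0‖ ≤ ‖Q‖ * 1 := by gcongr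
      change 1 ≤ ‖Q x‖
      linarith
    have h2 := h1 hy
    rw [hy0] at h2
    simp at h2
    linarith
  obtain ⟨s, hs⟩ := hK.elim_finite_subcover (fun p : ℝ[X] => {y | ‖aeval R p y - x0‖ < 1})
    (fun p => isOpen_lt (by fun_prop) continuous_const) (fun y hy => by
      obtain ⟨p, hp⟩ := hcyc y (hK0 y hy) x0
      exact Set.mem_iUnion.2 ⟨p, hp⟩)
  set c : ℝ := 1 + ∑ p ∈ s, ‖aeval R p‖ with hc
  have hc0 : 0 < c := by positivity
  have hstep : ∀ n : ℕ, ∃ P : X →L[ℝ] X, Commute P Q ∧ ‖P‖ ≤ c ^ n ∧ ‖P ((Q ^ n) x0) - x0‖ ≤ 1 := by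
    intro n
    induction n with
    | zero => exact ⟨1, Commute.one_left _, by
        rw [pow_zero]; exact ContinuousLinearMap.norm_id_le, by simp⟩
    | succ n ih =>
      obtain ⟨P, hP1, hP2, hP3⟩ := ih
      have h1 : Q (P ((Q ^ n) x0)) ∈ K := subset_closure ⟨_, by
        rwa [Metric.mem_closedBall, dist_eq_norm], rfl⟩
      obtain ⟨p, hp⟩ := Set.mem_iUnion.1 (hs h1)
      obtain ⟨hps, hp⟩ := Set.mem_iUnion.1 hp
      refine ⟨aeval R p * P, ?_, ?_, ?_⟩
      · refine Commute.mul_left ?_ hP1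
        rw [aeval_eq_sum_range]
        exact Commute.sum_left _ _ _ fun i _ => (hRQ.pow_left i).smul_left _
      · rw [pow_succ, mul_comm (c ^ n)]
        refine (norm_mul_le _ _).trans ?_
        have h2 := Finset.single_le_sum (f := fun p => ‖aeval R p‖) (fun _ _ => norm_nonneg _) hps
        gcongr
        rw [hc]
        linarith
      · have h2 : (aeval R p * P) ((Q ^ (n + 1)) x0) = aeval R p (Q (P ((Q ^ n) x0))) := by
          rw [pow_succ']
          exact congrArg (aeval R p) (congrArg (fun F : X →L[ℝ] X => F ((Q ^ n) x0)) hP1.eq)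
        rw [h2]
        exact le_of_lt hp
  have hlim : Tendsto (fun n : ℕ => (1 / 2 : ℝ) ^ n * ‖x0‖) atTop (𝓝 (0 * ‖x0‖)) :=
    (tendsto_pow_atTop_nhds_zero_of_lt_one (by norm_num) (by norm_num)).mul_const _
  rw [zero_mul] at hlim
  obtain ⟨n, hn1, hn2⟩ := ((h (1 / (2 * c)) (by positivity)).and
    (hlim.eventually_lt_const (show (0 : ℝ) < ‖x0‖ - 1 by linarith))).exists
  obtain ⟨P, -, hP2, hP3⟩ := hstep n
  have h1 : ‖P ((Q ^ n) x0)‖ ≤ (1 / 2) ^ n * ‖x0‖ := by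
    calc ‖P ((Q ^ n) x0)‖ ≤ ‖P‖ * (‖Q ^ n‖ * ‖x0‖) :=
          (P.le_opNorm _).trans (by gcongr; exact (Q ^ n).le_opNorm x0)
      _ ≤ c ^ n * ((1 / (2 * c)) ^ n * ‖x0‖) := by gcongr
      _ = _ := by
        rw [← mul_assoc, ← mul_pow]
        congr 2
        field_simp
  have h2 := norm_sub_norm_le x0 (P ((Q ^ n) x0))
  rw [norm_sub_rev] at h2
  linarith

/-- An operator on an infinite-dimensional Banach space with a compact power has a non-trivial
closed invariant subspace. -/
theorem exists_invariant_of_compact_pow [CompleteSpace X] (hX : ¬FiniteDimensional ℝ X)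
    (R : X →L[ℝ] X) (m : ℕ) (hm : IsCompactOperator (R ^ m)) :
    ∃ W : Submodule ℝ X, IsClosed (W : Set X) ∧ W ≠ ⊥ ∧ W ≠ ⊤ ∧ ∀ w ∈ W, R w ∈ W := by
  have : Nontrivial X := by
    by_contra hc
    rw [not_nontrivial_iff_subsingleton] at hc
    exact hX inferInstance
  have hclosed : ∀ P : X →L[ℝ] X,
      IsClosed ((LinearMap.ker P.toLinearMap : Submodule ℝ X) : Set X) :=
    fun P => P.isClosed_ker
  by_cases h0 : R ^ m = 0
  · by_cases hR : R = 0
    · obtain ⟨x, hx⟩ := exists_ne (0 : X)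
      refine ⟨ℝ ∙ x, Submodule.closed_of_finiteDimensional _, ?_, ?_, ?_⟩
      · rwa [ne_eq, Submodule.span_singleton_eq_bot]
      · intro htop
        refine hX ?_
        refine Module.finite_def.2 ?_
        rw [← htop]
        exact Submodule.fg_span_singleton x
      · intro w _
        rw [hR]; exact Submodule.zero_mem _
    · refine ⟨LinearMap.ker R.toLinearMap, hclosed R, ?_, ?_, ?_⟩
      · intro hbot
        have hinj : Function.Injective R := LinearMap.ker_eq_bot.1 hbot
        obtain ⟨x, hx⟩ := exists_ne (0 : X)
        have h1 : ∀ n : ℕ, (R ^ n) x ≠ 0 := fun n => by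
          induction n with
          | zero => exact hx
          | succ n ih =>
            rw [pow_succ']
            exact fun h => ih (hinj (h.trans (map_zero R).symm))
        exact h1 m (by rw [h0]; rfl)
      · intro htop
        exact hR (ContinuousLinearMap.ext fun x => by
          have : x ∈ LinearMap.ker R.toLinearMap := by rw [htop]; trivial
          exact this)
      · intro w hw
        have : R w = 0 := hw
        rw [this]; exact Submodule.zero_mem _
  · set Q := R ^ m with hQ
    have hRQ : Commute R Q := Commute.pow_right (Commute.refl R) m
    rcases exists_quadratic hm with h | ⟨a, b, hab, u, hu, hu'⟩
    · exact exists_invariant_of_quasinilpotent hRQ hm h0 h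
    · let P : X →L[ℝ] X := Q * Q - (2 * a) • Q + (a ^ 2 + b ^ 2) • 1
      have hP : ∀ x, P x = Q (Q x) - (2 * a) • Q x + (a ^ 2 + b ^ 2) • x := fun x => rfl
      have hPR : Commute R P := ((hRQ.mul_right hRQ).sub_right (hRQ.smul_right _)).add_right
        ((Commute.one_right R).smul_right _)
      have hab' : 0 < a ^ 2 + b ^ 2 := by rcases hab with h | h <;> positivity
      refine ⟨LinearMap.ker P.toLinearMap, hclosed P, ?_, ?_, ?_⟩
      · intro hbot
        have : u ∈ LinearMap.ker P.toLinearMap := hu'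
        rw [hbot] at this
        exact hu ((Submodule.mem_bot ℝ).1 this)
      · intro htop
        refine hX ((isCompactOperator_id_iff_finiteDimensional (𝕜 := ℝ)).1 ?_)
        have h1 : IsCompactOperator (((a ^ 2 + b ^ 2)⁻¹ : ℝ) •
            (((2 * a) • Q - Q * Q : X →L[ℝ] X) : X → X)) :=
          ((hm.smul (2 * a)).sub (hm.clm_comp Q)).smul _
        convert h1 using 1
        funext x
        have h2 : x ∈ LinearMap.ker P.toLinearMap := by rw [htop]; trivial
        have h3 : Q (Q x) - (2 * a) • Q x + (a ^ 2 + b ^ 2) • x = 0 := h2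
        change x = (a ^ 2 + b ^ 2)⁻¹ • ((2 * a) • Q x - Q (Q x))
        rw [eq_inv_smul_iff₀ hab'.ne']
        rw [← sub_eq_zero, ← h3]
        abel
      · intro w hw
        have h1 : P w = 0 := hw
        change P (R w) = 0
        have h2 : P (R w) = R (P w) := congrArg (fun F : X →L[ℝ] X => F w) hPR.eq.symm
        rw [h2, h1, map_zero]

end BD

namespace BD

/-- The right shift on `Fin k → ℝ`, a nilpotent Jordan block. -/
noncomputable def shift (k : ℕ) : (Fin k → ℝ) →L[ℝ] (Fin k → ℝ) :=
  LinearMap.toContinuousLinearMap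
    { toFun := fun v i => if (i : ℕ) = 0 then 0 else v ⟨i - 1, by omega⟩
      map_add' := fun v w => by ext i; by_cases h : (i : ℕ) = 0 <;> simp [h]
      map_smul' := fun r v => by ext i; by_cases h : (i : ℕ) = 0 <;> simp [h] }

theorem shift_apply {k : ℕ} (v : Fin k → ℝ) (i : Fin k) :
    shift k v i = if (i : ℕ) = 0 then 0 else v ⟨i - 1, by omega⟩ := rfl

theorem shift_pow_apply {k : ℕ} (n : ℕ) (v : Fin k → ℝ) (i : Fin k) :
    (shift k ^ n) v i = if (i : ℕ) < n then 0 else v ⟨i - n, by omega⟩ := by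
  induction n generalizing i with
  | zero => rfl
  | succ n ih =>
    rw [pow_succ', mul_apply_eq_comp, shift_apply]
    split_ifs with h1 h2 h2
    · rfl
    · omega
    · rw [ih, if_pos (by simp only; omega)]
    · rw [ih, if_neg (by simp only; omega)]
      congr 2
      simp only
      omega

theorem shift_pow_self (k : ℕ) : shift k ^ k = 0 := by
  ext v i
  rw [shift_pow_apply, if_pos i.2]
  rfl

theorem shift_pow_pred_ne_zero {k : ℕ} (hk : 0 < k) : shift k ^ (k - 1) ≠ 0 := by
  intro h
  have h1 := shift_pow_apply (k := k) (k - 1) (fun _ => 1) ⟨k - 1, by omega⟩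
  rw [h] at h1
  simp at h1

section Prod

variable {X F : Type*} [NormedAddCommGroup X] [NormedSpace ℝ X] [NormedAddCommGroup F]
  [NormedSpace ℝ F]

theorem prodMap_pow (S : X →L[ℝ] X) (J : F →L[ℝ] F) (n : ℕ) :
    S.prodMap J ^ n = (S ^ n).prodMap (J ^ n) := by
  induction n with
  | zero => rfl
  | succ n ih => rw [pow_succ, ih, pow_succ, pow_succ]; rfl

variable [FiniteDimensional ℝ F]

/-- An operator on `X × F` with `F` finite-dimensional is compact if its `X`-corner is. -/
theorem isCompactOperator_of_corner {T : X × F →L[ℝ] X × F}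
    (h : IsCompactOperator (ContinuousLinearMap.fst ℝ X F ∘ T ∘ ContinuousLinearMap.inl ℝ X F)) :
    IsCompactOperator T := by
  have : LocallyCompactSpace F := .of_finiteDimensional_of_complete ℝ F
  have h1 := h.comp_clm (ContinuousLinearMap.fst ℝ X F)
  have h2 := h1.clm_comp (ContinuousLinearMap.inl ℝ X F)
  have h3 := (isCompactOperator_of_locallyCompactSpace_dom (ContinuousLinearMap.snd ℝ X F)).clm_comp
    (T.comp (ContinuousLinearMap.inr ℝ X F))
  have h4 := ((isCompactOperator_of_locallyCompactSpace_dom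
    ((ContinuousLinearMap.snd ℝ X F).comp T)).sub
    ((isCompactOperator_of_locallyCompactSpace_dom (ContinuousLinearMap.snd ℝ X F)).clm_comp
      ((ContinuousLinearMap.snd ℝ X F).comp (T.comp (ContinuousLinearMap.inr ℝ X F))))).clm_comp
    (ContinuousLinearMap.inr ℝ X F)
  refine (congrArg IsCompactOperator (funext fun x => ?_)).mpr ((h2.add h3).add h4)
  have hx : T x = T (x.1, 0) + T (0, x.2) := by rw [← map_add]; simp
  apply Prod.ext
  · simp [hx]
  · simp [hx, add_comm]

theorem strictlySingular_prodMap {S : X →L[ℝ] X} (J : F →L[ℝ] F) (hS : StrictlySingular S) :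
    StrictlySingular (S.prodMap J) := by
  intro Y hY c hc
  let Z : Submodule ℝ X := Y.comap (LinearMap.inl ℝ X F)
  have hZ : ¬FiniteDimensional ℝ Z := by
    intro hZ
    refine hY (Module.Finite.iff_fg.2 (Submodule.fg_of_fg_map_of_fg_inf_ker (LinearMap.snd ℝ X F)
      (IsNoetherian.noetherian _) ?_))
    have h1 : Y ⊓ LinearMap.ker (LinearMap.snd ℝ X F) = Z.map (LinearMap.inl ℝ X F) := by
      ext ⟨x, v⟩
      constructor
      · rintro ⟨hxY, hv⟩
        obtain rfl : v = 0 := hv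
        exact ⟨x, hxY, rfl⟩
      · rintro ⟨x', hx', h⟩
        rw [← h]
        exact ⟨hx', rfl⟩
    rw [h1]
    exact (Module.Finite.iff_fg.1 hZ).map _
  obtain ⟨y, hy, hlt⟩ := hS Z hZ c hc
  refine ⟨(y, 0), hy, ?_⟩
  have h1 : S.prodMap J (y, 0) = (S y, 0) := Prod.ext rfl (map_zero J)
  rw [h1]
  simpa [Prod.norm_mk] using hlt

end Prod

/-- If `R - S` is compact then so is `R ^ n - S ^ n`. -/
theorem isCompactOperator_pow_sub_pow {X : Type*} [NormedAddCommGroup X] [NormedSpace ℝ X]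
    {R S : X →L[ℝ] X} (h : IsCompactOperator (R - S)) (n : ℕ) :
    IsCompactOperator (R ^ n - S ^ n) := by
  induction n with
  | zero => simpa using isCompactOperator_zero
  | succ n ih =>
    have h1 : R ^ (n + 1) - S ^ (n + 1) = R ^ n * (R - S) + (R ^ n - S ^ n) * S := by
      rw [pow_succ, pow_succ]; noncomm_ring
    rw [h1]
    exact (h.clm_comp (R ^ n)).add (ih.comp_clm S)

section Reduction

variable {X : Type*} [NormedAddCommGroup X] [NormedSpace ℝ X] {S : X →L[ℝ] X}

/-- The operators on `X × F` are those of `X` up to compact operators. -/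
theorem exists_prodMap_add_compact {F : Type*} [NormedAddCommGroup F] [NormedSpace ℝ F]
    [FiniteDimensional ℝ F] (J : F →L[ℝ] F)
    (h : ∀ T : X →L[ℝ] X, ∃ (s t : ℝ) (K : X →L[ℝ] X), IsCompactOperator K ∧ T = s • 1 + t • S + K)
    (T : X × F →L[ℝ] X × F) :
    ∃ (s t : ℝ) (K : X × F →L[ℝ] X × F), IsCompactOperator K ∧ T = s • 1 + t • S.prodMap J + K := by
  obtain ⟨s, t, K, hK, hT⟩ := h
    ((ContinuousLinearMap.fst ℝ X F).comp (T.comp (ContinuousLinearMap.inl ℝ X F)))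
  refine ⟨s, t, T - (s • 1 + t • S.prodMap J), isCompactOperator_of_corner ?_, by abel⟩
  refine (congrArg IsCompactOperator (funext fun x => ?_)).mpr hK
  have h1 : (T (x, 0)).1 = s • x + t • S x + K x := congrArg (fun P : X →L[ℝ] X => P x) hT
  change (T (x, 0)).1 - (s • x + t • S x) = K x
  rw [h1]
  abel

theorem exists_invariant [CompleteSpace X] (hX : ¬FiniteDimensional ℝ X) {k : ℕ} (hS : S ^ k = 0)
    {T K : X →L[ℝ] X} (hK : IsCompactOperator K) {s t : ℝ} (hT : T = s • 1 + t • S + K) :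
    ∃ W : Submodule ℝ X, IsClosed (W : Set X) ∧ W ≠ ⊥ ∧ W ≠ ⊤ ∧ ∀ w ∈ W, T w ∈ W := by
  have h1 := isCompactOperator_pow_sub_pow (R := t • S + K) (S := t • S) (by simpa using hK) k
  rw [smul_pow, hS, smul_zero, sub_zero] at h1
  obtain ⟨W, hc, hb, ht, hW⟩ := exists_invariant_of_compact_pow hX _ k h1
  refine ⟨W, hc, hb, ht, fun w hw => ?_⟩
  have h2 : T w = s • w + (t • S + K) w := by rw [hT, add_assoc]; rfl
  rw [h2]
  exact W.add_mem (W.smul_mem s hw) (hW w hw)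

end Reduction

end BD

theorem stmt6 (k : ℕ) (hk : 2 ≤ k) :
    ∃ (X : Type) (_ : NormedAddCommGroup X) (_ : NormedSpace ℝ X),
      CompleteSpace X ∧ TopologicalSpace.SeparableSpace X ∧ ¬FiniteDimensional ℝ X ∧
      ∃ S : X →L[ℝ] X, S ^ k = 0 ∧ S ^ (k - 1) ≠ 0 ∧
        StrictlySingular S ∧ ¬IsCompactOperator S ∧
        (∀ T : X →L[ℝ] X, ∃ (lam : Fin k → ℝ) (K : X →L[ℝ] X),
          IsCompactOperator K ∧ T = (∑ i : Fin k, lam i • S ^ (i : ℕ)) + K) ∧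
        (∀ T : X →L[ℝ] X, ∃ W : Submodule ℝ X,
          IsClosed (W : Set X) ∧ W ≠ ⊥ ∧ W ≠ ⊤ ∧ ∀ w ∈ W, T w ∈ W) := by
  obtain ⟨Γ⟩ := BD.nonempty_nodes
  let S₀ : Γ.X →L[ℝ] Γ.X := BD.Nodes.act BD.eps
  have hS₀ : S₀ ^ 2 = 0 := by
    ext u
    refine BD.Nodes.vec_injective ?_
    rw [pow_two, mul_apply_eq_comp, BD.Nodes.vec_act, BD.Nodes.vec_act, smul_smul, BD.eps_mul_eps,
      zero_smul]
    exact (map_zero BD.Nodes.vec).symm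
  have hT₀ : ∀ T : Γ.X →L[ℝ] Γ.X, ∃ (s t : ℝ) (K : Γ.X →L[ℝ] Γ.X),
      IsCompactOperator K ∧ T = s • 1 + t • S₀ + K := by
    intro T
    obtain ⟨a, K, hK, hT⟩ := BD.Nodes.exists_act_add_compact T
    refine ⟨BD.re a, BD.tau a, K, hK, ?_⟩
    rw [hT, ← BD.Nodes.act_mk, BD.mk_re_tau]
  have hss : StrictlySingular S₀ := fun Y hY c hc => BD.Nodes.exists_norm_act_eps_lt hY hc
  let S : Γ.X × (Fin k → ℝ) →L[ℝ] Γ.X × (Fin k → ℝ) := S₀.prodMap (BD.shift k)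
  have hSk : S ^ k = 0 := by
    rw [BD.prodMap_pow, BD.shift_pow_self, pow_eq_zero_of_le hk hS₀]
    rfl
  have hSc : ¬IsCompactOperator S := fun h => BD.Nodes.not_isCompactOperator_act_eps (Γ := Γ)
    ((h.comp_clm (ContinuousLinearMap.inl ℝ Γ.X (Fin k → ℝ))).clm_comp
      (ContinuousLinearMap.fst ℝ Γ.X (Fin k → ℝ)))
  have hX : ¬FiniteDimensional ℝ (Γ.X × (Fin k → ℝ)) := by
    intro h
    have : LocallyCompactSpace (Γ.X × (Fin k → ℝ)) := .of_finiteDimensional_of_complete ℝ _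
    exact hSc (isCompactOperator_of_locallyCompactSpace_dom S)
  refine ⟨Γ.X × (Fin k → ℝ), inferInstance, inferInstance, inferInstance, inferInstance, hX,
    S, hSk, ?_, BD.strictlySingular_prodMap _ hss, hSc, fun T => ?_, fun T => ?_⟩
  · intro h
    rw [BD.prodMap_pow] at h
    refine BD.shift_pow_pred_ne_zero (by omega : 0 < k) (ContinuousLinearMap.ext fun v => ?_)
    exact congrArg (fun P : Γ.X × (Fin k → ℝ) →L[ℝ] Γ.X × (Fin k → ℝ) => (P (0, v)).2) h
  · obtain ⟨s, t, K, hK, hT⟩ := BD.exists_prodMap_add_compact (BD.shift k) hT₀ T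
    refine ⟨fun i => if (i : ℕ) = 0 then s else if (i : ℕ) = 1 then t else 0, K, hK, ?_⟩
    rw [hT]
    congr 1
    rw [Fin.sum_univ_eq_sum_range
      (fun i => (if i = 0 then s else if i = 1 then t else 0) • S ^ i) k]
    obtain ⟨n, rfl⟩ := Nat.exists_eq_add_of_le' hk
    rw [Finset.sum_range_succ', Finset.sum_range_succ']
    simp [add_comm]
    rfl
  · obtain ⟨s, t, K, hK, hT⟩ := BD.exists_prodMap_add_compact (BD.shift k) hT₀ T
    exact BD.exists_invariant hX hSk hK hT
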